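/- arXiv:1110.5942 — 4 statements merged into one kernel-verified Lean document; each statement's English description precedes it below -/
import Mathlib

section
/- There exists a constant c > 0 such that for every nondeterministic generalized Büchi automaton A with n ≥ 1 states and index size k ≥ 1, there exists a deterministic Rabin automaton B over the same alphabet with L(B) = L(A), whose number of states is at most 2^{c·n·log₂(n·k+1)} and whose index size is at most n·(min(n,k)+1). -/
/-- The set of states occurring infinitely often in an infinite run. -/
def InfStates {Q : Type*} (ρ : ℕ → Q) : Set Q :=
  {q | ∀ N : ℕ, ∃ m : ℕ, N ≤ m ∧ ρ m = q}

namespace GBD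
open Classical

theorem inf_iff {X : Type} [Finite X] (ρ : ℕ → X) (A : Set X) :
    (InfStates ρ ∩ A).Nonempty ↔ ∀ N : ℕ, ∃ m, N ≤ m ∧ ρ m ∈ A := by
  constructor
  · rintro ⟨q, hq, hA⟩ N
    obtain ⟨m, hm, rfl⟩ := hq N
    exact ⟨m, hm, hA⟩
  · intro h
    by_contra hne
    have h1 : ∀ q : X, ∃ N : ℕ, q ∈ A → ∀ m, N ≤ m → ρ m ≠ q := by
      intro q
      by_cases hq : q ∈ A
      · have : q ∉ InfStates ρ := fun h' => hne ⟨q, h', hq⟩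
        simp only [InfStates, Set.mem_ofPred_eq] at this
        push Not at this
        obtain ⟨N, hN⟩ := this
        exact ⟨N, fun _ => hN⟩
      · exact ⟨0, fun h' => absurd h' hq⟩
    choose N hN using h1
    have := Fintype.ofFinite X
    obtain ⟨m, hm, hmA⟩ := h (Finset.univ.sup N)
    exact hN (ρ m) hmA m (le_trans (Finset.le_sup (Finset.mem_univ _)) hm) rfl

/-- König's lemma for backward-closed level sets. -/
theorem konig {X : Type} [Finite X] (V : ℕ → X → Prop) (E : ℕ → X → X → Prop)
    (hV : ∀ t q', V (t + 1) q' → ∃ q, V t q ∧ E t q q')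
    (hne : ∀ N, ∃ m, N ≤ m ∧ ∃ q, V m q) :
    ∃ ρ : ℕ → X, (∀ t, V t (ρ t)) ∧ ∀ t, E t (ρ t) (ρ (t + 1)) := by
  have hback : ∀ N q, V N q → ∃ x : ℕ → X, x N = q ∧ (∀ t ≤ N, V t (x t)) ∧
      ∀ t < N, E t (x t) (x (t + 1)) := by
    intro N
    induction N with
    | zero => 
      intro q hq
      refine ⟨fun _ => q, rfl, ?_, by simp⟩
      intro t ht
      obtain rfl : t = 0 := by omega
      exact hq
    | succ N ih =>
      intro q' hq'
      obtain ⟨q, hq, hE⟩ := hV N q' hq'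
      obtain ⟨x, hx, hx1, hx2⟩ := ih q hq
      refine ⟨fun t => if t ≤ N then x t else q', by simp, ?_, ?_⟩
      · intro t ht
        by_cases h : t ≤ N
        · simpa [h] using hx1 t h
        · obtain rfl : t = N + 1 := by omega
          simpa using hq'
      · intro t ht
        by_cases h : t + 1 ≤ N
        · have h' : t ≤ N := by omega
          simpa [h, h'] using hx2 t (by omega)
        · obtain rfl : t = N := by omega
          simpa [hx] using hE
  have h1 : ∀ N, ∃ x : ℕ → X, (∀ t ≤ N, V t (x t)) ∧ ∀ t < N, E t (x t) (x (t + 1)) := by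
    intro N
    obtain ⟨m, hm, q, hq⟩ := hne N
    obtain ⟨x, -, hx1, hx2⟩ := hback m q hq
    exact ⟨x, fun t ht => hx1 t (by omega), fun t ht => hx2 t (by omega)⟩
  choose x hx1 hx2 using h1
  have h2 : ∀ t, ∃ q, ∀ᶠ N in (Filter.hyperfilter ℕ : Filter ℕ), x N t = q := by
    intro t
    obtain ⟨q, hq⟩ := Ultrafilter.eq_pure_of_finite ((Filter.hyperfilter ℕ).map (fun N => x N t))
    refine ⟨q, ?_⟩
    have : ({q} : Set X) ∈ (Filter.hyperfilter ℕ).map (fun N => x N t) := by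
      rw [hq]; simp
    exact this
  choose ρ hρ using h2
  have hge : ∀ t : ℕ, ∀ᶠ N in (Filter.hyperfilter ℕ : Filter ℕ), t < N := by
    intro t
    have : ∀ᶠ N in (Filter.cofinite : Filter ℕ), t < N := by
      rw [Nat.cofinite_eq_atTop]; exact Filter.eventually_gt_atTop t
    exact Filter.hyperfilter_le_cofinite this
  refine ⟨ρ, ?_, ?_⟩
  · intro t
    obtain ⟨N, h1, h2⟩ := ((hρ t).and (hge t)).exists
    rw [← h1]; exact hx1 N t h2.le
  · intro t
    obtain ⟨N, ⟨h1, h3⟩, h2⟩ := (((hρ t).and (hρ (t+1))).and (hge t)).exists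
    rw [← h1, ← h3]; exact hx2 N t h2

structure St (Q : Type) (k : ℕ) where
  L : ℕ → Set Q
  idx : ℕ → Fin k
  G : ℕ → Prop
  R : ℕ → Prop

structure Valid {Q : Type} {k : ℕ} (n : ℕ) (z : Fin k) (s : St Q k) : Prop where
  lam : ∀ v w q, v < w → q ∈ s.L v → q ∈ s.L w → s.L w ⊆ s.L v
  emp : ∀ v, n ≤ v → s.L v = ∅
  idx : ∀ v, n ≤ v → s.idx v = z
  g : ∀ v, s.G v → v < n
  r : ∀ v, s.R v → v < n

theorem exists_best {Q : Type} [Finite Q] (L : ℕ → Set Q) (T : Q → Q → Prop) :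
    ∃ f : Q → Q, ∀ q q', T q q' → T (f q') q' ∧
      ((∀ x, f q' ∈ L x ↔ q ∈ L x) ∨
        ∃ u, f q' ∈ L u ∧ q ∉ L u ∧ ∀ x < u, (f q' ∈ L x ↔ q ∈ L x)) := by
  have h : ∀ q', ∃ p, ∀ q, T q q' → T p q' ∧
      ((∀ x, p ∈ L x ↔ q ∈ L x) ∨
        ∃ u, p ∈ L u ∧ q ∉ L u ∧ ∀ x < u, (p ∈ L x ↔ q ∈ L x)) := by
    intro q'
    by_cases hne : ∃ q, T q q'
    · let F : Q → Lex (ℕ → Prop) := fun q => toLex (fun x => q ∈ L x)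
      obtain ⟨p, hp, hmax⟩ := Set.exists_max_image {q | T q q'} F (Set.toFinite _) hne
      refine ⟨p, fun q hq => ⟨hp, ?_⟩⟩
      rcases (hmax q hq).eq_or_lt with h | h
      · left
        intro x
        have := congrFun (toLex.injective h) x
        exact (iff_of_eq this).symm
      · right
        obtain ⟨u, hu, hlt⟩ := h
        have h3 : ((q ∈ L u) → (p ∈ L u)) ∧ ¬ ((p ∈ L u) → (q ∈ L u)) :=
          lt_iff_le_not_ge.1 hlt
        refine ⟨u, ?_, ?_, fun x hx => (iff_of_eq (hu x hx)).symm⟩ <;> tauto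
    · exact ⟨q', fun q hq => absurd ⟨q, hq⟩ hne⟩
  choose f hf using h
  exact ⟨f, fun q q' => hf q' q⟩

noncomputable def best {Q : Type} [Finite Q] (L : ℕ → Set Q) (T : Q → Q → Prop) : Q → Q :=
  (exists_best L T).choose

theorem best_spec {Q : Type} [Finite Q] (L : ℕ → Set Q) (T : Q → Q → Prop) (q q') (h : T q q') :
    T (best L T q') q' ∧
      ((∀ x, best L T q' ∈ L x ↔ q ∈ L x) ∨
        ∃ u, best L T q' ∈ L u ∧ q ∉ L u ∧ ∀ x < u, (best L T q' ∈ L x ↔ q ∈ L x)) :=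
  (exists_best L T).choose_spec q q' h

section step
variable {Q : Type} [Finite Q] {k : ℕ} (n : ℕ) (z : Fin k) (nxt : Fin k → Fin k)
  (B : Fin k → Set Q) (s : St Q k) (T : Q → Q → Prop)

def L1 (v : ℕ) : Set Q := {q' | (∃ q, T q q') ∧ best s.L T q' ∈ s.L v}

def L2 (v : ℕ) : Set Q :=
  if v < n then L1 s T v else
    {q | q ∈ L1 s T (v - n) ∧ (∀ w, v - n < w → q ∉ L1 s T w) ∧ q ∈ B (s.idx (v - n))}

def green (v : ℕ) : Prop :=
  (L2 n B s T v).Nonempty ∧ ∀ q ∈ L2 n B s T v, ∃ w, v < w ∧ q ∈ L2 n B s T w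

def L3 (w : ℕ) : Set Q :=
  {q | q ∈ L2 n B s T w ∧ ∀ v, v < w → green n B s T v → q ∉ L2 n B s T v}

def live (v : ℕ) : Prop := (L3 n B s T v).Nonempty

noncomputable def step : St Q k where
  L i := {q | ∃ v, q ∈ L3 n B s T v ∧ Nat.count (live n B s T) v = i}
  idx i := if i < n then (if live n B s T i ∧ green n B s T i then nxt (s.idx i) else s.idx i)
    else z
  G i := i < n ∧ live n B s T i ∧ green n B s T i
  R i := i < n ∧ ∃ u ≤ i, ¬ live n B s T u

variable {n z nxt B s T}

theorem L2_lt {v : ℕ} (h : v < n) : L2 n B s T v = L1 s T v := by simp [L2, h]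

theorem L2_ge {v : ℕ} {q : Q} (h : n ≤ v) (hq : q ∈ L2 n B s T v) :
    q ∈ L1 s T (v - n) ∧ (∀ w, v - n < w → q ∉ L1 s T w) ∧ q ∈ B (s.idx (v - n)) := by
  rw [L2, if_neg (not_lt.2 h)] at hq
  exact hq

theorem L2_fresh {v : ℕ} {q : Q} (h1 : q ∈ L1 s T v) (h2 : ∀ w, v < w → q ∉ L1 s T w)
    (h3 : q ∈ B (s.idx v)) : q ∈ L2 n B s T (n + v) := by
  simp only [L2, show ¬ (n + v < n) by omega, if_false, Nat.add_sub_cancel_left]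
  exact ⟨h1, h2, h3⟩

theorem L1_pred {v : ℕ} {q' : Q} (h : q' ∈ L1 s T v) :
    T (best s.L T q') q' ∧ best s.L T q' ∈ s.L v := by
  obtain ⟨⟨q, hq⟩, h2⟩ := h
  exact ⟨(best_spec s.L T q q' hq).1, h2⟩

theorem L1_lt (hs : Valid n z s) {v : ℕ} {q : Q} (h : q ∈ L1 s T v) : v < n := by
  by_contra hv
  have := h.2
  rw [hs.emp v (by omega)] at this
  exact this

theorem L1_lam (hs : Valid n z s) {v w : ℕ} {q p : Q} (h : v < w) (h1 : q ∈ L1 s T v)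
    (h2 : q ∈ L1 s T w) (h3 : p ∈ L1 s T w) : p ∈ L1 s T v :=
  ⟨h3.1, hs.lam v w _ h h1.2 h2.2 h3.2⟩

theorem L2_lam (hs : Valid n z s) {v w : ℕ} {q p : Q} (h : v < w) (h1 : q ∈ L2 n B s T v)
    (h2 : q ∈ L2 n B s T w) (h3 : p ∈ L2 n B s T w) : p ∈ L2 n B s T v := by
  by_cases hw : w < n
  · have hv : v < n := by omega
    rw [L2_lt hw] at h2 h3
    rw [L2_lt hv] at h1 ⊢
    exact L1_lam hs h h1 h2 h3
  · push Not at hw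
    obtain ⟨a1, a2, a3⟩ := L2_ge hw h2
    obtain ⟨b1, b2, b3⟩ := L2_ge hw h3
    by_cases hv : v < n
    · rw [L2_lt hv] at h1 ⊢
      rcases lt_trichotomy v (w - n) with h' | h' | h'
      · exact L1_lam hs h' h1 a1 b1
      · rw [h']; exact b1
      · exact absurd h1 (a2 v h')
    · push Not at hv
      obtain ⟨c1, c2, c3⟩ := L2_ge hv h1
      exact absurd a1 (c2 _ (by omega))

theorem L3_lam (hs : Valid n z s) {v w : ℕ} {q p : Q} (h : v < w) (h1 : q ∈ L3 n B s T v)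
    (h2 : q ∈ L3 n B s T w) (h3 : p ∈ L3 n B s T w) : p ∈ L3 n B s T v :=
  ⟨L2_lam hs h h1.1 h2.1 h3.1, fun x hx hg => h3.2 x (by omega) hg⟩

theorem L2_head {u : ℕ} {q : Q} (h : q ∈ L2 n B s T u) :
    ∃ x ≤ u, q ∈ L3 n B s T x ∧ (x = u ∨ green n B s T x) := by
  by_cases hg : ∃ x, x < u ∧ green n B s T x ∧ q ∈ L2 n B s T x
  · have hsp := Nat.find_spec hg
    refine ⟨Nat.find hg, hsp.1.le, ⟨hsp.2.2, ?_⟩, Or.inr hsp.2.1⟩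
    intro v hv hgv hq
    exact Nat.find_min hg hv ⟨by omega, hgv, hq⟩
  · push Not at hg
    exact ⟨u, le_rfl, ⟨h, fun v hv hgv => hg v hv hgv⟩, Or.inl rfl⟩

theorem live_host (hs : Valid n z s) {v : ℕ} (h : live n B s T v) :
    ∃ q, q ∈ L3 n B s T v ∧ ∀ w, v < w → q ∉ L3 n B s T w := by
  obtain ⟨q0, hq0⟩ := h
  by_cases hg : green n B s T v
  · exact ⟨q0, hq0, fun w hw h' => h'.2 v hw hg hq0.1⟩
  · have : ∃ q ∈ L2 n B s T v, ∀ w, v < w → q ∉ L2 n B s T w := by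
      by_contra hc
      push Not at hc
      exact hg ⟨⟨q0, hq0.1⟩, hc⟩
    obtain ⟨q, hq, hw⟩ := this
    exact ⟨q, ⟨hq, fun u hu hgu hqu => hq0.2 u hu hgu (L2_lam hs hu hqu hq hq0.1)⟩,
      fun w h1 h2 => hw w h1 h2.1⟩

theorem count_live_le [Nonempty Q] (hs : Valid n z s) (hn : Nat.card Q = n) (m : ℕ) :
    Nat.count (live n B s T) m ≤ n := by
  have := Fintype.ofFinite Q
  have h : ∀ u, ∃ q, live n B s T u → q ∈ L3 n B s T u ∧ ∀ w, u < w → q ∉ L3 n B s T w := by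
    intro u
    by_cases hu : live n B s T u
    · obtain ⟨q, hq⟩ := live_host hs hu
      exact ⟨q, fun _ => hq⟩
    · exact ⟨Classical.arbitrary Q, fun h' => absurd h' hu⟩
  choose f hf using h
  rw [Nat.count_eq_card_filter_range]
  refine le_trans ?_ (le_of_eq ((Nat.card_eq_fintype_card (α := Q)).symm.trans hn))
  refine Finset.card_le_card_of_injOn f (by simp) ?_
  intro a ha b hb hab
  simp only [Finset.coe_filter, Set.mem_ofPred_eq] at ha hb
  obtain ⟨a1, a2⟩ := hf a ha.2
  obtain ⟨b1, b2⟩ := hf b hb.2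
  rcases lt_trichotomy a b with h | h | h
  · exact absurd (hab ▸ b1) (a2 b h)
  · exact h
  · exact absurd (hab ▸ a1) (b2 a h)

theorem step_valid [Nonempty Q] (hs : Valid n z s) (hn : Nat.card Q = n) :
    Valid n z (step n z nxt B s T) where
  lam := by
    rintro i j q hij ⟨v, hv, rfl⟩ ⟨w, hw, rfl⟩ p ⟨w', hp, hw'⟩
    have hvw : v < w := by
      by_contra hc
      exact absurd (Nat.count_monotone (live n B s T) (not_lt.1 hc)) (by omega)
    obtain rfl : w' = w := Nat.count_injective ⟨p, hp⟩ ⟨q, hw⟩ hw'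
    exact ⟨v, L3_lam hs hvw hv hw hp, rfl⟩
  emp := by
    intro i hi
    ext q
    simp only [Set.mem_empty_iff_false, iff_false]
    rintro ⟨v, hv, rfl⟩
    have := count_live_le (B := B) (T := T) hs hn (v + 1)
    rw [Nat.count_succ, if_pos (show live n B s T v from ⟨q, hv⟩)] at this
    omega
  idx := by
    intro v hv
    simp [step, not_lt.2 hv]
  g := fun v hv => hv.1
  r := fun v hv => hv.1

theorem count_eq {v : ℕ} (h : ∀ u < v, live n B s T u) : Nat.count (live n B s T) v = v :=
  Nat.count_iff_forall.2 h

theorem notR {v : ℕ} (hv : v < n) (h : ¬ (step n z nxt B s T).R v) :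
    ∀ u ≤ v, live n B s T u := by
  intro u hu
  by_contra hc
  exact h ⟨hv, u, hu, hc⟩

theorem notR_mem {v : ℕ} (hv : ∀ u ≤ v, live n B s T u) {q : Q} :
    q ∈ (step n z nxt B s T).L v ↔ q ∈ L3 n B s T v := by
  constructor
  · rintro ⟨x, hx, hc⟩
    have h1 : Nat.count (live n B s T) v = v := count_eq fun u hu => hv u hu.le
    obtain rfl : x = v := Nat.count_injective ⟨q, hx⟩ (hv v le_rfl) (hc.trans h1.symm)
    exact hx
  · intro h
    exact ⟨v, h, count_eq fun u hu => hv u hu.le⟩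

theorem step_pred {i : ℕ} {q' : Q} (h : q' ∈ (step n z nxt B s T).L i) :
    ∃ q, T q q' ∧ ∃ u, q ∈ s.L u := by
  obtain ⟨v, hv, -⟩ := h
  by_cases hn : v < n
  · have := hv.1
    rw [L2_lt hn] at this
    exact ⟨_, (L1_pred this).1, _, (L1_pred this).2⟩
  · have := (L2_ge (not_lt.1 hn) hv.1).1
    exact ⟨_, (L1_pred this).1, _, (L1_pred this).2⟩

theorem step_sound {v : ℕ} (hv : v < n) (hR : ¬ (step n z nxt B s T).R v) {q' : Q}
    (h : q' ∈ (step n z nxt B s T).L v) :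
    ∃ q, q ∈ s.L v ∧ T q q' ∧
      (((∃ w, v < w ∧ q' ∈ (step n z nxt B s T).L w) ∨ (step n z nxt B s T).G v) →
        (∃ w, v < w ∧ q ∈ s.L w) ∨ q' ∈ B (s.idx v)) := by
  have hl := notR hv hR
  rw [notR_mem hl] at h
  have h2 := h.1
  have h1 := h.1
  rw [L2_lt hv] at h1
  refine ⟨_, (L1_pred h1).2, (L1_pred h1).1, ?_⟩
  intro hc
  have : ∃ w, v < w ∧ q' ∈ L2 n B s T w := by
    rcases hc with ⟨i, hi, x, hx, rfl⟩ | hG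
    · exact ⟨x, lt_of_lt_of_le hi (Nat.count_le _), hx.1⟩
    · exact hG.2.2.2 q' h2
  obtain ⟨w, hw, hq⟩ := this
  by_cases hwn : w < n
  · rw [L2_lt hwn] at hq
    exact Or.inl ⟨w, hw, hq.2⟩
  · obtain ⟨a1, a2, a3⟩ := L2_ge (not_lt.1 hwn) hq
    rcases lt_trichotomy v (w - n) with h' | h' | h'
    · exact Or.inl ⟨_, h', a1.2⟩
    · right; rw [h']; exact a3
    · exact absurd h1 (a2 v h')

theorem step_G_shallow {v : ℕ} (hG : (step n z nxt B s T).G v) 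
    (hR : ¬ (step n z nxt B s T).R v) {q' : Q}
    (h : q' ∈ (step n z nxt B s T).L v) : ¬ ∃ w, v < w ∧ q' ∈ (step n z nxt B s T).L w := by
  rintro ⟨i, hi, x, hx, rfl⟩
  rw [notR_mem (notR hG.1 hR)] at h
  exact hx.2 v (lt_of_lt_of_le hi (Nat.count_le _)) hG.2.2 h.1

theorem step_idx_G {v : ℕ} (hG : (step n z nxt B s T).G v) :
    (step n z nxt B s T).idx v = nxt (s.idx v) := by
  have h1 := hG.1
  have h2 := hG.2
  simp [step, h1, h2]

theorem step_idx_nG {v : ℕ} (hv : v < n) (hG : ¬ (step n z nxt B s T).G v) :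
    (step n z nxt B s T).idx v = s.idx v := by
  have : ¬ (live n B s T v ∧ green n B s T v) := fun h => hG ⟨hv, h⟩
  simp only [step, hv, if_true, if_neg this]

theorem step_keep (hs : Valid n z s) {v : ℕ} {q q' : Q} (hT : T q q') (hq : q ∈ s.L v)
    (hP : ∀ u < v, (q' ∈ (step n z nxt B s T).L u ↔ q ∈ s.L u))
    (hG : ∀ u < v, q ∈ s.L u → ¬ (step n z nxt B s T).G u) :
    q' ∈ (step n z nxt B s T).L v ∧ ¬ (step n z nxt B s T).R v := by
  have hvn : v < n := by
    by_contra hc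
    rw [hs.emp v (by omega)] at hq
    exact hq
  obtain ⟨u0, hu0v, hu0, hagree, hlast⟩ : ∃ u0 ≤ v, q' ∈ L1 s T u0 ∧
      (∀ x < u0, (q' ∈ L1 s T x ↔ q ∈ s.L x)) ∧ (u0 = v ∨ q ∉ s.L u0) := by
    have hmem : ∀ x, q' ∈ L1 s T x ↔ best s.L T q' ∈ s.L x :=
      fun x => ⟨fun h => h.2, fun h => ⟨⟨q, hT⟩, h⟩⟩
    simp only [hmem]
    rcases (best_spec s.L T q q' hT).2 with h | ⟨u, h1, h2, h3⟩
    · exact ⟨v, le_rfl, (h v).2 hq, fun x _ => h x, Or.inl rfl⟩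
    · by_cases huv : u ≤ v
      · exact ⟨u, huv, h1, h3, Or.inr h2⟩
      · exact ⟨v, le_rfl, (h3 v (by omega)).2 hq, fun x hx => h3 x (by omega), Or.inl rfl⟩
  have hu2 : q' ∈ L2 n B s T u0 := by rw [L2_lt (by omega)]; exact hu0
  -- a green node below u0 containing q' with everything up to it live is impossible
  have key : ∀ x < u0, (∀ y ≤ x, live n B s T y) → green n B s T x → q' ∈ L3 n B s T x → False := by
    intro x hx hl hg h3
    have h1 := h3.1
    rw [L2_lt (by omega)] at h1
    exact hG x (by omega) ((hagree x hx).1 h1) ⟨by omega, hl x le_rfl, hg⟩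
  by_cases hd : ∃ d, d ≤ u0 ∧ ¬ live n B s T d
  · exfalso
    obtain ⟨hdu, hdead⟩ := Nat.find_spec hd
    have hmin : ∀ y < Nat.find hd, live n B s T y := by
      intro y hy
      by_contra hc
      exact Nat.find_min hd hy ⟨by omega, hc⟩
    set d := Nat.find hd
    have hd2 : q' ∉ L2 n B s T d := by
      intro h
      obtain ⟨x, hx, hx3, hxg⟩ := L2_head h
      have hxd : x ≠ d := by rintro rfl; exact hdead ⟨q', hx3⟩
      have hg := hxg.resolve_left hxd
      exact key x (by omega) (fun y hy => hmin y (by omega)) hg hx3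
    have hne : ∃ y, d < y ∧ y ≤ u0 ∧ q' ∈ L3 n B s T y := by
      obtain ⟨x, hx, hx3, hxg⟩ := L2_head hu2
      refine ⟨x, ?_, hx, hx3⟩
      by_contra hc
      have hxd : x ≠ d := by rintro rfl; exact hdead ⟨q', hx3⟩
      rcases hxg with h | h
      · omega
      · exact key x (by omega) (fun y hy => hmin y (by omega)) h hx3
    obtain ⟨hy1, hy2, hy3⟩ := Nat.find_spec hne
    have hymin : ∀ x, d < x → x < Nat.find hne → q' ∉ L3 n B s T x := by
      intro x hx hxy h3
      exact Nat.find_min hne hxy ⟨hx, by omega, h3⟩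
    set y := Nat.find hne
    have hdc : d ≤ Nat.count (live n B s T) y := by
      have := Nat.count_monotone (live n B s T) hy1.le
      rwa [count_eq hmin] at this
    have hcy : Nat.count (live n B s T) y < y := by
      refine lt_of_le_of_ne (Nat.count_le _) fun h => ?_
      exact hdead (Nat.count_iff_forall.1 h d hy1)
    set c := Nat.count (live n B s T) y with hc
    have hc' : q' ∈ (step n z nxt B s T).L c := ⟨y, hy3, rfl⟩
    have hc1 : q' ∈ L1 s T c := (hagree c (by omega)).2 ((hP c (by omega)).1 hc')
    have hc2 : q' ∈ L2 n B s T c := by rw [L2_lt (by omega)]; exact hc1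
    have hdc' : d ≠ c := by intro h; rw [h] at hd2; exact hd2 hc2
    obtain ⟨x, hx, hx3, hxg⟩ := L2_head hc2
    by_cases hxd : d < x
    · exact hymin x hxd (by omega) hx3
    · have hxd' : x ≠ d := by rintro rfl; exact hd2 hx3.1
      exact key x (by omega) (fun y hy => hmin y (by omega)) (hxg.resolve_left (by omega)) hx3
  · push Not at hd
    have hu3 : q' ∈ L3 n B s T u0 := by
      obtain ⟨x, hx, hx3, hxg⟩ := L2_head hu2
      rcases eq_or_ne x u0 with rfl | hne
      · exact hx3
      · exact absurd hx3 fun h =>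
          key x (by omega) (fun y hy => hd y (by omega)) (hxg.resolve_left hne) h
    have hu' : q' ∈ (step n z nxt B s T).L u0 := (notR_mem hd).2 hu3
    obtain rfl : u0 = v := by
      rcases hlast with h | h
      · exact h
      · by_contra hne
        exact h ((hP u0 (by omega)).1 hu')
    exact ⟨hu', fun hR => by obtain ⟨-, u, hu, hnl⟩ := hR; exact hnl (hd u hu)⟩

theorem step_ext (hs : Valid n z s) {v : ℕ} {q' : Q} (hv : v < n)
    (hR : ¬ (step n z nxt B s T).R v) (hq : q' ∈ (step n z nxt B s T).L v)
    (hmax : ∀ w, v < w → q' ∉ (step n z nxt B s T).L w)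
    (hG : ∀ u ≤ v, q' ∈ (step n z nxt B s T).L u → ¬ (step n z nxt B s T).G u) :
    q' ∉ B (s.idx v) := by
  intro hB
  have hl := notR hv hR
  have h3 := (notR_mem hl).1 hq
  have h1 := h3.1
  rw [L2_lt hv] at h1
  have key : ∀ w, v < w → q' ∉ L2 n B s T w := by
    intro w hw h2
    obtain ⟨x, hx, hx3, hxg⟩ := L2_head h2
    by_cases hxv : x ≤ v
    · have hlx : ∀ u ≤ x, live n B s T u := fun u hu => hl u (by omega)
      exact hG x hxv ((notR_mem hlx).2 hx3)
        ⟨by omega, hl x hxv, hxg.resolve_left (by omega)⟩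
    · refine hmax (Nat.count (live n B s T) x) ?_ ⟨x, hx3, rfl⟩
      have := Nat.count_strict_mono (hl v le_rfl) (show v < x by omega)
      rwa [count_eq fun u hu => hl u hu.le] at this
  have key1 : ∀ w, v < w → q' ∉ L1 s T w := by
    intro w hw h
    exact key w hw (by rw [L2_lt (L1_lt hs h)]; exact h)
  exact key (n + v) (by omega) (L2_fresh h1 key1 hB)

end step

/-! ### Encoding of states -/

noncomputable def mb {Q : Type} (L : ℕ → Set Q) (w : ℕ) (q : Q) : ℕ :=
  Nat.findGreatest (fun i => ∃ v, i = v + 1 ∧ q ∈ L v) w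

theorem mb_le {Q : Type} (L : ℕ → Set Q) (w : ℕ) (q : Q) : mb L w q ≤ w :=
  Nat.findGreatest_le _

theorem mb_above {Q : Type} {L : ℕ → Set Q} {w v : ℕ} {q : Q} (h1 : mb L w q ≤ v) (h2 : v < w) :
    q ∉ L v := by
  intro h
  have := Nat.findGreatest_is_greatest (P := fun i => ∃ v, i = v + 1 ∧ q ∈ L v) (n := w)
    (k := v + 1) (by unfold mb at h1; omega) (by omega)
  exact this ⟨v, rfl, h⟩

theorem mb_mem {Q : Type} {L : ℕ → Set Q} {w v : ℕ} {q : Q} (h : mb L w q = v + 1) :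
    q ∈ L v := by
  obtain ⟨x, hx, hq⟩ := Nat.findGreatest_of_ne_zero h (by omega)
  obtain rfl : v = x := by omega
  exact hq

noncomputable def par {Q : Type} (L : ℕ → Set Q) (w : ℕ) : ℕ :=
  if h : (L w).Nonempty then mb L w h.some else 0

theorem par_le {Q : Type} (L : ℕ → Set Q) (w : ℕ) : par L w ≤ w := by
  unfold par; split
  · exact mb_le _ _ _
  · omega

theorem mb_congr {Q : Type} {L L' : ℕ → Set Q} {w : ℕ} {q p : Q}
    (h : ∀ v < w, (q ∈ L v ↔ p ∈ L' v)) : mb L w q = mb L' w p := by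
  apply le_antisymm
  · by_contra hc
    push Not at hc
    obtain ⟨v, hv⟩ : ∃ v, mb L w q = v + 1 := ⟨mb L w q - 1, by omega⟩
    have h1 := mb_mem hv
    have h2 := mb_le L w q
    exact mb_above (L := L') (w := w) (q := p) (v := v) (by omega) (by omega) ((h v (by omega)).1 h1)
  · by_contra hc
    push Not at hc
    obtain ⟨v, hv⟩ : ∃ v, mb L' w p = v + 1 := ⟨mb L' w p - 1, by omega⟩
    have h1 := mb_mem hv
    have h2 := mb_le L' w p
    exact mb_above (L := L) (w := w) (q := q) (v := v) (by omega) (by omega) ((h v (by omega)).2 h1)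

theorem par_eq {Q : Type} {k n : ℕ} {z : Fin k} {s : St Q k} (hs : Valid n z s) {w : ℕ} {q : Q}
    (hq : q ∈ s.L w) : par s.L w = mb s.L w q := by
  have hne : (s.L w).Nonempty := ⟨q, hq⟩
  unfold par
  rw [dif_pos hne]
  apply mb_congr
  intro v hv
  exact ⟨fun h => hs.lam v w _ hv h hne.some_mem hq, fun h => hs.lam v w _ hv h hq hne.some_mem⟩

theorem L_inj {Q : Type} {k n : ℕ} {z : Fin k} {s s' : St Q k} (hs : Valid n z s)
    (hs' : Valid n z s') (hpar : ∀ w < n, par s.L w = par s'.L w) (q : Q) :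
    ∀ w ≤ n, mb s.L w q = mb s'.L w q → ∀ v < w, (q ∈ s.L v ↔ q ∈ s'.L v) := by
  intro w
  induction w using Nat.strong_induction_on with
  | _ w ih =>
    intro hw hmb v hv
    by_cases hc : mb s.L w q ≤ v
    · exact iff_of_false (mb_above hc hv) (mb_above (hmb ▸ hc) hv)
    · obtain ⟨u, hu⟩ : ∃ u, mb s.L w q = u + 1 := ⟨mb s.L w q - 1, by omega⟩
      have h1 := mb_mem hu
      have h2 := mb_mem (hmb ▸ hu)
      have h3 := mb_le s.L w q
      rcases eq_or_ne v u with rfl | hne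
      · exact iff_of_true h1 h2
      · refine ih u (by omega) (by omega) ?_ v (by omega)
        rw [← par_eq hs h1, ← par_eq hs' h2]
        exact hpar u (by omega)

abbrev Code (Q : Type) (n k : ℕ) : Type :=
  (Q → Fin (n + 1)) × (Fin n → Fin (n + 1)) × (Fin n → Fin k) × (Fin n → Bool) × (Fin n → Bool)

noncomputable def enc {Q : Type} {k : ℕ} (n : ℕ) (s : St Q k) : Code Q n k :=
  (fun q => ⟨mb s.L n q, Nat.lt_succ_of_le (mb_le _ _ _)⟩,
   fun w => ⟨par s.L w, lt_of_le_of_lt (par_le _ _) (Nat.lt_succ_of_lt w.2)⟩,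
   fun w => s.idx w, fun w => decide (s.G w), fun w => decide (s.R w))

theorem enc_inj {Q : Type} {k n : ℕ} {z : Fin k} {s s' : St Q k} (hs : Valid n z s)
    (hs' : Valid n z s') (h : enc n s = enc n s') : s = s' := by
  simp only [enc, Prod.mk.injEq, funext_iff, Fin.mk.injEq, decide_eq_decide] at h
  obtain ⟨h1, h2, h3, h4, h5⟩ := h
  have hL : s.L = s'.L := by
    funext v
    by_cases hv : v < n
    · ext q
      exact L_inj hs hs' (fun w hw => h2 ⟨w, hw⟩) q n le_rfl (h1 q) v hv
    · rw [hs.emp v (by omega), hs'.emp v (by omega)]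
  have hi : s.idx = s'.idx := by
    funext v
    by_cases hv : v < n
    · exact h3 ⟨v, hv⟩
    · rw [hs.idx v (by omega), hs'.idx v (by omega)]
  have hg : s.G = s'.G := by
    funext v
    by_cases hv : v < n
    · exact propext (h4 ⟨v, hv⟩)
    · exact propext (iff_of_false (fun h => hv (hs.g v h)) (fun h => hv (hs'.g v h)))
  have hr : s.R = s'.R := by
    funext v
    by_cases hv : v < n
    · exact propext (h5 ⟨v, hv⟩)
    · exact propext (iff_of_false (fun h => hv (hs.r v h)) (fun h => hv (hs'.r v h)))
  cases s; cases s'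
  simp_all

def init {Q : Type} {k : ℕ} (z : Fin k) (Q₀ : Set Q) : St Q k where
  L v := {q | v = 0 ∧ q ∈ Q₀}
  idx _ := z
  G _ := False
  R _ := False

theorem init_valid {Q : Type} {k n : ℕ} (hn : 1 ≤ n) (z : Fin k) (Q₀ : Set Q) :
    Valid n z (init z Q₀) where
  lam := by
    rintro v w q h ⟨rfl, -⟩ ⟨rfl, -⟩
    omega
  emp := by
    intro v hv
    ext q
    simp only [Set.mem_empty_iff_false, iff_false]
    rintro ⟨rfl, -⟩
    omega
  idx _ _ := rfl
  g _ h := h.elim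
  r _ h := h.elim

theorem exists_nxt {k : ℕ} (hk : 1 ≤ k) : ∃ nxt : Fin k → Fin k, ∀ i j, ∃ d, nxt^[d + 1] i = j := by
  let nxt : Fin k → Fin k := fun i => ⟨(i + 1) % k, Nat.mod_lt _ hk⟩
  refine ⟨nxt, ?_⟩
  have h : ∀ d i, ((nxt^[d] i : Fin k) : ℕ) = (i + d) % k := by
    intro d
    induction d with
    | zero => intro i; simp [Nat.mod_eq_of_lt i.2]
    | succ d ih =>
      intro i
      rw [Function.iterate_succ_apply, ih]
      simp only [nxt]
      rw [Nat.mod_add_mod]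
      congr 1; omega
  intro i j
  refine ⟨j + k - i - 1, Fin.ext ?_⟩
  rw [h]
  have hi := i.2
  have : (i : ℕ) + (j + k - i - 1 + 1) = j + k := by omega
  rw [this, Nat.add_mod_right, Nat.mod_eq_of_lt j.2]

section run
variable {Q : Type} [Finite Q] {k : ℕ} {n : ℕ} {z : Fin k} {nxt : Fin k → Fin k}
  {B : Fin k → Set Q} {T : ℕ → Q → Q → Prop} {Q₀ : Set Q} {st : ℕ → St Q k}

theorem sound (hnxt : ∀ i j, ∃ d, nxt^[d + 1] i = j)
    (h0 : st 0 = init z Q₀) (hst : ∀ t, st (t + 1) = step n z nxt B (st t) (T t))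
    {v : ℕ} (hv : v < n) (hG : ∀ N, ∃ m, N ≤ m ∧ (st m).G v)
    (hR : ∃ N, ∀ m, N ≤ m → ¬ (st m).R v) :
    ∃ ρ : ℕ → Q, ρ 0 ∈ Q₀ ∧ (∀ i, T i (ρ i) (ρ (i + 1))) ∧
      ∀ j, ∀ N, ∃ m, N ≤ m ∧ ρ m ∈ B j := by
  obtain ⟨N0, hN0⟩ := hR
  let deep : ℕ → Q → Prop := fun t q => ∃ w, v < w ∧ q ∈ (st t).L w
  obtain ⟨ρ, hρV, hρE⟩ := konig
    (fun t q => (∃ u, q ∈ (st t).L u) ∧ (N0 ≤ t → q ∈ (st t).L v))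
    (fun t q q' => T t q q' ∧ (N0 ≤ t → (deep (t + 1) q' ∨ (st (t + 1)).G v) →
      deep t q ∨ q' ∈ B ((st t).idx v)))
    (by
      rintro t q' ⟨⟨u, hu⟩, h2⟩
      by_cases ht : N0 ≤ t
      · have hq := h2 (by omega)
        have hR := hN0 (t + 1) (by omega)
        rw [hst] at hq hR
        obtain ⟨q, a1, a2, a3⟩ := step_sound hv hR hq
        refine ⟨q, ⟨⟨v, a1⟩, fun _ => a1⟩, a2, fun _ => ?_⟩
        simpa only [deep, hst] using a3
      · rw [hst] at hu
        obtain ⟨q, hq, hu'⟩ := step_pred hu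
        exact ⟨q, ⟨hu', fun h => absurd h ht⟩, hq, fun h => absurd h ht⟩)
    (by
      intro N
      obtain ⟨m, hm, hg⟩ := hG (N + N0 + 1)
      obtain ⟨t, rfl⟩ : ∃ t, m = t + 1 := ⟨m - 1, by omega⟩
      have hR := hN0 (t + 1) (by omega)
      rw [hst] at hR hg
      obtain ⟨q, hq⟩ := hg.2.1
      have hq' := (notR_mem (z := z) (nxt := nxt) (notR hv hR)).2 hq
      rw [← hst] at hq'
      exact ⟨t + 1, by omega, q, ⟨v, hq'⟩, fun _ => hq'⟩)
  refine ⟨ρ, ?_, fun i => (hρE i).1, ?_⟩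
  · obtain ⟨u, hu⟩ := (hρV 0).1
    rw [h0] at hu
    exact hu.2
  -- index evolution
  have hidx : ∀ t, ¬ (st (t + 1)).G v → (st (t + 1)).idx v = (st t).idx v := by
    intro t h; rw [hst] at h ⊢; exact step_idx_nG hv h
  have hidxG : ∀ t, (st (t + 1)).G v → (st (t + 1)).idx v = nxt ((st t).idx v) := by
    intro t h; rw [hst] at h ⊢; exact step_idx_G h
  have hnext : ∀ t, ∃ t', t < t' ∧ (st t').G v ∧ (st t').idx v = nxt ((st t).idx v) := by
    intro t
    have hex : ∃ d, (st (t + d + 1)).G v := by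
      obtain ⟨m, hm, hg⟩ := hG (t + 1)
      exact ⟨m - t - 1, by rwa [show t + (m - t - 1) + 1 = m by omega]⟩
    have hc : ∀ d ≤ Nat.find hex, (st (t + d)).idx v = (st t).idx v := by
      intro d
      induction d with
      | zero => simp
      | succ d ih =>
        intro hd
        rw [← ih (by omega)]
        exact hidx (t + d) (Nat.find_min hex (by omega))
    refine ⟨t + Nat.find hex + 1, by omega, Nat.find_spec hex, ?_⟩
    rw [hidxG _ (Nat.find_spec hex), hc _ le_rfl]
  have hiter : ∀ d t, ∃ t', t < t' ∧ (st t').G v ∧ (st t').idx v = nxt^[d + 1] ((st t).idx v) := by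
    intro d
    induction d with
    | zero => intro t; simpa using hnext t
    | succ d ih =>
      intro t
      obtain ⟨t1, h1, -, h2⟩ := ih t
      obtain ⟨t2, h3, h4, h5⟩ := hnext t1
      refine ⟨t2, by omega, h4, ?_⟩
      rw [h5, h2, ← Function.iterate_succ_apply' nxt]
  intro j N
  by_contra hno
  push Not at hno
  obtain ⟨d, hd⟩ := hnxt ((st (N + N0 + 1)).idx v) j
  obtain ⟨t0, ht0, hg0, hi0⟩ := hiter d (N + N0 + 1)
  rw [hd] at hi0
  have hinv : ∀ e, ¬ deep (t0 + e) (ρ (t0 + e)) ∧ (st (t0 + e)).idx v = j := by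
    intro e
    induction e with
    | zero =>
      refine ⟨?_, hi0⟩
      obtain ⟨t, rfl⟩ : ∃ t, t0 = t + 1 := ⟨t0 - 1, by omega⟩
      have hR := hN0 (t + 1) (by omega)
      have hq := (hρV (t + 1)).2 (by omega)
      simp only [deep, Nat.add_zero]
      rw [hst] at hR hg0 hq ⊢
      exact step_G_shallow hg0 hR hq
    | succ e ih =>
      have h := (hρE (t0 + e)).2 (by omega)
      have hB := hno (t0 + e + 1) (by omega)
      rw [ih.2] at h
      have hc : ¬ (deep (t0 + e + 1) (ρ (t0 + e + 1)) ∨ (st (t0 + e + 1)).G v) :=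
        fun hc => (h hc).elim ih.1 hB
      exact ⟨fun h => hc (Or.inl h), (hidx (t0 + e) fun h => hc (Or.inr h)).trans ih.2⟩
  obtain ⟨m, hm, hg⟩ := hG (t0 + 1)
  obtain ⟨e, rfl⟩ : ∃ e, m = t0 + e + 1 := ⟨m - t0 - 1, by omega⟩
  have h := (hρE (t0 + e)).2 (by omega) (Or.inr hg)
  rw [(hinv e).2] at h
  exact h.elim (hinv e).1 (hno _ (by omega))

theorem complete (hval : ∀ t, Valid n z (st t))
    (h0 : st 0 = init z Q₀) (hst : ∀ t, st (t + 1) = step n z nxt B (st t) (T t))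
    {ρ : ℕ → Q} (hρ0 : ρ 0 ∈ Q₀) (hρ : ∀ i, T i (ρ i) (ρ (i + 1)))
    (hB : ∀ j, ∀ N, ∃ m, N ≤ m ∧ ρ m ∈ B j) :
    ∃ v < n, (∀ N, ∃ m, N ≤ m ∧ (st m).G v) ∧ ∃ N, ∀ m, N ≤ m → ¬ (st m).R v := by
  by_contra hno
  have hno' : ∀ v < n, (∃ N, ∀ m, N ≤ m → ¬ (st m).R v) → ∃ N, ∀ m, N ≤ m → ¬ (st m).G v := by
    intro v hv hR
    by_contra hc
    push Not at hc
    exact hno ⟨v, hv, hc, hR⟩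
  have hlt : ∀ t v, ρ t ∈ (st t).L v → v < n := by
    intro t v h
    by_contra hc
    rw [(hval t).emp v (by omega)] at h
    exact h
  have keep : ∀ t v, ρ t ∈ (st t).L v →
      (∀ u < v, (ρ (t + 1) ∈ (st (t + 1)).L u ↔ ρ t ∈ (st t).L u)) →
      (∀ u < v, ρ t ∈ (st t).L u → ¬ (st (t + 1)).G u) →
      ρ (t + 1) ∈ (st (t + 1)).L v ∧ ¬ (st (t + 1)).R v := by
    intro t v h1 h2 h3
    rw [hst] at h2 h3 ⊢
    exact step_keep (hval t) (hρ t) h1 h2 h3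
  have hroot : ∀ t, ρ t ∈ (st t).L 0 := by
    intro t
    induction t with
    | zero => rw [h0]; exact ⟨rfl, hρ0⟩
    | succ t ih => exact (keep t 0 ih (by simp) (by simp)).1
  have claim : ∀ m, ∃ N, ∀ t, N ≤ t → ∀ u < m, (ρ t ∈ (st t).L u ↔ ρ N ∈ (st N).L u) ∧
      (ρ t ∈ (st t).L u → ¬ (st t).G u ∧ ¬ (st t).R u) := by
    intro m
    induction m with
    | zero => exact ⟨0, by simp⟩
    | succ m ih =>
      obtain ⟨N, hN⟩ := ih
      by_cases hex : ∃ t1, N ≤ t1 ∧ ρ t1 ∈ (st t1).L m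
      · obtain ⟨t1, ht1, hm1⟩ := hex
        have hk : ∀ t, N ≤ t → ρ t ∈ (st t).L m →
            ρ (t + 1) ∈ (st (t + 1)).L m ∧ ¬ (st (t + 1)).R m := by
          intro t ht hmem
          have hiff : ∀ u < m, (ρ (t + 1) ∈ (st (t + 1)).L u ↔ ρ t ∈ (st t).L u) := fun u hu =>
            ((hN (t + 1) (by omega) u hu).1).trans ((hN t ht u hu).1).symm
          exact keep t m hmem hiff fun u hu h =>
            ((hN (t + 1) (by omega) u hu).2 ((hiff u hu).2 h)).1
        have hall : ∀ e, ρ (t1 + e) ∈ (st (t1 + e)).L m := by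
          intro e
          induction e with
          | zero => exact hm1
          | succ e ih => exact (hk (t1 + e) (by omega) ih).1
        have hall' : ∀ t, t1 ≤ t → ρ t ∈ (st t).L m := by
          intro t ht
          have := hall (t - t1)
          rwa [show t1 + (t - t1) = t by omega] at this
        have hR' : ∀ t, t1 + 1 ≤ t → ¬ (st t).R m := by
          intro t ht
          obtain ⟨x, rfl⟩ : ∃ x, t = x + 1 := ⟨t - 1, by omega⟩
          exact (hk x (by omega) (hall' x (by omega))).2
        obtain ⟨N2, hN2⟩ := hno' m (hlt _ _ hm1) ⟨_, hR'⟩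
        refine ⟨t1 + 1 + N2, fun t ht u hu => ?_⟩
        rcases Nat.lt_succ_iff_lt_or_eq.1 hu with hu | rfl
        · exact ⟨((hN t (by omega) u hu).1).trans ((hN (t1 + 1 + N2) (by omega) u hu).1).symm,
            (hN t (by omega) u hu).2⟩
        · exact ⟨iff_of_true (hall' _ (by omega)) (hall' _ (by omega)),
            fun _ => ⟨hN2 t (by omega), hR' t (by omega)⟩⟩
      · push Not at hex
        refine ⟨N, fun t ht u hu => ?_⟩
        rcases Nat.lt_succ_iff_lt_or_eq.1 hu with hu | rfl
        · exact hN t ht u hu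
        · exact ⟨iff_of_false (hex t ht) (hex N le_rfl), fun h => absurd h (hex t ht)⟩
  obtain ⟨N, hN⟩ := claim n
  have hmb : mb (st N).L n (ρ N) ≠ 0 := fun h =>
    mb_above (v := 0) (by omega) (hlt N 0 (hroot N)) (hroot N)
  obtain ⟨v, hv⟩ : ∃ v, mb (st N).L n (ρ N) = v + 1 := ⟨mb (st N).L n (ρ N) - 1, by omega⟩
  have hvm := mb_mem hv
  have hvn := hlt _ _ hvm
  have hmax : ∀ t, N ≤ t → ∀ w, v < w → ρ t ∉ (st t).L w := by
    intro t ht w hw h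
    have hwn := hlt _ _ h
    exact mb_above (by omega) hwn ((hN t ht w hwn).1.1 h)
  have hmem : ∀ t, N ≤ t → ρ t ∈ (st t).L v := fun t ht => (hN t ht v hvn).1.2 hvm
  have hidx : ∀ e, (st (N + e)).idx v = (st N).idx v := by
    intro e
    induction e with
    | zero => rfl
    | succ e ih =>
      rw [← ih]
      have hg := ((hN (N + e + 1) (by omega) v hvn).2 (hmem _ (by omega))).1
      show (st (N + e + 1)).idx v = _
      rw [hst] at hg ⊢
      exact step_idx_nG hvn hg
  obtain ⟨m, hm, hmB⟩ := hB ((st N).idx v) (N + 1)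
  obtain ⟨e, rfl⟩ : ∃ e, m = N + e + 1 := ⟨m - N - 1, by omega⟩
  have a1 := ((hN (N + e + 1) (by omega) v hvn).2 (hmem _ (by omega))).2
  have a2 := hmem (N + e + 1) (by omega)
  have a3 := hmax (N + e + 1) (by omega)
  have a4 : ∀ u ≤ v, ρ (N + e + 1) ∈ (st (N + e + 1)).L u → ¬ (st (N + e + 1)).G u :=
    fun u hu h => ((hN (N + e + 1) (by omega) u (by omega)).2 h).1
  rw [hst] at a1 a2 a3 a4
  exact step_ext (hval (N + e)) hvn a1 a2 a3 a4 ((hidx e).symm ▸ hmB)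

end run

theorem card_code {Q : Type} [Fintype Q] (n k : ℕ) (hn : Fintype.card Q = n) (h1 : 1 ≤ n)
    (hk : 1 ≤ k) : Nat.card (Code Q n k) ≤ (n * k + 1) ^ (5 * n) := by
  have e : Nat.card (Code Q n k) = (n+1)^n * ((n+1)^n * (k^n * (2^n * 2^n))) := by
    simp [Code, Nat.card_eq_fintype_card, hn]
  rw [e]
  have a1 : n + 1 ≤ n * k + 1 := by nlinarith
  have a2 : k ≤ n * k + 1 := by nlinarith
  have a3 : 2 ≤ n * k + 1 := by nlinarith
  calc _ ≤ (n*k+1)^n * ((n*k+1)^n * ((n*k+1)^n * ((n*k+1)^n * (n*k+1)^n))) := by gcongr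
    _ = _ := by ring

end GBD

/-- Generalized Büchi determinization, asymptotic form `2^{O(n log nk)}`:
there is a constant `c > 0` such that every nondeterministic generalized Büchi
automaton with `n ≥ 1` states and index size `k ≥ 1` has an equivalent
deterministic Rabin automaton with at most `2^{c·n·log₂(nk+1)}` states and
index size at most `n·(min(n,k)+1)`. -/
theorem generalized_buchi_determinization :
    ∃ c : ℝ, 0 < c ∧ ∀ (α Q : Type) (_ : Fintype α) (_ : Nonempty α) (_ : Fintype Q)
      (n k : ℕ), Fintype.card Q = n → 1 ≤ n → 1 ≤ k →
      ∀ (Q₀ : Set Q) (Δ : Q → α → Q → Prop) (B : Fin k → Set Q),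
      ∃ (m kB : ℕ) (init : Fin m) (δ : Fin m → α → Fin m)
        (G' B' : Fin kB → Set (Fin m)),
        (m : ℝ) ≤ (2 : ℝ) ^ (c * (n : ℝ) * Real.logb 2 ((n : ℝ) * (k : ℝ) + 1)) ∧
        kB ≤ n * (min n k + 1) ∧
        ∀ w : ℕ → α,
          (∃ ρ : ℕ → Q, ρ 0 ∈ Q₀ ∧ (∀ i : ℕ, Δ (ρ i) (w i) (ρ (i + 1))) ∧
            ∀ i : Fin k, (InfStates ρ ∩ B i).Nonempty) ↔
          (∃ ρ : ℕ → Fin m, ρ 0 = init ∧ (∀ i : ℕ, ρ (i + 1) = δ (ρ i) (w i)) ∧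
            ∃ i : Fin kB, (InfStates ρ ∩ G' i).Nonempty ∧ InfStates ρ ∩ B' i = ∅) := by
  refine ⟨5, by norm_num, ?_⟩
  intro α Q _ _ _ n k hcard hn hk Q₀ Δ B
  have hcard' : Nat.card Q = n := by rw [Nat.card_eq_fintype_card, hcard]
  have hQ : Nonempty Q := Fintype.card_pos_iff.1 (by omega)
  obtain ⟨nxt, hnxt⟩ := GBD.exists_nxt hk
  let z : Fin k := ⟨0, hk⟩
  let S : Type := {s : GBD.St Q k // GBD.Valid n z s}
  let F : S → GBD.Code Q n k := fun s => GBD.enc n s.1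
  have hF : Function.Injective F := fun s s' h => Subtype.ext (GBD.enc_inj s.2 s'.2 h)
  have hfin : Finite S := Finite.of_injective F hF
  let e : S ≃ Fin (Nat.card S) := Finite.equivFin S
  let stp : S → α → S := fun s a =>
    ⟨GBD.step n z nxt B s.1 (fun q q' => Δ q a q'), GBD.step_valid s.2 hcard'⟩
  let s0 : S := ⟨GBD.init z Q₀, GBD.init_valid hn z Q₀⟩
  refine ⟨Nat.card S, n, e s0, fun x a => e (stp (e.symm x) a),
    fun i => {x | (e.symm x).1.G i}, fun i => {x | (e.symm x).1.R i}, ?_, ?_, ?_⟩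
  · have h1 : Nat.card S ≤ (n * k + 1) ^ (5 * n) :=
      (Nat.card_le_card_of_injective F hF).trans (GBD.card_code n k hcard hn hk)
    have hpos : (0 : ℝ) < (n : ℝ) * k + 1 := by positivity
    have h2 : (2 : ℝ) ^ ((5 : ℝ) * (n : ℝ) * Real.logb 2 ((n : ℝ) * (k : ℝ) + 1))
        = ((n : ℝ) * k + 1) ^ (5 * n) := by
      rw [mul_comm, Real.rpow_mul (by norm_num), Real.rpow_logb (by norm_num) (by norm_num) hpos,
        ← Real.rpow_natCast]
      norm_num
    rw [h2]
    exact_mod_cast h1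
  · exact Nat.le_mul_of_pos_right n (by omega)
  · intro w
    have hacc : ∀ ρ : ℕ → Fin (Nat.card S), ∀ i : Fin n,
        ((InfStates ρ ∩ {x | (e.symm x).1.G i}).Nonempty ∧
          InfStates ρ ∩ {x | (e.symm x).1.R i} = ∅) ↔
        ((∀ N, ∃ m, N ≤ m ∧ (e.symm (ρ m)).1.G i) ∧
          ∃ N, ∀ m, N ≤ m → ¬ (e.symm (ρ m)).1.R i) := by
      intro ρ i
      rw [← Set.not_nonempty_iff_eq_empty, GBD.inf_iff, GBD.inf_iff]
      push Not
      rfl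
    constructor
    · rintro ⟨ρ, h0, h1, h2⟩
      let st : ℕ → S := fun t => Nat.rec s0 (fun t s => stp s (w t)) t
      obtain ⟨v, hv, hG, hR⟩ := GBD.complete (n := n) (z := z) (nxt := nxt)
        (T := fun t q q' => Δ q (w t) q') (st := fun t => (st t).1)
        (fun t => (st t).2) rfl (fun t => rfl) h0 h1
        (fun j => (GBD.inf_iff ρ (B j)).1 (h2 j))
      refine ⟨fun t => e (st t), rfl, fun i => ?_, ⟨v, hv⟩, (hacc _ _).2 ⟨?_, ?_⟩⟩
      · simp only [Equiv.symm_apply_apply]; rfl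
      · simpa only [Equiv.symm_apply_apply] using hG
      · simpa only [Equiv.symm_apply_apply] using hR
    · rintro ⟨ρ, h0, h1, i, hi⟩
      obtain ⟨hG, hR⟩ := (hacc _ _).1 hi
      obtain ⟨r, r0, r1, r2⟩ := GBD.sound (n := n) (z := z) (nxt := nxt)
        (T := fun t q q' => Δ q (w t) q') (st := fun t => (e.symm (ρ t)).1) hnxt
        (by simp only [h0, Equiv.symm_apply_apply]; rfl)
        (by intro t; simp only [h1, Equiv.symm_apply_apply]; rfl) i.2 hG hR
      exact ⟨r, r0, r1, fun j => (GBD.inf_iff r (B j)).2 (r2 j)⟩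
end

section
/- There exists a constant c > 0 such that for every nondeterministic parity automaton A with n ≥ 1 states and index size k ≥ 1, there exists a deterministic Rabin automaton B over the same alphabet with L(B) = L(A), whose number of states is at most 2^{c·n·log₂(n+1)} and whose index size is at most n·(k+1). -/
set_option linter.unusedSectionVars false

namespace PD
open Classical

abbrev PPath := List (Bool × ℕ)

def lid : PPath → ℕ
  | [] => 0
  | e :: _ => e.2

def lvl : PPath → ℕ
  | [] => 0
  | e :: x => (if e.1 = true then 1 else 0) + lvl x

lemma lvl_append (x y : PPath) : lvl (x ++ y) = lvl x + lvl y := by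
  induction x with
  | nil => simp [lvl]
  | cons e x ih => simp [lvl, ih]; omega

lemma lvl_rep (r i : ℕ) : lvl (List.replicate r (true, i)) = r := by
  induction r with
  | zero => simp [lvl]
  | succ r ih => simp [List.replicate_succ, lvl, ih]; omega

lemma lid_rep (r : ℕ) (x : PPath) : lid (List.replicate r (true, lid x) ++ x) = lid x := by
  cases r with
  | zero => simp
  | succ r => simp [List.replicate_succ, lid]

lemma lvl_suffix {x y : PPath} (h : x <:+ y) : lvl x ≤ lvl y := by
  obtain ⟨t, rfl⟩ := h
  rw [lvl_append]; omega

lemma suffix_total {x y u : PPath} (hx : x <:+ u) (hy : y <:+ u) : x <:+ y ∨ y <:+ x :=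
  List.suffix_or_suffix_of_suffix hx hy

lemma suffix_len {x y u : PPath} (hx : x <:+ u) (hy : y <:+ u) (h : x.length ≤ y.length) :
    x <:+ y := List.suffix_of_suffix_length_le hx hy h

lemma suffix_eq {x y u : PPath} (hx : x <:+ u) (hy : y <:+ u) (h : x.length = y.length) :
    x = y := (suffix_len hx hy h.le).eq_of_length h

/-- a proper suffix extends by one -/
lemma suffix_proper {x u : PPath} (hx : x <:+ u) (h : x.length < u.length) :
    ∃ e, (e :: x) <:+ u := by
  obtain ⟨t, rfl⟩ := hx
  rcases List.eq_nil_or_concat t with rfl | ⟨t', e, rfl⟩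
  · simp at h
  · exact ⟨e, ⟨t', by simp⟩⟩

abbrev Ent := WithTop (Bool ×ₗ ℕ)

noncomputable def fkey (a : PPath) : List Ent :=
  a.map (fun e => ((toLex e : Bool ×ₗ ℕ) : Ent)) ++ [⊤]

noncomputable def key (u : PPath) : List Ent := fkey u.reverse

lemma cons_le_aux {a b : Ent} {l m : List Ent} (h : a :: l ≤ b :: m) :
    a < b ∨ a = b ∧ l ≤ m := by
  rcases lt_or_eq_of_le h with h | h
  · rcases List.cons_lt_cons_iff.1 h with h | ⟨h1, h2⟩
    · exact Or.inl h
    · exact Or.inr ⟨h1, le_of_lt h2⟩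
  · simp only [List.cons.injEq] at h
    exact Or.inr ⟨h.1, h.2.le⟩

lemma fkey_le (a b : PPath) (h : fkey a ≤ fkey b) :
    b <+: a ∨ ∃ w x y, (w ++ [x]) <+: a ∧ (w ++ [y]) <+: b ∧ toLex x < toLex y := by
  induction a generalizing b with
  | nil =>
    cases b with
    | nil => left; exact List.prefix_refl _
    | cons y b =>
      exfalso
      have h' : (⊤ : Ent) :: [] ≤ ((toLex y : Bool ×ₗ ℕ) : Ent) :: fkey b := h
      rcases cons_le_aux h' with h | ⟨h, -⟩
      · exact not_top_lt h
      · exact WithTop.top_ne_coe h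
  | cons x a ih =>
    cases b with
    | nil => left; exact List.nil_prefix
    | cons y b =>
      have h' : ((toLex x : Bool ×ₗ ℕ) : Ent) :: fkey a ≤
        ((toLex y : Bool ×ₗ ℕ) : Ent) :: fkey b := h
      rcases cons_le_aux h' with h | ⟨h1, h2⟩
      · right
        exact ⟨[], x, y, by simp, by simp, by simpa using h⟩
      · have hxy : x = y := by simpa using h1
        subst hxy
        rcases ih b h2 with h | ⟨w, x', y', h3, h4, h5⟩
        · left; simpa using h
        · right; exact ⟨x :: w, x', y', by simpa using h3, by simpa using h4, h5⟩

def Best (c u : PPath) : Prop :=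
  u <:+ c ∨ ∃ w x y, (x :: w) <:+ c ∧ (y :: w) <:+ u ∧ toLex x < toLex y

lemma key_le {c u : PPath} (h : key c ≤ key u) : Best c u := by
  rcases fkey_le _ _ h with h | ⟨w, x, y, h1, h2, h3⟩
  · left; simpa using h
  · right
    refine ⟨w.reverse, x, y, ?_, ?_, h3⟩
    · rw [← List.reverse_prefix]; simpa using h1
    · rw [← List.reverse_prefix]; simpa using h2

/-- longest suffix whose level is fine -/
noncomputable def trunc (P : ℕ → Prop) : PPath → PPath
  | [] => []
  | e :: x => if P (lvl (e :: x)) then e :: x else trunc P x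

lemma trunc_suffix (P : ℕ → Prop) (u : PPath) : trunc P u <:+ u := by
  induction u with
  | nil => simp [trunc]
  | cons e x ih =>
    unfold trunc; split_ifs
    · exact List.suffix_refl _
    · exact ih.trans (List.suffix_cons _ _)

lemma trunc_lvl (P : ℕ → Prop) (h0 : P 0) (u : PPath) : P (lvl (trunc P u)) := by
  induction u with
  | nil => simpa [trunc, lvl]
  | cons e x ih =>
    unfold trunc; split_ifs with h
    · exact h
    · exact ih

lemma trunc_max (P : ℕ → Prop) {x u : PPath} (hx : x <:+ u) (h : P (lvl x)) :
    x <:+ trunc P u := by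
  induction u with
  | nil => simpa [trunc] using hx
  | cons e u ih =>
    unfold trunc; split_ifs with h'
    · exact hx
    · rcases List.suffix_cons_iff.1 hx with rfl | hx
      · exact absurd h h'
      · exact ih hx

noncomputable def cut (P : PPath → Prop) : PPath → PPath
  | [] => []
  | e :: x => if P (cut P x) then cut P x else e :: x

lemma cut_suffix (P : PPath → Prop) (u : PPath) : cut P u <:+ u := by
  induction u with
  | nil => simp [cut]
  | cons e x ih =>
    unfold cut; split_ifs
    · exact ih.trans (List.suffix_cons _ _)
    · exact List.suffix_refl _

lemma cut_or (P : PPath → Prop) (u : PPath) : cut P u = u ∨ P (cut P u) := by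
  cases u with
  | nil => simp [cut]
  | cons e x =>
    unfold cut; split_ifs with h
    · exact Or.inr h
    · exact Or.inl rfl

lemma cut_of (P : PPath → Prop) {v u : PPath} (hv : v <:+ u) (h : P v) : cut P u <:+ v := by
  induction u with
  | nil => simp [cut]
  | cons e x ih =>
    rcases List.suffix_cons_iff.1 hv with rfl | hx
    · exact cut_suffix P _
    · have := ih hx
      unfold cut; split_ifs with h'
      · exact this
      · exfalso
        rcases cut_or P x with h2 | h2
        · rw [h2] at this h'
          have : v = x := hx.eq_of_length_le this.length_le
          exact h' (this ▸ h)
        · exact h' h2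

lemma cut_eq (P : PPath → Prop) {v u : PPath} (hv : v <:+ cut P u) (h : P v) : cut P u = v :=
  (cut_of P (hv.trans (cut_suffix P u)) h).eq_of_length_le hv.length_le

variable {Q : Type}

abbrev Cfg (Q : Type) := Q → Option PPath

def Nd (f : Cfg Q) (x : PPath) : Prop := ∃ q u, f q = some u ∧ x <:+ u

lemma Nd.suff {f : Cfg Q} {x y : PPath} (h : Nd f y) (hx : x <:+ y) : Nd f x := by
  obtain ⟨q, u, h1, h2⟩ := h
  exact ⟨q, u, h1, hx.trans h2⟩

structure PInv (g : Cfg Q) : Prop where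
  ch : ∀ x y, Nd g x → Nd g y → lid x = lid y → lvl x ≤ lvl y →
    ∃ r, y = List.replicate r (true, lid x) ++ x
  mono : ∀ e x, Nd g (e :: x) → lid x ≤ e.2

def Eld (g : Cfg Q) (i : ℕ) (x : PPath) : Prop := ∀ i', Nd g ((true, i') :: x) → i ≤ i'

noncomputable def kap (g : Cfg Q) : PPath → ℕ
  | [] => 0
  | e :: x => if e.1 = true ∧ Eld g e.2 x then kap g x else e.2

inductive Ch (g : Cfg Q) (x : PPath) : PPath → Prop
  | refl : Ch g x x
  | step (y : PPath) (i : ℕ) : Ch g x y → Eld g i y → Ch g x ((true, i) :: y)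

lemma Ch.kap_eq {g : Cfg Q} {x y : PPath} (h : Ch g x y) : kap g y = kap g x := by
  induction h with
  | refl => rfl
  | step y i _ he ih => rw [kap, if_pos ⟨rfl, he⟩, ih]

lemma Ch.suff {g : Cfg Q} {x y : PPath} (h : Ch g x y) : x <:+ y := by
  induction h with
  | refl => exact List.suffix_refl _
  | step y i _ he ih => exact ih.trans (List.suffix_cons _ _)

lemma Ch.eq {g : Cfg Q} {x y : PPath} (h : Ch g x y) (hl : lvl y ≤ lvl x) : x = y := by
  cases h with
  | refl => rfl
  | step y i h' he =>
    have := lvl_suffix h'.suff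
    simp [lvl] at hl; omega

lemma Ch.trans {g : Cfg Q} {x y z : PPath} (h : Ch g x y) (h2 : Ch g y z) : Ch g x z := by
  induction h2 with
  | refl => exact h
  | step y i _ he ih => exact Ch.step _ _ ih he

lemma Ch.comp {g : Cfg Q} {h x y : PPath} (hx : Ch g h x) (hy : Ch g h y) (nx : Nd g x)
    (ny : Nd g y) (hl : lvl x ≤ lvl y) : Ch g x y := by
  induction hy generalizing x with
  | refl => rw [hx.eq hl]; exact Ch.refl
  | step y i hy he ih =>
    have ny' : Nd g y := ny.suff (List.suffix_cons _ _)
    by_cases hle : lvl x ≤ lvl y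
    · exact Ch.step _ _ (ih hx nx ny' hle) he
    · have hl' : lvl x = lvl y + 1 := by simp [lvl] at hl; omega
      cases hx with
      | refl =>
        have := lvl_suffix hy.suff; omega
      | step x' i' hx' he' =>
        have e1 : lvl x' = lvl y := by simp [lvl] at hl'; omega
        have := (ih hx' (nx.suff (List.suffix_cons _ _)) ny' e1.le).eq e1.ge
        subst this
        have : i = i' := le_antisymm (he _ nx) (he' _ ny)
        subst this
        exact Ch.refl

lemma head_ex (g : Cfg Q) (x : PPath) : ∃ h, Ch g h x ∧ kap g h = lid h ∧
    ∀ i z, h = (true, i) :: z → ¬ Eld g i z := by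
  induction x with
  | nil => exact ⟨[], Ch.refl, rfl, by simp⟩
  | cons e x ih =>
    by_cases h : e.1 = true ∧ Eld g e.2 x
    · obtain ⟨w, h1, h2, h3⟩ := ih
      refine ⟨w, ?_, h2, h3⟩
      have : e = (true, e.2) := by ext <;> simp [h.1]
      rw [this]
      exact Ch.step _ _ h1 h.2
    · refine ⟨e :: x, Ch.refl, by rw [kap, if_neg h]; rfl, ?_⟩
      rintro i z hz he
      simp only [List.cons.injEq] at hz
      obtain ⟨rfl, rfl⟩ := hz
      exact h ⟨rfl, he⟩

lemma head_no {g : Cfg Q} (hg : PInv g) {x : PPath} {r : ℕ}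
    (hn : Nd g (List.replicate r (true, lid x) ++ x))
    (hh : ∀ i z, List.replicate r (true, lid x) ++ x = (true, i) :: z → ¬ Eld g i z) : r = 0 := by
  cases r with
  | zero => rfl
  | succ r =>
    exfalso
    refine hh (lid x) (List.replicate r (true, lid x) ++ x) (by simp [List.replicate_succ]) ?_
    intro i' hi'
    have := hg.mono _ _ hi'
    rwa [lid_rep] at this

lemma kap_ch {g : Cfg Q} (hg : PInv g) {x y : PPath} (nx : Nd g x) (ny : Nd g y)
    (hk : kap g x = kap g y) (hl : lvl x ≤ lvl y) : Ch g x y := by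
  obtain ⟨a, a1, a2, a3⟩ := head_ex g x
  obtain ⟨b, b1, b2, b3⟩ := head_ex g y
  have na := nx.suff a1.suff
  have nb := ny.suff b1.suff
  have hab : lid a = lid b := by rw [← a2, ← b2, ← a1.kap_eq, ← b1.kap_eq, hk]
  have : a = b := by
    rcases le_total (lvl a) (lvl b) with h | h
    · obtain ⟨r, rfl⟩ := hg.ch a b na nb hab h
      have := head_no hg nb b3
      subst this; simp
    · obtain ⟨r, rfl⟩ := hg.ch b a nb na hab.symm h
      have := head_no hg na a3
      subst this; simp
  subst this
  exact a1.comp b1 nx ny hl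

lemma kap_le {g : Cfg Q} (hg : PInv g) {x : PPath} (nx : Nd g x) : kap g x ≤ lid x := by
  induction x with
  | nil => simp [kap]
  | cons e x ih =>
    rw [kap]
    split_ifs
    · exact (ih (nx.suff (List.suffix_cons _ _))).trans (hg.mono _ _ nx)
    · exact le_rfl

lemma kap_mono {g : Cfg Q} (hg : PInv g) {e} {x : PPath} (nx : Nd g (e :: x)) :
    kap g x ≤ kap g (e :: x) := by
  conv_rhs => rw [kap]
  split_ifs
  · exact le_rfl
  · exact (kap_le hg (nx.suff (List.suffix_cons _ _))).trans (hg.mono _ _ nx)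

variable [Fintype Q]

noncomputable def UU (g : Cfg Q) : Finset ℕ :=
  Finset.univ.image (fun q => (g q).elim 0 (kap g))

noncomputable def rk (U : Finset ℕ) (u : ℕ) : ℕ := (U.filter (· < u)).card

lemma rk_le (U : Finset ℕ) (u : ℕ) : rk U u ≤ u := by
  calc rk U u ≤ (Finset.range u).card := by
        apply Finset.card_le_card
        intro x; simp
    _ = u := by simp

lemma rk_mono (U : Finset ℕ) {u v : ℕ} (h : u ≤ v) : rk U u ≤ rk U v := by
  apply Finset.card_le_card
  intro x; simp; intro h1 h2; exact ⟨h1, by omega⟩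

lemma rk_strict (U : Finset ℕ) {u v : ℕ} (hu : u ∈ U) (h : u < v) : rk U u < rk U v := by
  apply Finset.card_lt_card
  rw [Finset.ssubset_iff_of_subset]
  · exact ⟨u, by simp [hu, h], by simp⟩
  · intro x; simp; intro h1 h2; exact ⟨h1, by omega⟩

lemma rk_inj (U : Finset ℕ) {u v : ℕ} (hu : u ∈ U) (hv : v ∈ U) (h : rk U u = rk U v) :
    u = v := by
  rcases lt_trichotomy u v with h1 | h1 | h1
  · have := rk_strict U hu h1; omega
  · exact h1
  · have := rk_strict U hv h1; omega

lemma rk_lt (U : Finset ℕ) {u : ℕ} (hu : u ∈ U) : rk U u < U.card := by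
  apply Finset.card_lt_card
  rw [Finset.ssubset_iff_of_subset (Finset.filter_subset _ _)]
  exact ⟨u, hu, by simp⟩

lemma UU_card (g : Cfg Q) : (UU g).card ≤ Fintype.card Q := Finset.card_image_le

noncomputable def nu (g : Cfg Q) (x : PPath) : ℕ := rk (UU g) (kap g x)

noncomputable def NN (g : Cfg Q) : PPath → PPath
  | [] => []
  | e :: x => (e.1, nu g (e :: x)) :: NN g x

lemma NN_len (g : Cfg Q) (x : PPath) : (NN g x).length = x.length := by
  induction x with
  | nil => rfl
  | cons e x ih => simp [NN, ih]

lemma NN_lvl (g : Cfg Q) (x : PPath) : lvl (NN g x) = lvl x := by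
  induction x with
  | nil => rfl
  | cons e x ih => simp [NN, lvl, ih]

lemma NN_lid (g : Cfg Q) (x : PPath) : lid (NN g x) = nu g x := by
  cases x with
  | nil => simp [NN, lid, nu, kap, rk]
  | cons e x => rfl

lemma NN_suff (g : Cfg Q) {x u : PPath} (h : x <:+ u) : NN g x <:+ NN g u := by
  induction u with
  | nil => simp at h; subst h; exact List.suffix_refl _
  | cons e u ih =>
    rcases List.suffix_cons_iff.1 h with rfl | h
    · exact List.suffix_refl _
    · exact (ih h).trans (List.suffix_cons _ _)

lemma NN_suff' (g : Cfg Q) {y u : PPath} (h : y <:+ NN g u) : ∃ x, x <:+ u ∧ NN g x = y := by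
  induction u with
  | nil => simp [NN] at h; exact ⟨[], by simp, by simp [NN, h]⟩
  | cons e u ih =>
    rcases List.suffix_cons_iff.1 h with rfl | h
    · exact ⟨e :: u, List.suffix_refl _, rfl⟩
    · obtain ⟨x, h1, h2⟩ := ih h
      exact ⟨x, h1.trans (List.suffix_cons _ _), h2⟩

lemma NN_ch {g : Cfg Q} {x y : PPath} (h : Ch g x y) :
    ∃ r, NN g y = List.replicate r (true, nu g x) ++ NN g x := by
  induction h with
  | refl => exact ⟨0, by simp⟩
  | step y i h he ih =>
    obtain ⟨r, hr⟩ := ih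
    refine ⟨r + 1, ?_⟩
    have : nu g ((true, i) :: y) = nu g x := by
      unfold nu; rw [(Ch.step y i h he).kap_eq]
    simp [NN, hr, List.replicate_succ, this]

/-- every node leads along its chain to a bare state -/
lemma own_ex {g : Cfg Q} (hb : ∀ x, Nd g x → ∃ q u, g q = some u ∧ x <:+ u ∧
    ¬ ∃ i, ((false, i) :: x) <:+ u) {x : PPath} (nx : Nd g x) :
    ∃ q u, g q = some u ∧ Ch g x u := by
  obtain ⟨L, hL⟩ : ∃ L, ∀ q u, g q = some u → u.length ≤ L := by
    refine ⟨Finset.univ.sup (fun q => (g q).elim 0 List.length), fun q u h => ?_⟩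
    have := Finset.le_sup (f := fun q => (g q).elim 0 List.length) (Finset.mem_univ q)
    simpa [h] using this
  have key : ∀ m x, Nd g x → L - x.length ≤ m → ∃ q u, g q = some u ∧ Ch g x u := by
    intro m
    induction m with
    | zero =>
      intro x nx hm
      obtain ⟨q, u, h1, h2⟩ := nx
      have := hL q u h1
      have e : x = u := h2.eq_of_length_le (by omega)
      exact ⟨q, u, h1, e ▸ Ch.refl⟩
    | succ m ih =>
      intro x nx hm
      obtain ⟨q, u, h1, h2, h3⟩ := hb x nx
      by_cases hl : x.length < u.length
      · obtain ⟨⟨ty, i⟩, he⟩ := suffix_proper h2 hl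
        cases ty with
        | false => exact absurd ⟨i, he⟩ h3
        | true =>
          have hex : ∃ i, Nd g ((true, i) :: x) := ⟨i, q, u, h1, he⟩
          have hE : Eld g (Nat.find hex) x := fun i' hi' => Nat.find_min' hex hi'
          have hN := Nat.find_spec hex
          obtain ⟨q', u', h4, h5⟩ := ih _ hN (by simp; omega)
          exact ⟨q', u', h4, (Ch.step _ _ Ch.refl hE).trans h5⟩
      · have e : x = u := h2.eq_of_length_le (by omega)
        exact ⟨q, u, h1, e ▸ Ch.refl⟩
  exact key _ x nx le_rfl

structure Tidy (g : Cfg Q) : Prop extends PInv g where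
  bare : ∀ x, Nd g x → ∃ q u, g q = some u ∧ x <:+ u ∧ ¬ ∃ i, ((false, i) :: x) <:+ u

lemma kap_mem {g : Cfg Q} (hg : Tidy g) {x : PPath} (nx : Nd g x) : kap g x ∈ UU g := by
  obtain ⟨q, u, h1, h2⟩ := own_ex hg.bare nx
  rw [← h2.kap_eq]
  exact Finset.mem_image.2 ⟨q, Finset.mem_univ _, by simp [h1]⟩

lemma nu_ch {g : Cfg Q} (hg : Tidy g) {x y : PPath} (nx : Nd g x) (ny : Nd g y)
    (hk : nu g x = nu g y) (hl : lvl x ≤ lvl y) : Ch g x y :=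
  kap_ch hg.toPInv nx ny (rk_inj _ (kap_mem hg nx) (kap_mem hg ny) hk) hl

lemma NN_inj {g : Cfg Q} (hg : Tidy g) {x y : PPath} (nx : Nd g x) (ny : Nd g y)
    (h : NN g x = NN g y) : x = y := by
  have hl : lvl x = lvl y := by rw [← NN_lvl g x, h, NN_lvl]
  have hk : nu g x = nu g y := by rw [← NN_lid g x, h, NN_lid]
  exact (nu_ch hg nx ny hk hl.le).eq hl.ge

lemma nu_le {g : Cfg Q} (hg : Tidy g) {x : PPath} (nx : Nd g x) : nu g x ≤ lid x :=
  (rk_le _ _).trans (kap_le hg.toPInv nx)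

noncomputable def rnm (g : Cfg Q) : Cfg Q := fun q => (g q).map (NN g)

lemma Nd_rnm {g : Cfg Q} {y : PPath} : Nd (rnm g) y ↔ ∃ x, Nd g x ∧ NN g x = y := by
  constructor
  · rintro ⟨q, u, h1, h2⟩
    obtain ⟨w, h3, rfl⟩ := Option.map_eq_some_iff.1 h1
    obtain ⟨x, h4, h5⟩ := NN_suff' g h2
    exact ⟨x, ⟨q, w, h3, h4⟩, h5⟩
  · rintro ⟨x, ⟨q, u, h1, h2⟩, rfl⟩
    exact ⟨q, NN g u, by simp [rnm, h1], NN_suff g h2⟩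

structure GInv (f : Cfg Q) : Prop extends PInv f where
  idn : ∀ x, Nd f x → lid x < Fintype.card Q
  own : ∀ x, Nd f x → ∃ q r, f q = some (List.replicate r (true, lid x) ++ x)

lemma rnm_inv {g : Cfg Q} (hg : Tidy g) : GInv (rnm g) where
  ch := by
    intro x y nx ny h1 h2
    obtain ⟨x, mx, rfl⟩ := Nd_rnm.1 nx
    obtain ⟨y, my, rfl⟩ := Nd_rnm.1 ny
    simp only [NN_lid, NN_lvl] at *
    exact NN_ch (nu_ch hg mx my h1 h2)
  mono := by
    intro e x h
    obtain ⟨y, ny, hy⟩ := Nd_rnm.1 h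
    cases y with
    | nil => simp [NN] at hy
    | cons e' y =>
      simp only [NN, List.cons.injEq] at hy
      obtain ⟨rfl, rfl⟩ := hy
      rw [NN_lid]
      exact rk_mono _ (kap_mono hg.toPInv ny)
  idn := by
    intro x nx
    obtain ⟨x, mx, rfl⟩ := Nd_rnm.1 nx
    rw [NN_lid]
    exact (rk_lt _ (kap_mem hg mx)).trans_le (UU_card g)
  own := by
    intro x nx
    obtain ⟨x, mx, rfl⟩ := Nd_rnm.1 nx
    obtain ⟨q, u, h1, h2⟩ := own_ex hg.bare mx
    obtain ⟨r, hr⟩ := NN_ch h2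
    exact ⟨q, r, by simp [rnm, h1, hr, NN_lid]⟩

structure Setup (Q α : Type) where
  k : ℕ
  sf : ℕ → Q → Prop
  ht : ℕ → Q → Prop
  Δ : Q → α → Q → Prop
  sf0 : ∀ q, sf 0 q
  sfanti : ∀ j q, sf (j + 1) q → sf j q
  sfk : ∀ j q, sf j q → j ≤ k
  htsf : ∀ j q, ht j q → ¬ sf (j + 1) q

variable {α : Type} (S : Setup Q α)

lemma sf_le {j j' : ℕ} {q : Q} (h : j ≤ j') (h' : S.sf j' q) : S.sf j q := by
  induction h with
  | refl => exact h'
  | step _ ih => exact ih (S.sfanti _ _ h')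

noncomputable def nid (q : Q) : ℕ := Fintype.card Q + (Fintype.equivFin Q q : ℕ)

lemma nid_inj {q q' : Q} (h : nid q = nid q') : q = q' := by
  unfold nid at h
  have : (Fintype.equivFin Q q : ℕ) = (Fintype.equivFin Q q' : ℕ) := by omega
  exact (Fintype.equivFin Q).injective (Fin.ext this)

noncomputable def ext (q : Q) (c : PPath) : PPath :=
  if S.ht (lvl c) q then (false, nid q) :: c
  else if S.sf (lvl c + 1) q then (true, nid q) :: c else c

lemma ext_or (q : Q) (c : PPath) : ext S q c = c ∨ ∃ ty, ext S q c = (ty, nid q) :: c := by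
  unfold ext; split_ifs
  · exact Or.inr ⟨_, rfl⟩
  · exact Or.inr ⟨_, rfl⟩
  · exact Or.inl rfl

lemma ext_suff (q : Q) (c : PPath) : c <:+ ext S q c := by
  rcases ext_or S q c with h | ⟨ty, h⟩ <;> rw [h]
  exact List.suffix_cons _ _

lemma pred_ex (f : Cfg Q) (a : α) (q' : Q) (h : ∃ q u, f q = some u ∧ S.Δ q a q') :
    ∃ q u, f q = some u ∧ S.Δ q a q' ∧ ∀ q2 u2, f q2 = some u2 → S.Δ q2 a q' →
      Best (trunc (S.sf · q') u) (trunc (S.sf · q') u2) := by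
  let s : Finset Q := Finset.univ.filter (fun q => ∃ u, f q = some u ∧ S.Δ q a q')
  have hs : s.Nonempty := by
    obtain ⟨q, u, h⟩ := h
    exact ⟨q, Finset.mem_filter.2 ⟨Finset.mem_univ _, u, h⟩⟩
  obtain ⟨q, hq, hm⟩ := Finset.exists_min_image s
    (fun q => key (trunc (S.sf · q') ((f q).getD []))) hs
  simp only [s, Finset.mem_filter, Finset.mem_univ, true_and] at hq hm
  obtain ⟨u, h1, h2⟩ := hq
  refine ⟨q, u, h1, h2, fun q2 u2 h3 h4 => key_le ?_⟩
  have := hm q2 ⟨u2, h3, h4⟩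
  simpa [h1, h3] using this

noncomputable def mv (f : Cfg Q) (a : α) : Cfg Q := fun q' =>
  if h : ∃ q u, f q = some u ∧ S.Δ q a q' then
    some (ext S q' (trunc (S.sf · q') (pred_ex S f a q' h).choose_spec.choose)) else none

lemma mv_ex {f : Cfg Q} {a : α} {q q' : Q} {u : PPath} (h : f q = some u) (h' : S.Δ q a q') :
    ∃ w, mv S f a q' = some w := by
  unfold mv; rw [dif_pos ⟨q, u, h, h'⟩]; exact ⟨_, rfl⟩

lemma mv_spec {f : Cfg Q} {a : α} {q' : Q} {w : PPath} (h : mv S f a q' = some w) :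
    ∃ q u, f q = some u ∧ S.Δ q a q' ∧ w = ext S q' (trunc (S.sf · q') u) ∧
    ∀ q2 u2, f q2 = some u2 → S.Δ q2 a q' →
      Best (trunc (S.sf · q') u) (trunc (S.sf · q') u2) := by
  unfold mv at h
  split_ifs at h with h0
  have hs := (pred_ex S f a q' h0).choose_spec.choose_spec
  exact ⟨_, _, hs.1, hs.2.1, (Option.some.inj h).symm, hs.2.2⟩

lemma mv_nd {f : Cfg Q} {a : α} {x : PPath} (h : Nd (mv S f a) x) :
    Nd f x ∨ ∃ q ty c, Nd f c ∧ mv S f a q = some x ∧ x = (ty, nid q) :: c := by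
  obtain ⟨q, w, h1, h2⟩ := h
  obtain ⟨p, u, h3, h4, h5, -⟩ := mv_spec S h1
  have hc : Nd f (trunc (S.sf · q) u) := ⟨p, u, h3, trunc_suffix _ _⟩
  rcases ext_or S q (trunc (S.sf · q) u) with h6 | ⟨ty, h6⟩
  · left; rw [h5, h6] at h2; exact hc.suff h2
  · rw [h5, h6] at h2
    rcases List.suffix_cons_iff.1 h2 with h7 | h7
    · right; exact ⟨q, ty, _, hc, by rw [h1, h5, h6, h7], h7⟩
    · left; exact hc.suff h7

lemma mv_pinv {f : Cfg Q} (hf : GInv f) (a : α) : PInv (mv S f a) where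
  ch := by
    intro x y nx ny h1 h2
    rcases mv_nd S nx with nx | ⟨q, ty, c, hc, hq, hx⟩ <;>
    rcases mv_nd S ny with ny | ⟨q', ty', c', hc', hq', hy⟩
    · exact hf.ch x y nx ny h1 h2
    · have := hf.idn x nx
      rw [h1, hy] at this; simp [lid, nid] at this
    · have := hf.idn y ny
      rw [← h1, hx] at this; simp [lid, nid] at this
    · have : q = q' := by
        rw [hx, hy] at h1; exact nid_inj h1
      subst this
      rw [hq] at hq'
      exact ⟨0, by simpa using hq'.symm⟩
  mono := by
    intro e x h
    rcases mv_nd S h with h | ⟨q, ty, c, hc, hq, hx⟩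
    · exact hf.mono _ _ h
    · simp only [List.cons.injEq] at hx
      obtain ⟨rfl, rfl⟩ := hx
      have := hf.idn _ hc
      simp [nid]; omega

/-- all runs in `v` have seen the target since the last flash -/
def Fl (g : Cfg Q) (v : PPath) : Prop :=
  ∀ q u, g q = some u → v <:+ u → ∃ i, ((false, i) :: v) <:+ u

noncomputable def ct (g : Cfg Q) : Cfg Q := fun q => (g q).map (cut (Fl g))

lemma ct_some {g : Cfg Q} {q : Q} {u : PPath} (h : ct g q = some u) :
    ∃ w, g q = some w ∧ u = cut (Fl g) w := by
  obtain ⟨w, h1, rfl⟩ := Option.map_eq_some_iff.1 h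
  exact ⟨w, h1, rfl⟩

lemma ct_nd {g : Cfg Q} {x : PPath} (h : Nd (ct g) x) : Nd g x := by
  obtain ⟨q, u, h1, h2⟩ := h
  obtain ⟨w, h3, rfl⟩ := ct_some h1
  exact ⟨q, w, h3, h2.trans (cut_suffix _ _)⟩

lemma ct_tidy {g : Cfg Q} (hg : PInv g) : Tidy (ct g) where
  ch := fun x y nx ny => hg.ch x y (ct_nd nx) (ct_nd ny)
  mono := fun e x h => hg.mono e x (ct_nd h)
  bare := by
    rintro x ⟨q, u, h1, h2⟩
    obtain ⟨w, h3, rfl⟩ := ct_some h1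
    by_cases hF : Fl g x
    · refine ⟨q, _, h1, h2, ?_⟩
      rw [cut_eq _ h2 hF]
      rintro ⟨i, hi⟩
      have := hi.length_le
      simp at this
    · have hF' := hF
      unfold Fl at hF'
      push Not at hF'
      obtain ⟨q', u', h4, h5, h6⟩ := hF'
      refine ⟨q', cut (Fl g) u', by simp [ct, h4], ?_, ?_⟩
      · rcases cut_or (Fl g) u' with h7 | h7
        · rw [h7]; exact h5
        · rcases suffix_total h5 (cut_suffix (Fl g) u') with h8 | h8
          · exact h8
          · have := cut_eq _ (h8.trans h2) h7
            rw [this] at h2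
            exact h2
      · rintro ⟨i, hi⟩
        exact h6 i (hi.trans (cut_suffix _ _))

noncomputable def stp (f : Cfg Q) (a : α) : Cfg Q := rnm (ct (mv S f a))

structure Inv (f : Cfg Q) : Prop extends GInv f where
  sfl : ∀ q u, f q = some u → S.sf (lvl u) q

lemma stp_spec {f : Cfg Q} {a : α} {q : Q} {u : PPath} (h : stp S f a q = some u) :
    ∃ w, mv S f a q = some w ∧
      u = NN (ct (mv S f a)) (cut (Fl (mv S f a)) w) := by
  obtain ⟨w, h1, rfl⟩ := Option.map_eq_some_iff.1 h
  obtain ⟨w', h2, rfl⟩ := ct_some h1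
  exact ⟨w', h2, rfl⟩

lemma stp_some {f : Cfg Q} {a : α} {q : Q} {w : PPath} (h : mv S f a q = some w) :
    stp S f a q = some (NN (ct (mv S f a)) (cut (Fl (mv S f a)) w)) := by
  simp [stp, rnm, ct, h]

lemma ext_sf {q : Q} {c : PPath} (h : S.sf (lvl c) q) : S.sf (lvl (ext S q c)) q := by
  unfold ext; split_ifs with h1 h2
  · simpa [lvl] using h
  · simpa [lvl, add_comm] using h2
  · exact h

lemma stp_inv {f : Cfg Q} (hf : Inv S f) (a : α) : Inv S (stp S f a) where
  toGInv := rnm_inv (ct_tidy (mv_pinv S hf.toGInv a))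
  sfl := by
    intro q u h
    obtain ⟨w, h1, rfl⟩ := stp_spec S h
    rw [NN_lvl]
    obtain ⟨p, u, h3, h4, rfl, -⟩ := mv_spec S h1
    exact sf_le S (lvl_suffix (cut_suffix _ _)) (ext_sf S (trunc_lvl (S.sf · q) (S.sf0 q) u))

noncomputable def ini (Q₀ : Set Q) : Cfg Q := fun q => if q ∈ Q₀ then some [] else none

lemma ini_nd {Q₀ : Set Q} {x : PPath} (h : Nd (ini Q₀) x) :
    x = [] ∧ ∃ q, ini Q₀ q = some [] := by
  obtain ⟨q, u, h1, h2⟩ := h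
  unfold ini at h1
  split_ifs at h1 with h0
  cases h1
  exact ⟨by simpa using h2, q, by simp [ini, h0]⟩

lemma ini_inv (Q₀ : Set Q) [Nonempty Q] : Inv S (ini Q₀) where
  ch := by
    intro x y nx ny _ _
    exact ⟨0, by rw [(ini_nd nx).1, (ini_nd ny).1]; rfl⟩
  mono := by
    intro e x h
    simpa using (ini_nd h).1
  idn := by
    intro x h
    rw [(ini_nd h).1]; exact Fintype.card_pos
  own := by
    intro x h
    obtain ⟨rfl, q, hq⟩ := ini_nd h
    exact ⟨q, 0, by simpa using hq⟩
  sfl := by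
    intro q u h
    have := (ini_nd ⟨q, u, h, List.suffix_refl _⟩).1
    subst this
    exact S.sf0 q

noncomputable def hl (f : Cfg Q) (a : α) (q : Q) : ℕ :=
  Nat.findGreatest (fun m => ∃ x : PPath, x.length = m ∧ ∃ w u, mv S f a q = some w ∧
    stp S f a q = some u ∧ x <:+ w ∧ x <:+ u) (((stp S f a q).getD []).length)

def fl (f : Cfg Q) (a : α) (q : Q) : Prop :=
  ∃ w, mv S f a q = some w ∧ Fl (mv S f a) (cut (Fl (mv S f a)) w)

lemma hl_le {f : Cfg Q} {a : α} {q : Q} {w u v : PPath} (hw : mv S f a q = some w)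
    (hu : stp S f a q = some u) (h1 : v <:+ w) (h2 : v <:+ u) : v.length ≤ hl S f a q := by
  apply Nat.le_findGreatest
  · simpa [hu] using h2.length_le
  · exact ⟨v, rfl, w, u, hw, hu, h1, h2⟩

lemma hl_suff {f : Cfg Q} {a : α} {q : Q} {w u v : PPath} (hw : mv S f a q = some w)
    (hu : stp S f a q = some u) (h2 : v <:+ u) (h : v.length ≤ hl S f a q) : v <:+ w := by
  have := Nat.findGreatest_spec (P := fun m => ∃ x : PPath, x.length = m ∧ ∃ w u, 
    mv S f a q = some w ∧ stp S f a q = some u ∧ x <:+ w ∧ x <:+ u)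
    (n := ((stp S f a q).getD []).length) (m := 0) (Nat.zero_le _)
    ⟨[], rfl, w, u, hw, hu, by simp, by simp⟩
  obtain ⟨x, hx, w', u', h3, h4, h5, h6⟩ := this
  rw [hw] at h3; cases h3
  rw [hu] at h4; cases h4
  exact (suffix_len h2 h6 (by rw [hx]; exact h)).trans h5

lemma hl_bd (f : Cfg Q) (a : α) (q : Q) : hl S f a q ≤ ((stp S f a q).getD []).length :=
  Nat.findGreatest_le _

/-- lengths of paths are polynomially bounded -/
lemma len_bd {f : Cfg Q} (hf : Inv S f) {q : Q} {u : PPath} (h : f q = some u) :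
    u.length < Fintype.card Q * (S.k + 1) := by
  have key : (Finset.range (u.length + 1)).card ≤
      ((Finset.range (Fintype.card Q)) ×ˢ (Finset.range (S.k + 1))).card := by
    apply Finset.card_le_card_of_injOn (fun m => (lid (u.drop m), lvl (u.drop m)))
    · intro m hm
      have hn : Nd f (u.drop m) := ⟨q, u, h, List.drop_suffix _ _⟩
      have h1 := hf.idn _ hn
      have h2 := (lvl_suffix (List.drop_suffix m u)).trans (S.sfk _ _ (hf.sfl q u h))
      simp; omega
    · intro m hm m' hm' he
      simp only [Prod.mk.injEq] at he
      simp at hm hm'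
      have hn : ∀ m, Nd f (u.drop m) := fun m => ⟨q, u, h, List.drop_suffix _ _⟩
      obtain ⟨r, hr⟩ := hf.ch _ _ (hn m) (hn m') he.1 he.2.le
      have h1 := congrArg lvl hr
      rw [lvl_append, lvl_rep] at h1
      have : r = 0 := by omega
      subst this
      have := congrArg List.length hr
      simp at this; omega
  simp at key; omega

lemma konig (X : ℕ → Set Q) (P : ℕ → Q → Q) (ne : ∀ t, (X t).Nonempty)
    (hP : ∀ t q, q ∈ X (t + 1) → P t q ∈ X t) :
    ∃ ρ : ℕ → Q, ∀ t, ρ t ∈ X t ∧ P t (ρ (t + 1)) = ρ t := by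
  let it : ℕ → ℕ → Q → Q := fun t d => Nat.rec id (fun d r q => r (P (t + d) q)) d
  have it0 : ∀ t q, it t 0 q = q := fun _ _ => rfl
  have itS : ∀ t d q, it t (d + 1) q = it t d (P (t + d) q) := fun _ _ _ => rfl
  have itS' : ∀ d t q, it t (d + 1) q = P t (it (t + 1) d q) := by
    intro d
    induction d with
    | zero => intro t q; rfl
    | succ d ih =>
      intro t q
      rw [itS, ih, itS]
      congr 3
      omega
  have mem : ∀ d t q, q ∈ X (t + d) → it t d q ∈ X t := by
    intro d
    induction d with
    | zero => intro t q h; exact h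
    | succ d ih => intro t q h; rw [itS]; exact ih t _ (hP _ _ h)
  let Good : ℕ → Q → Prop := fun t q => ∀ d, ∃ x ∈ X (t + d), it t d x = q
  have down : ∀ t q d d', d ≤ d' → (∃ x ∈ X (t + d'), it t d' x = q) →
      ∃ x ∈ X (t + d), it t d x = q := by
    intro t q d d' h
    induction h with
    | refl => exact id
    | step _ ih =>
      rintro ⟨x, hx, h⟩
      exact ih ⟨_, hP _ _ hx, h⟩
  -- pigeonhole
  have pig : ∀ t (C : Q → Prop), (∀ d, ∃ x ∈ X (t + d), C (it t d x)) → ∃ q, C q ∧ Good t q := by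
    intro t C h
    by_contra hcon
    push Not at hcon
    have : ∀ q, ∃ d, C q → ¬ ∃ x ∈ X (t + d), it t d x = q := by
      intro q
      by_cases hc : C q
      · have := hcon q hc
        simp only [Good, not_forall] at this
        obtain ⟨d, hd⟩ := this
        exact ⟨d, fun _ => hd⟩
      · exact ⟨0, fun h => absurd h hc⟩
    choose d hd using this
    obtain ⟨x, hx, hc⟩ := h (Finset.univ.sup d)
    exact hd _ hc (down t _ _ _ (Finset.le_sup (Finset.mem_univ _)) ⟨x, hx, rfl⟩)
  have start : ∃ q, Good 0 q := by
    obtain ⟨q, -, h⟩ := pig 0 (fun _ => True) (fun d => by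
      obtain ⟨x, hx⟩ := ne (0 + d); exact ⟨x, hx, trivial⟩)
    exact ⟨q, h⟩
  have next : ∀ t q, Good t q → ∃ q', P t q' = q ∧ Good (t + 1) q' := by
    intro t q h
    apply pig (t + 1) (fun q' => P t q' = q)
    intro d
    obtain ⟨x, hx, h'⟩ := h (d + 1)
    refine ⟨x, ?_, ?_⟩
    · have : t + 1 + d = t + (d + 1) := by omega
      rw [this]; exact hx
    · rw [← itS']; exact h'
  obtain ⟨q0, h0⟩ := start
  choose! nx hnx using next
  let ρ : ℕ → Q := fun t => Nat.rec q0 (fun t q => nx t q) t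
  have hG : ∀ t, Good t (ρ t) := by
    intro t
    induction t with
    | zero => exact h0
    | succ t ih => exact (hnx t _ ih).2
  refine ⟨ρ, fun t => ⟨?_, (hnx t _ (hG t)).1⟩⟩
  obtain ⟨x, hx, h⟩ := hG t 0
  rw [it0] at h
  rw [← h]; exact hx

def Kept (f : Cfg Q) (a : α) (r j : ℕ) : Prop :=
  ∃ v, lid v = r ∧ lvl v = j ∧ Nd (stp S f a) v ∧
    ∀ q u, stp S f a q = some u → v <:+ u → v.length ≤ hl S f a q

def Flashed (f : Cfg Q) (a : α) (r j : ℕ) : Prop :=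
  ∃ q u, stp S f a q = some u ∧ fl S f a q ∧ lid u = r ∧ lvl u = j

lemma nd_uniq {f : Cfg Q} (hf : PInv f) {x y : PPath} (nx : Nd f x) (ny : Nd f y)
    (h1 : lid x = lid y) (h2 : lvl x = lvl y) : x = y := by
  obtain ⟨r, rfl⟩ := hf.ch x y nx ny h1 h2.le
  rw [lvl_append, lvl_rep] at h2
  have : r = 0 := by omega
  subst this; rfl

/-! ### soundness -/

lemma snd1 {f : Cfg Q} (hf : Inv S f) {a : α} {v : PPath} 
    (nv : Nd (stp S f a) v) {q' : Q} {w u : PPath} (hvw : v <:+ w)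
    (hw' : w = ext S q' (trunc (S.sf · q') u)) : v <:+ trunc (S.sf · q') u := by
  rcases ext_or S q' (trunc (S.sf · q') u) with h | ⟨ty, h⟩
  · rw [hw', h] at hvw; exact hvw
  · rw [hw', h] at hvw
    rcases List.suffix_cons_iff.1 hvw with rfl | h
    · have := (stp_inv S hf a).idn _ nv
      simp [lid, nid] at this
    · exact h

lemma snd2 {v : PPath} {q' : Q} {w u : PPath} 
    (hw' : w = ext S q' (trunc (S.sf · q') u)) {i : ℕ} (hi : ((false, i) :: v) <:+ w) :
    (∃ i, ((false, i) :: v) <:+ u) ∨ S.ht (lvl v) q' := by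
  rw [hw'] at hi
  unfold ext at hi
  split_ifs at hi with h1 h2
  · rcases List.suffix_cons_iff.1 hi with h | h
    · simp only [List.cons.injEq] at h
      right; rw [h.2]; exact h1
    · left; exact ⟨i, h.trans (trunc_suffix _ _)⟩
  · rcases List.suffix_cons_iff.1 hi with h | h
    · simp at h
    · left; exact ⟨i, h.trans (trunc_suffix _ _)⟩
  · left; exact ⟨i, hi.trans (trunc_suffix _ _)⟩

lemma snd3 {f : Cfg Q} {a : α} {v : PPath} {q' : Q} {w u' : PPath}
    (hw : mv S f a q' = some w) (hu' : stp S f a q' = some u') (hvw : v <:+ w) {i : ℕ}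
    (hi : ((false, i) :: v) <:+ u') : ∃ i, ((false, i) :: v) <:+ w := by
  rw [stp_some S hw] at hu'
  cases hu'
  obtain ⟨z, h1, h2⟩ := NN_suff' _ hi
  cases z with
  | nil => simp [NN] at h2
  | cons e z =>
    simp only [NN, List.cons.injEq] at h2
    obtain ⟨h3, h4⟩ := h2
    have hz : (e :: z) <:+ w := h1.trans (cut_suffix _ _)
    have : z = v := suffix_eq ((List.suffix_cons _ _).trans hz) hvw (by rw [← h4, NN_len])
    subst this
    obtain ⟨ty, i'⟩ := e
    simp at h3
    obtain ⟨rfl, -⟩ := h3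
    exact ⟨i', hz⟩

lemma snd4 {f : Cfg Q} (hf : Inv S f) {a : α} {v : PPath} (nv : Nd (stp S f a) v)
    (K : ∀ q u, stp S f a q = some u → v <:+ u → v.length ≤ hl S f a q)
    (hfl : Flashed S f a (lid v) (lvl v)) : Fl (mv S f a) v := by
  obtain ⟨q, u, h1, ⟨w, h2, h3⟩, h4, h5⟩ := hfl
  have : u = v := nd_uniq (stp_inv S hf a).toPInv ⟨q, u, h1, List.suffix_refl _⟩ nv h4 h5
  subst this
  have hk := hl_suff S h2 h1 (List.suffix_refl _) (K q u h1 (List.suffix_refl _))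
  have h6 := stp_some S h2
  rw [h1] at h6
  have h7 := Option.some.inj h6
  have : cut (Fl (mv S f a)) w = u := suffix_eq (cut_suffix _ _) hk (by
    conv_rhs => rw [h7]
    rw [NN_len])
  rwa [this] at h3

lemma snd5 {f : Cfg Q} {a : α} {v : PPath} {q' : Q} {w u' : PPath}
    (hw : mv S f a q' = some w) (hu' : stp S f a q' = some u') (hvw : v <:+ w) 
    (hF : Fl (mv S f a) v) :
    (∃ i, ((false, i) :: v) <:+ w) ∧ ¬ ∃ i, ((false, i) :: v) <:+ u' := by
  refine ⟨hF _ _ hw hvw, ?_⟩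
  rintro ⟨i, hi⟩
  rw [stp_some S hw] at hu'
  cases hu'
  have h1 := (cut_of _ hvw hF).length_le
  have h2 := hi.length_le
  rw [NN_len] at h2
  simp at h2; omega

noncomputable def FF (Q₀ : Set Q) (w : ℕ → α) : ℕ → Cfg Q
  | 0 => ini Q₀
  | t + 1 => stp S (FF Q₀ w t) (w t)

lemma FF_inv [Nonempty Q] (Q₀ : Set Q) (w : ℕ → α) (t : ℕ) : Inv S (FF S Q₀ w t) := by
  induction t with
  | zero => exact ini_inv S Q₀
  | succ t ih => exact stp_inv S ih _

def Acc (ρ : ℕ → Q) : Prop :=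
  ∃ j, (∃ T, ∀ t, T ≤ t → S.sf j (ρ t)) ∧ ∀ N, ∃ t, N ≤ t ∧ S.ht j (ρ t)

lemma sound [Nonempty Q] (Q₀ : Set Q) (w : ℕ → α) (r j : ℕ)
    (hK : ∃ T, ∀ t, T ≤ t → Kept S (FF S Q₀ w t) (w t) r j)
    (hF : ∀ N, ∃ t, N ≤ t ∧ Flashed S (FF S Q₀ w t) (w t) r j) :
    ∃ ρ : ℕ → Q, ρ 0 ∈ Q₀ ∧ (∀ i, S.Δ (ρ i) (w i) (ρ (i + 1))) ∧ Acc S ρ := by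
  obtain ⟨T, hK⟩ := hK
  let F := FF S Q₀ w
  have FS : ∀ t, F (t + 1) = stp S (F t) (w t) := fun _ => rfl
  have hI : ∀ t, Inv S (F t) := FF_inv S Q₀ w
  -- the node is constant
  obtain ⟨v, hv1, hv2, nv, hvK⟩ := hK T le_rfl
  have hconst : ∀ d, Nd (F (T + d + 1)) v ∧ ∀ q u, F (T + d + 1) q = some u → v <:+ u →
      v.length ≤ hl S (F (T + d)) (w (T + d)) q := by
    intro d
    induction d with
    | zero => exact ⟨nv, hvK⟩
    | succ d ih =>
      obtain ⟨v', h1, h2, h3, h4⟩ := hK (T + (d + 1)) (by omega)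
      have nv' : Nd (F (T + (d + 1))) v' := by
        obtain ⟨q, u, h5, h6⟩ := h3
        obtain ⟨x, h7, -⟩ := stp_spec S h5
        have h8 := hl_suff S h7 h5 h6 (h4 q u h5 h6)
        obtain ⟨p, u0, h9, -, h10, -⟩ := mv_spec S h7
        have := snd1 S (hI (T + (d + 1))) ⟨q, u, h5, h6⟩ h8 h10
        exact ⟨p, u0, h9, this.trans (trunc_suffix _ _)⟩
      have : v' = v := nd_uniq (hI (T + (d + 1))).toPInv nv' ih.1 (h1.trans hv1.symm)
        (h2.trans hv2.symm)
      subst this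
      exact ⟨h3, h4⟩
  have hnd : ∀ t, T + 1 ≤ t → Nd (F t) v := by
    intro t ht
    have := (hconst (t - T - 1)).1
    rwa [show T + (t - T - 1) + 1 = t by omega] at this
  have hkp : ∀ t, T ≤ t → ∀ q u, F (t + 1) q = some u → v <:+ u →
      v.length ≤ hl S (F t) (w t) q := by
    intro t ht
    have := (hconst (t - T)).2
    rwa [show T + (t - T) = t by omega] at this
  -- predecessor function
  have hpre : ∀ t q', ∃ p, ∀ u', F (t + 1) q' = some u' → ∃ x u, mv S (F t) (w t) q' = some x ∧
      F t p = some u ∧ S.Δ p (w t) q' ∧ x = ext S q' (trunc (S.sf · q') u) := by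
    intro t q'
    by_cases h : ∃ u', F (t + 1) q' = some u'
    · obtain ⟨u', h⟩ := h
      obtain ⟨x, hx, -⟩ := stp_spec S h
      obtain ⟨p, u, h1, h2, h3, -⟩ := mv_spec S hx
      exact ⟨p, fun _ _ => ⟨x, u, hx, h1, h2, h3⟩⟩
    · exact ⟨q', fun u' h' => absurd ⟨u', h'⟩ h⟩
  choose P hP using hpre
  have hPv : ∀ t, T ≤ t → ∀ q' u', F (t + 1) q' = some u' → v <:+ u' →
      ∃ u, F t (P t q') = some u ∧ v <:+ u := by
    intro t ht q' u' h1 h2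
    obtain ⟨x, u, h3, h4, h5, h6⟩ := hP t q' u' h1
    have h7 := hl_suff S h3 h1 h2 (hkp t ht q' u' h1 h2)
    have h8 := snd1 S (hI t) ⟨q', u', h1, h2⟩ h7 h6
    exact ⟨u, h4, h8.trans (trunc_suffix _ _)⟩
  let X : ℕ → Set Q := fun t => {q | ∃ u, F t q = some u ∧ (T + 1 ≤ t → v <:+ u)}
  have hXP : ∀ t q, q ∈ X (t + 1) → P t q ∈ X t := by
    rintro t q ⟨u', h1, h2⟩
    by_cases ht : T + 1 ≤ t
    · obtain ⟨u, h3, h4⟩ := hPv t (by omega) q u' h1 (h2 (by omega))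
      exact ⟨u, h3, fun _ => h4⟩
    · obtain ⟨x, u, h3, h4, h5, h6⟩ := hP t q u' h1
      exact ⟨u, h4, fun h => absurd h ht⟩
  have hXne : ∀ t, (X t).Nonempty := by
    have big : ∀ t, T + 1 ≤ t → (X t).Nonempty := by
      intro t ht
      obtain ⟨q, u, h1, h2⟩ := hnd t ht
      exact ⟨q, u, h1, fun _ => h2⟩
    have : ∀ d t, T + 1 ≤ t + d → (X t).Nonempty := by
      intro d
      induction d with
      | zero => intro t ht; exact big t ht
      | succ d ih =>
        intro t ht
        obtain ⟨q, hq⟩ := ih (t + 1) (by omega)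
        exact ⟨_, hXP t q hq⟩
    intro t; exact this (T + 1) t (by omega)
  obtain ⟨ρ, hρ⟩ := konig X P hXne hXP
  refine ⟨ρ, ?_, ?_, j, ⟨T + 1, ?_⟩, ?_⟩
  · obtain ⟨u, h1, -⟩ := (hρ 0).1
    by_contra h
    simp [F, FF, ini, h] at h1
  · intro i
    obtain ⟨u', h1, -⟩ := (hρ (i + 1)).1
    obtain ⟨x, u, h3, h4, h5, h6⟩ := hP i _ u' h1
    rwa [(hρ i).2] at h5
  · intro t ht
    obtain ⟨u, h1, h2⟩ := (hρ t).1
    have := (hI t).sfl _ _ h1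
    rw [← hv2]
    exact sf_le S (lvl_suffix (h2 ht)) this
  · -- infinitely often
    let A : ℕ → Prop := fun t => ∃ u i, F t (ρ t) = some u ∧ ((false, i) :: v) <:+ u
    have data : ∀ t, T + 1 ≤ t → ∃ u u' x, F t (ρ t) = some u ∧ F (t + 1) (ρ (t + 1)) = some u' ∧
        mv S (F t) (w t) (ρ (t + 1)) = some x ∧ 
        x = ext S (ρ (t + 1)) (trunc (S.sf · (ρ (t + 1))) u) ∧ v <:+ x := by
      intro t ht
      obtain ⟨u', h1, h2⟩ := (hρ (t + 1)).1
      obtain ⟨x, u, h3, h4, h5, h6⟩ := hP t _ u' h1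
      rw [(hρ t).2] at h4
      exact ⟨u, u', x, h4, h1, h3, h6, 
        hl_suff S h3 h1 (h2 (by omega)) (hkp t (by omega) _ u' h1 (h2 (by omega)))⟩
    have back : ∀ t, T + 1 ≤ t → A (t + 1) → A t ∨ S.ht j (ρ (t + 1)) := by
      intro t ht hA
      obtain ⟨u, u', x, h1, h2, h3, h4, h5⟩ := data t ht
      obtain ⟨u'', i, h6, h7⟩ := hA
      rw [h2] at h6; cases h6
      obtain ⟨i', h8⟩ := snd3 S h3 h2 h5 h7
      rcases snd2 S h4 h8 with ⟨i, hi⟩ | h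
      · left; exact ⟨u, i, h1, hi⟩
      · right; rwa [hv2] at h
    have flash : ∀ t, T + 1 ≤ t → Flashed S (F t) (w t) r j →
        ¬ A (t + 1) ∧ (A t ∨ S.ht j (ρ (t + 1))) := by
      intro t ht hA
      obtain ⟨u, u', x, h1, h2, h3, h4, h5⟩ := data t ht
      rw [← hv1, ← hv2] at hA
      have := snd4 S (hI t) (hnd (t + 1) (by omega)) (hkp t (by omega)) hA
      obtain ⟨⟨i, h6⟩, h7⟩ := snd5 S h3 h2 h5 this
      refine ⟨?_, ?_⟩
      · rintro ⟨u'', i, h8, h9⟩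
        rw [h2] at h8; cases h8
        exact h7 ⟨i, h9⟩
      · rcases snd2 S h4 h6 with ⟨i, hi⟩ | h
        · left; exact ⟨u, i, h1, hi⟩
        · right; rwa [hv2] at h
    intro N
    obtain ⟨t1, ht1, hf1⟩ := hF (max N (T + 1))
    obtain ⟨t2, ht2, hf2⟩ := hF (t1 + 1)
    by_contra hcon
    push Not at hcon
    have hno : ∀ d, ¬ A (t1 + 1 + d) := by
      intro d
      induction d with
      | zero => exact (flash t1 (by omega) hf1).1
      | succ d ih =>
        intro hA
        rcases back (t1 + 1 + d) (by omega) hA with h | h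
        · exact ih h
        · exact hcon _ (by omega) h
    rcases (flash t2 (by omega) hf2).2 with h | h
    · have := hno (t2 - (t1 + 1))
      rw [show t1 + 1 + (t2 - (t1 + 1)) = t2 by omega] at this
      exact this h
    · exact hcon _ (by omega) h

/-! ### completeness -/

lemma cmp1 {f : Cfg Q} (hf : Inv S f) {a : α} {q q' : Q} {u u' v : PPath}
    (hu : f q = some u) (hd : S.Δ q a q') (hu' : stp S f a q' = some u')
    (hv : v <:+ u) (hv' : v <:+ u') (hsf : S.sf (lvl v) q') :
    ∃ c, mv S f a q' = some (ext S q' c) ∧ S.sf (lvl c) q' ∧ Best c (trunc (S.sf · q') u) ∧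
      v <:+ c ∧ NN (ct (mv S f a)) v = v ∧ v <:+ cut (Fl (mv S f a)) (ext S q' c) := by
  obtain ⟨w, hw⟩ := mv_ex S hu hd
  obtain ⟨p, u0, h1, h2, rfl, h4⟩ := mv_spec S hw
  set c := trunc (S.sf · q') u0 with hc
  have hB := h4 q u hu hd
  have hv1 : v <:+ trunc (S.sf · q') u := trunc_max (S.sf · q') hv hsf
  have htd := ct_tidy (mv_pinv S hf.toGInv a)
  rw [stp_some S hw] at hu'
  cases hu'
  obtain ⟨z, hz, hzv⟩ := NN_suff' _ hv'
  have hlen : z.length = v.length := by rw [← hzv, NN_len]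
  have hzw : z <:+ ext S q' c := hz.trans (cut_suffix _ _)
  have fin : v <:+ c → v <:+ c ∧ NN (ct (mv S f a)) v = v ∧
      v <:+ cut (Fl (mv S f a)) (ext S q' c) := by
    intro h
    have : z = v := suffix_eq hzw (h.trans (ext_suff S q' c)) hlen
    rw [this] at hz hzv
    exact ⟨h, hzv, hz⟩
  refine ⟨c, hw, trunc_lvl (S.sf · q') (S.sf0 q') u0, hB, fin ?_⟩
  rcases hB with hB | ⟨ω, x, y, h5, h6, h7⟩
  · exact hv1.trans hB
  · by_cases hlt : v.length ≤ ω.length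
    · exact (suffix_len hv1 ((List.suffix_cons _ _).trans h6) hlt).trans
        ((List.suffix_cons _ _).trans h5)
    · exfalso
      have h8 : (y :: ω) <:+ v := suffix_len h6 hv1 (by simp; omega)
      have h9 : (x :: ω) <:+ z := suffix_len (h5.trans (ext_suff S q' c)) hzw (by simp; omega)
      have h10 := NN_suff (ct (mv S f a)) h9
      rw [hzv] at h10
      have h11 := suffix_eq h10 h8 (by rw [NN_len]; simp)
      simp only [NN, List.cons.injEq] at h11
      have hnd : Nd (ct (mv S f a)) (x :: ω) :=
        ⟨q', _, by simp [ct, hw], h9.trans hz⟩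
      have h12 : nu (ct (mv S f a)) (x :: ω) ≤ x.2 := nu_le htd hnd
      rw [← h11.1] at h7
      rw [Prod.Lex.toLex_lt_toLex] at h7
      simp at h7
      omega

lemma cmp2 {f : Cfg Q} (hf : Inv S f) {a : α} {q' : Q} {u' v c : PPath}
    (hw : mv S f a q' = some (ext S q' c)) (hu' : stp S f a q' = some u')
    (hN : NN (ct (mv S f a)) v = v) (hc : v <:+ cut (Fl (mv S f a)) (ext S q' c))
    (hF : ¬ Fl (mv S f a) v) {e} (he : (e :: v) <:+ ext S q' c) :
    ∃ i, i ≤ e.2 ∧ ((e.1, i) :: v) <:+ u' := by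
  have htd := ct_tidy (mv_pinv S hf.toGInv a)
  have h1 : (e :: v) <:+ cut (Fl (mv S f a)) (ext S q' c) := by
    rcases cut_or (Fl (mv S f a)) (ext S q' c) with h | h
    · rw [h]; exact he
    · apply suffix_len he (cut_suffix _ _)
      by_contra hlt
      have : v = cut (Fl (mv S f a)) (ext S q' c) := hc.eq_of_length_le (by simp at hlt; omega)
      rw [← this] at h
      exact hF h
  rw [stp_some S hw] at hu'
  cases hu'
  have hnd : Nd (ct (mv S f a)) (e :: v) := ⟨q', _, by simp [ct, hw], h1⟩
  refine ⟨nu (ct (mv S f a)) (e :: v), nu_le htd hnd, ?_⟩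
  have := NN_suff (ct (mv S f a)) h1
  rwa [NN, hN] at this

lemma cmp_next {f : Cfg Q} (hf : Inv S f) {a : α} {q q' : Q} {u u' v : PPath}
    (hu : f q = some u) (hd : S.Δ q a q') (hu' : stp S f a q' = some u')
    {e} (hv : (e :: v) <:+ u) (hv' : v <:+ u') (hsf : S.sf (lvl (e :: v)) q')
    (hF : ¬ Fl (mv S f a) v) : ∃ e', (e' :: v) <:+ u' ∧ toLex e' ≤ toLex e := by
  obtain ⟨c, hw, hcs, hB, hvc, hN, hvcut⟩ := cmp1 S hf hu hd hu'
    ((List.suffix_cons _ _).trans hv) hv' (sf_le S (lvl_suffix (List.suffix_cons _ _)) hsf)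
  have hv1 := trunc_max (S.sf · q') hv hsf
  have : ∃ e0, (e0 :: v) <:+ c ∧ toLex e0 ≤ toLex e := by
    rcases hB with hB | ⟨ω, x, y, h5, h6, h7⟩
    · exact ⟨e, hv1.trans hB, le_rfl⟩
    · rcases lt_trichotomy ω.length v.length with h | h | h
      · exfalso
        have h8 : (y :: ω) <:+ v := suffix_len h6 ((List.suffix_cons _ _).trans hv1)
          (by simp; omega)
        have := suffix_eq h5 (h8.trans hvc) (by simp)
        simp only [List.cons.injEq, and_true] at this
        subst this
        exact lt_irrefl _ h7
      · have := suffix_eq h6 hv1 (by simp [h])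
        simp only [List.cons.injEq] at this
        obtain ⟨rfl, rfl⟩ := this
        exact ⟨x, h5, h7.le⟩
      · have := suffix_len hv1 ((List.suffix_cons _ _).trans h6) (by simp; omega)
        exact ⟨e, this.trans ((List.suffix_cons _ _).trans h5), le_rfl⟩
  obtain ⟨e0, h1, h2⟩ := this
  obtain ⟨i, hi, h3⟩ := cmp2 S hf hw hu' hN hvcut hF (h1.trans (ext_suff S q' c))
  refine ⟨_, h3, le_trans ?_ h2⟩
  rw [Prod.Lex.toLex_le_toLex]
  exact Or.inr ⟨rfl, hi⟩

lemma cmp_new1 {f : Cfg Q} (hf : Inv S f) {a : α} {q q' : Q} {u u' v : PPath}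
    (hu : f q = some u) (hd : S.Δ q a q') (hu' : stp S f a q' = some u')
    (hv : v <:+ u) (hv' : v <:+ u') (hsf : S.sf (lvl v) q') (hht : S.ht (lvl v) q')
    (hF : ¬ Fl (mv S f a) v) : ∃ i, ((false, i) :: v) <:+ u' := by
  obtain ⟨c, hw, hcs, hB, hvc, hN, hvcut⟩ := cmp1 S hf hu hd hu' hv hv' hsf
  have : ∃ i, ((false, i) :: v) <:+ ext S q' c := by
    by_cases hl : v.length < c.length
    · obtain ⟨⟨ty, i⟩, he⟩ := suffix_proper hvc hl
      cases ty with
      | false => exact ⟨i, he.trans (ext_suff S q' c)⟩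
      | true =>
        exfalso
        have h1 := sf_le S (lvl_suffix he) hcs
        apply S.htsf _ _ hht
        simpa [lvl, add_comm] using h1
    · have : v = c := hvc.eq_of_length_le (by omega)
      subst this
      exact ⟨nid q', by rw [ext, if_pos hht]⟩
  obtain ⟨i, hi⟩ := this
  obtain ⟨i', -, h⟩ := cmp2 S hf hw hu' hN hvcut hF hi
  exact ⟨i', h⟩

lemma cmp_new2 {f : Cfg Q} (hf : Inv S f) {a : α} {q q' : Q} {u u' v : PPath}
    (hu : f q = some u) (hd : S.Δ q a q') (hu' : stp S f a q' = some u')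
    (hv : v <:+ u) (hv' : v <:+ u') (hsf : S.sf (lvl v + 1) q')
    (hF : ¬ Fl (mv S f a) v) : ∃ e, (e :: v) <:+ u' := by
  obtain ⟨c, hw, hcs, hB, hvc, hN, hvcut⟩ := cmp1 S hf hu hd hu' hv hv' (S.sfanti _ _ hsf)
  have : ∃ e, (e :: v) <:+ ext S q' c := by
    by_cases hl : v.length < c.length
    · obtain ⟨e, he⟩ := suffix_proper hvc hl
      exact ⟨e, he.trans (ext_suff S q' c)⟩
    · have : v = c := hvc.eq_of_length_le (by omega)
      subst this
      unfold ext
      rw [if_pos hsf]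
      split_ifs
      · exact ⟨_, List.suffix_refl _⟩
      · exact ⟨_, List.suffix_refl _⟩
  obtain ⟨e, hi⟩ := this
  obtain ⟨i', -, h⟩ := cmp2 S hf hw hu' hN hvcut hF hi
  exact ⟨_, h⟩

lemma cmp_kept {f : Cfg Q} (hf : Inv S f) {a : α} {q q' : Q} {u u' v : PPath}
    (hu : f q = some u) (hd : S.Δ q a q') (hu' : stp S f a q' = some u')
    (hv : v <:+ u) (hv' : v <:+ u') (hsf : S.sf (lvl v) q') :
    Kept S f a (lid v) (lvl v) := by
  obtain ⟨c, hw, hcs, hB, hvc, hN, hvcut⟩ := cmp1 S hf hu hd hu' hv hv' hsf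
  have htd := ct_tidy (mv_pinv S hf.toGInv a)
  refine ⟨v, rfl, rfl, ⟨q', u', hu', hv'⟩, ?_⟩
  intro p x hp hx
  obtain ⟨y, hy, rfl⟩ := stp_spec S hp
  obtain ⟨z, hz, hzv⟩ := NN_suff' _ hx
  have : z = v := NN_inj htd ⟨p, _, by simp [ct, hy], hz⟩
    ⟨q', _, by simp [ct, hw], hvcut⟩ (by rw [hzv, hN])
  subst this
  exact hl_le S hy hp (hz.trans (cut_suffix _ _)) hx

lemma cmp_flash {f : Cfg Q} (hf : Inv S f) {a : α} {q q' : Q} {u u' v : PPath}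
    (hu : f q = some u) (hd : S.Δ q a q') (hu' : stp S f a q' = some u')
    (hv : v <:+ u) (hv' : v <:+ u') (hsf : S.sf (lvl v) q') (hF : Fl (mv S f a) v) :
    Flashed S f a (lid v) (lvl v) := by
  obtain ⟨c, hw, hcs, hB, hvc, hN, hvcut⟩ := cmp1 S hf hu hd hu' hv hv' hsf
  have h1 := cut_eq _ hvcut hF
  refine ⟨q', v, ?_, ⟨_, hw, by rw [h1]; exact hF⟩, rfl, rfl⟩
  rw [stp_some S hw, h1, hN]

lemma complete [Nonempty Q] (Q₀ : Set Q) (w : ℕ → α) (ρ : ℕ → Q) (h0 : ρ 0 ∈ Q₀)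
    (hd : ∀ i, S.Δ (ρ i) (w i) (ρ (i + 1))) (hA : Acc S ρ) :
    ∃ r j, r < Fintype.card Q ∧ j ≤ S.k ∧
      (∃ T, ∀ t, T ≤ t → Kept S (FF S Q₀ w t) (w t) r j) ∧
      ∀ N, ∃ t, N ≤ t ∧ Flashed S (FF S Q₀ w t) (w t) r j := by
  obtain ⟨j, ⟨T0, hsf⟩, hht⟩ := hA
  let F := FF S Q₀ w
  have FS : ∀ t, F (t + 1) = stp S (F t) (w t) := fun _ => rfl
  have hI : ∀ t, Inv S (F t) := FF_inv S Q₀ w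
  have hex : ∀ t, ∃ u, F t (ρ t) = some u := by
    intro t
    induction t with
    | zero => exact ⟨[], by simp [F, FF, ini, h0]⟩
    | succ t ih =>
      obtain ⟨u, hu⟩ := ih
      obtain ⟨x, hx⟩ := mv_ex S hu (hd t)
      exact ⟨_, stp_some S hx⟩
  choose u hu using hex
  by_contra hcon
  push Not at hcon
  have key : ∀ m : ℕ, ∃ v : PPath, v.length = m ∧ lvl v ≤ j ∧ ∃ T, ∀ t, T ≤ t → v <:+ u t := by
    intro m
    induction m with
    | zero => exact ⟨[], rfl, by simp [lvl], 0, fun t _ => List.nil_suffix⟩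
    | succ m ih =>
      obtain ⟨v, hm, hvj, T1, hT1⟩ := ih
      have hk : ∀ t, max T0 T1 ≤ t → Kept S (F t) (w t) (lid v) (lvl v) := by
        intro t ht
        exact cmp_kept S (hI t) (hu t) (hd t) (hu (t + 1)) (hT1 t (by omega))
          (hT1 (t + 1) (by omega)) (sf_le S hvj (hsf (t + 1) (by omega)))
      have hid : lid v < Fintype.card Q := (hI T1).idn v ⟨_, _, hu T1, hT1 T1 le_rfl⟩
      have hlk : lvl v ≤ S.k := hvj.trans (S.sfk _ _ (hsf T0 le_rfl))
      obtain ⟨N, hN⟩ := hcon (lid v) (lvl v) hid hlk ⟨_, hk⟩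
      let T := max N (max T0 T1)
      have hnf : ∀ t, T ≤ t → ¬ Fl (mv S (F t) (w t)) v := by
        intro t ht hF
        exact hN t (by omega) (cmp_flash S (hI t) (hu t) (hd t) (hu (t + 1)) (hT1 t (by omega))
          (hT1 (t + 1) (by omega)) (sf_le S hvj (hsf (t + 1) (by omega))) hF)
      let Pr : Bool × ℕ → Prop := fun e => e.1 = false ∨ lvl v < j
      have hstart : ∃ t e, T ≤ t ∧ Pr e ∧ (e :: v) <:+ u t := by
        by_cases hl : lvl v < j
        · obtain ⟨e, he⟩ := cmp_new2 S (hI T) (hu T) (hd T) (hu (T + 1)) (hT1 T (by omega))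
            (hT1 (T + 1) (by omega)) (sf_le S hl (hsf (T + 1) (by omega))) (hnf T le_rfl)
          exact ⟨T + 1, e, by omega, Or.inr hl, he⟩
        · have hj : lvl v = j := by omega
          obtain ⟨t', ht', hh⟩ := hht (T + 1)
          obtain ⟨t, rfl⟩ : ∃ t, t' = t + 1 := ⟨t' - 1, by omega⟩
          rw [← hj] at hh
          obtain ⟨i, hi⟩ := cmp_new1 S (hI t) (hu t) (hd t) (hu (t + 1)) (hT1 t (by omega))
            (hT1 (t + 1) (by omega)) (sf_le S hvj (hsf (t + 1) (by omega))) hh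
            (hnf t (by omega))
          exact ⟨t + 1, (false, i), by omega, Or.inl rfl, hi⟩
      have hlv : ∀ e, Pr e → lvl (e :: v) ≤ j := by
        rintro ⟨ty, i⟩ (h | h)
        · simp at h; subst h; simpa [lvl] using hvj
        · cases ty <;> simp [lvl] <;> omega
      let M : Set (Bool ×ₗ ℕ) := {x | ∃ t, T ≤ t ∧ Pr (ofLex x) ∧ (ofLex x :: v) <:+ u t}
      have hM : M.Nonempty := by
        obtain ⟨t, e, h⟩ := hstart
        exact ⟨toLex e, t, h⟩
      obtain ⟨x, ⟨t0, ht0, hx1, hx2⟩, hmin⟩ :=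
        (wellFounded_lt (α := Bool ×ₗ ℕ)).has_min M hM
      refine ⟨ofLex x :: v, by simp [hm], hlv _ hx1, t0, ?_⟩
      intro t ht
      induction ht with
      | refl => exact hx2
      | @step t ht ih =>
        have ht : t0 ≤ t := ht
        obtain ⟨e', he1, he2⟩ := cmp_next S (hI t) (hu t) (hd t) (hu (t + 1)) ih
          (hT1 (t + 1) (by omega)) (sf_le S (hlv _ hx1) (hsf (t + 1) (by omega)))
          (hnf t (by omega))
        have hpr : Pr e' := by
          rcases hx1 with h | h
          · left
            rw [toLex_ofLex, ← toLex_ofLex x, Prod.Lex.toLex_le_toLex, h] at he2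
            rcases he2 with h' | h'
            · exact absurd h' (by simp)
            · exact h'.1
          · exact Or.inr h
        have : toLex e' ∈ M := ⟨t + 1, by omega, hpr, he1⟩
        have h3 := hmin _ this
        have h4 : toLex e' = x := le_antisymm he2 (not_lt.1 h3)
        rw [← h4]; exact he1
  obtain ⟨v, h1, h2, T, hT⟩ := key (Fintype.card Q * (S.k + 1))
  have h3 := len_bd S (hI T) (hu T)
  have h4 := (hT T le_rfl).length_le
  omega

noncomputable def chd : PPath → PPath
  | [] => []
  | e :: x => if e = (true, lid x) then chd x else e :: x

lemma chd_suff (x : PPath) : chd x <:+ x := by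
  induction x with
  | nil => simp [chd]
  | cons e x ih =>
    unfold chd; split_ifs
    · exact ih.trans (List.suffix_cons _ _)
    · exact List.suffix_refl _

lemma chd_spec (x : PPath) :
    lid (chd x) = lid x ∧ x = List.replicate (lvl x - lvl (chd x)) (true, lid x) ++ chd x := by
  induction x with
  | nil => simp [chd]
  | cons e x ih =>
    unfold chd; split_ifs with h
    · subst h
      refine ⟨by simpa [lid] using ih.1, ?_⟩
      have h1 : lvl (chd x) ≤ lvl x := lvl_suffix (chd_suff x)
      have h2 : lvl ((true, lid x) :: x) - lvl (chd x) = (lvl x - lvl (chd x)) + 1 := by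
        simp [lvl]; omega
      rw [h2, List.replicate_succ]
      have h3 : lid ((true, lid x) :: x) = lid x := rfl
      rw [h3, List.cons_append, ← ih.2]
    · simp

lemma chd_rep (r : ℕ) (x : PPath) : chd (List.replicate r (true, lid x) ++ x) = chd x := by
  induction r with
  | zero => simp
  | succ r ih =>
    rw [List.replicate_succ, List.cons_append, chd, lid_rep, if_pos rfl, ih]

noncomputable def pdt : PPath → Option (Bool × ℕ × ℕ)
  | [] => none
  | e :: x => some (e.1, lid x, lvl x)

noncomputable def Dt (u : PPath) : ℕ × ℕ × ℕ × Option (Bool × ℕ × ℕ) :=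
  (lid u, lvl u, lvl (chd u), pdt (chd u))

lemma enc_aux {f g : Cfg Q} (hf : GInv f) (hg : GInv g)
    (h : ∀ q, (f q).map Dt = (g q).map Dt) (m : ℕ) : ∀ x y : PPath, x.length ≤ m →
    Nd f x → Nd g y → lid x = lid y → lvl x = lvl y → x = y := by
  induction m with
  | zero =>
    intro x y hm nx ny h1 h2
    have hx : x = [] := List.eq_nil_of_length_eq_zero (by omega)
    obtain ⟨r, h3⟩ := hg.ch [] y (ny.suff (List.nil_suffix)) ny (by rw [← h1, hx])
      (by rw [← h2, hx])
    have := congrArg lvl h3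
    rw [lvl_append, lvl_rep, ← h2, hx] at this
    simp only [lvl] at this
    have : r = 0 := by omega
    subst this
    simp [hx, h3]
  | succ m ih =>
    intro x y hm nx ny h1 h2
    obtain ⟨q, r, h3⟩ := hf.own x nx
    have h4 := h q
    rw [h3] at h4
    obtain ⟨w, h5, h6⟩ := Option.map_eq_some_iff.1 h4.symm
    simp only [Dt, Prod.mk.injEq] at h6
    obtain ⟨a1, a2, a3, a4⟩ := h6
    rw [lid_rep] at a1
    rw [lvl_append] at a2
    rw [chd_rep] at a3 a4
    have nw : Nd g w := ⟨q, w, h5, List.suffix_refl _⟩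
    obtain ⟨r', h7⟩ := hg.ch y w ny nw (by rw [a1, h1]) (by omega)
    have h8 : chd w = chd y := by rw [h7, chd_rep]
    rw [h8] at a3 a4
    have key : chd x = chd y := by
      have cx := chd_suff x
      have cy := chd_suff y
      have lx := (chd_spec x).1
      have ly := (chd_spec y).1
      revert a3 a4 cx cy lx ly
      generalize chd x = x'
      generalize chd y = y'
      intro a3 a4 cx cy lx ly
      rcases x' with _ | ⟨e, x'⟩ <;> rcases y' with _ | ⟨e', y'⟩
      · rfl
      · simp [pdt] at a4
      · simp [pdt] at a4
      · simp only [pdt, Option.some.injEq, Prod.mk.injEq] at a4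
        obtain ⟨b1, b2, b3⟩ := a4
        have hl := cx.length_le
        simp only [List.length_cons] at hl
        have e1 : x' = y' := ih x' y' (by omega) (nx.suff ((List.suffix_cons _ _).trans cx))
          (ny.suff ((List.suffix_cons _ _).trans cy)) b2.symm b3.symm
        have e2 : e = e' := by
          apply Prod.ext b1.symm
          exact lx.trans (h1.trans ly.symm)
        rw [e1, e2]
    rw [(chd_spec x).2, (chd_spec y).2, key, h1, h2]

lemma enc_inj {f g : Cfg Q} (hf : GInv f) (hg : GInv g)
    (h : ∀ q, (f q).map Dt = (g q).map Dt) : f = g := by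
  funext q
  have h1 := h q
  cases h2 : f q with
  | none =>
    rw [h2] at h1
    simp at h1
    exact h1.symm
  | some u =>
    rw [h2] at h1
    obtain ⟨w, h5, h6⟩ := Option.map_eq_some_iff.1 h1.symm
    simp only [Dt, Prod.mk.injEq] at h6
    rw [h5, enc_aux hf hg h _ u w le_rfl ⟨q, u, h2, List.suffix_refl _⟩
      ⟨q, w, h5, List.suffix_refl _⟩ h6.1.symm h6.2.1.symm]

def DD (n k : ℕ) : Finset (Option (ℕ × ℕ × ℕ × Option (Bool × ℕ × ℕ))) :=
  Finset.insertNone (Finset.range n ×ˢ Finset.range (k + 1) ×ˢ Finset.range (k + 1) ×ˢ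
    Finset.insertNone (Finset.univ ×ˢ Finset.range n ×ˢ Finset.range (k + 1)))

lemma DD_card (n k : ℕ) : (DD n k).card =
    n * ((k + 1) * ((k + 1) * (2 * (n * (k + 1)) + 1))) + 1 := by
  simp [DD]

lemma enc_mem {f : Cfg Q} (hf : Inv S f) (q : Q) :
    (f q).map Dt ∈ DD (Fintype.card Q) S.k := by
  cases h : f q with
  | none => simp [DD]
  | some u =>
    have nu : Nd f u := ⟨q, u, h, List.suffix_refl _⟩
    have lu : lvl u ≤ S.k := S.sfk _ _ (hf.sfl q u h)
    have lc := lvl_suffix (chd_suff u)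
    simp only [DD, Option.map_some, Finset.some_mem_insertNone, Dt, Finset.mem_product,
      Finset.mem_range]
    refine ⟨hf.idn u nu, by omega, by omega, ?_⟩
    have cs := chd_suff u
    revert cs
    generalize chd u = x
    intro cs
    cases x with
    | nil => simp [pdt]
    | cons e x =>
      have sx := (List.suffix_cons e x).trans cs
      have lx := lvl_suffix sx
      simp only [pdt, Finset.some_mem_insertNone, Finset.mem_product, Finset.mem_univ,
        Finset.mem_range, true_and]
      exact ⟨hf.idn x (nu.suff sx), by omega⟩

noncomputable def enc (f : {f : Cfg Q // Inv S f}) :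
    Q → {d // d ∈ DD (Fintype.card Q) S.k} :=
  fun q => ⟨(f.1 q).map Dt, enc_mem S f.2 q⟩

lemma enc_injective : Function.Injective (enc S) := by
  intro f g h
  apply Subtype.ext
  apply enc_inj f.2.toGInv g.2.toGInv
  intro q
  exact congrArg Subtype.val (congrFun h q)

instance cfin : Finite {f : Cfg Q // Inv S f} := Finite.of_injective _ (enc_injective S)

lemma ccard : Nat.card {f : Cfg Q // Inv S f} ≤ (DD (Fintype.card Q) S.k).card ^ Fintype.card Q := by
  have := Nat.card_le_card_of_injective _ (enc_injective S)
  simpa using this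
/-! ### the automaton -/

lemma inf_ne {Z : Type*} [Finite Z] (ρ : ℕ → Z) (A : Set Z) :
    (InfStates ρ ∩ A).Nonempty ↔ ∀ N, ∃ t, N ≤ t ∧ ρ t ∈ A := by
  constructor
  · rintro ⟨z, h1, h2⟩ N
    obtain ⟨m, h3, rfl⟩ := h1 N
    exact ⟨m, h3, h2⟩
  · intro h
    by_contra hc
    have h1 : ∀ z : Z, ∃ N, ∀ m, N ≤ m → ρ m = z → z ∉ A := by
      intro z
      by_contra hz
      push Not at hz
      obtain ⟨_, _, _, hzA⟩ := hz 0
      apply hc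
      refine ⟨z, fun N => ?_, hzA⟩
      obtain ⟨m, h2, h3, _⟩ := hz N
      exact ⟨m, h2, h3⟩
    choose N hN using h1
    obtain ⟨b, hb⟩ := (Set.finite_range N).bddAbove
    obtain ⟨t, h2, h3⟩ := h b
    exact hN (ρ t) t ((hb ⟨ρ t, rfl⟩).trans h2) rfl h3

lemma inf_emp {Z : Type*} [Finite Z] (ρ : ℕ → Z) (A : Set Z) :
    InfStates ρ ∩ A = ∅ ↔ ∃ T, ∀ t, T ≤ t → ρ t ∉ A := by
  rw [← Set.not_nonempty_iff_eq_empty, inf_ne]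
  push Not
  rfl

abbrev ZZ := {f : Cfg Q // Inv S f} × (Q → Fin (Fintype.card Q * (S.k + 1))) × (Q → Bool)

lemma hl_lt [Nonempty Q] {f : Cfg Q} (hf : Inv S f) (a : α) (q : Q) :
    hl S f a q < Fintype.card Q * (S.k + 1) := by
  apply (hl_bd S f a q).trans_lt
  cases h : stp S f a q with
  | none => simpa using Fintype.card_pos
  | some u => simpa using len_bd S (stp_inv S hf a) h

noncomputable def zstep [Nonempty Q] (z : ZZ S) (a : α) : ZZ S :=
  (⟨stp S z.1.1 a, stp_inv S z.1.2 a⟩, fun q => ⟨hl S z.1.1 a q, hl_lt S z.1.2 a q⟩,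
    fun q => decide (fl S z.1.1 a q))

noncomputable def zini [Nonempty Q] (Q₀ : Set Q) : ZZ S :=
  (⟨ini Q₀, ini_inv S Q₀⟩, fun _ => ⟨0, Nat.mul_pos Fintype.card_pos (Nat.succ_pos _)⟩,
    fun _ => false)

noncomputable def zrun [Nonempty Q] (Q₀ : Set Q) (w : ℕ → α) : ℕ → ZZ S
  | 0 => zini S Q₀
  | t + 1 => zstep S (zrun Q₀ w t) (w t)

lemma zrun_FF [Nonempty Q] (Q₀ : Set Q) (w : ℕ → α) (t : ℕ) :
    (zrun S Q₀ w t).1.1 = FF S Q₀ w t := by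
  induction t with
  | zero => rfl
  | succ t ih =>
    show stp S (zrun S Q₀ w t).1.1 (w t) = stp S (FF S Q₀ w t) (w t)
    rw [ih]

def zG (r j : ℕ) : Set (ZZ S) :=
  {z | ∃ q u, z.1.1 q = some u ∧ z.2.2 q = true ∧ lid u = r ∧ lvl u = j}

def zB (r j : ℕ) : Set (ZZ S) :=
  {z | ¬ ∃ v, lid v = r ∧ lvl v = j ∧ Nd z.1.1 v ∧
    ∀ q u, z.1.1 q = some u → v <:+ u → v.length ≤ (z.2.1 q : ℕ)}

lemma zG_iff [Nonempty Q] (Q₀ : Set Q) (w : ℕ → α) (t r j : ℕ) :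
    zrun S Q₀ w (t + 1) ∈ zG S r j ↔ Flashed S (FF S Q₀ w t) (w t) r j := by
  rw [← zrun_FF]
  simp [zG, zrun, zstep, Flashed]

lemma zB_iff [Nonempty Q] (Q₀ : Set Q) (w : ℕ → α) (t r j : ℕ) :
    zrun S Q₀ w (t + 1) ∉ zB S r j ↔ Kept S (FF S Q₀ w t) (w t) r j := by
  rw [← zrun_FF]
  simp [zB, zrun, zstep, Kept]

lemma zcard : Nat.card (ZZ S) ≤ (DD (Fintype.card Q) S.k).card ^ Fintype.card Q *
    ((Fintype.card Q * (S.k + 1)) ^ Fintype.card Q * 2 ^ Fintype.card Q) := by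
  rw [Nat.card_prod, Nat.card_prod]
  apply Nat.mul_le_mul (ccard S)
  simp

lemma rabin [Nonempty Q] (Q₀ : Set Q) :
    ∃ (m : ℕ) (init : Fin m) (δ : Fin m → α → Fin m)
      (G' B' : Fin (Fintype.card Q * (S.k + 1)) → Set (Fin m)),
      m ≤ (DD (Fintype.card Q) S.k).card ^ Fintype.card Q *
        ((Fintype.card Q * (S.k + 1)) ^ Fintype.card Q * 2 ^ Fintype.card Q) ∧
      ∀ w : ℕ → α,
        (∃ ρ : ℕ → Q, ρ 0 ∈ Q₀ ∧ (∀ i, S.Δ (ρ i) (w i) (ρ (i + 1))) ∧ Acc S ρ) ↔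
        (∃ ρ : ℕ → Fin m, ρ 0 = init ∧ (∀ i : ℕ, ρ (i + 1) = δ (ρ i) (w i)) ∧
            ∃ i, (InfStates ρ ∩ G' i).Nonempty ∧ InfStates ρ ∩ B' i = ∅) := by
  let e : ZZ S ≃ Fin (Nat.card (ZZ S)) := Finite.equivFin (ZZ S)
  refine ⟨Nat.card (ZZ S), e (zini S Q₀), fun x a => e (zstep S (e.symm x) a),
    fun i => {x | e.symm x ∈ zG S (finProdFinEquiv.symm i).1 (finProdFinEquiv.symm i).2},
    fun i => {x | e.symm x ∈ zB S (finProdFinEquiv.symm i).1 (finProdFinEquiv.symm i).2},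
    zcard S, fun w => ?_⟩
  have hrun : ∀ ρ : ℕ → Fin (Nat.card (ZZ S)), ρ 0 = e (zini S Q₀) →
      (∀ i : ℕ, ρ (i + 1) = e (zstep S (e.symm (ρ i)) (w i))) →
      ∀ t, ρ t = e (zrun S Q₀ w t) := by
    intro ρ h0 h1 t
    induction t with
    | zero => exact h0
    | succ t ih => rw [h1, ih, Equiv.symm_apply_apply]; rfl
  constructor
  · rintro ⟨ρ, h0, hd, hA⟩
    obtain ⟨r, j, hr, hj, ⟨T, hK⟩, hF⟩ := complete S Q₀ w ρ h0 hd hA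
    refine ⟨fun t => e (zrun S Q₀ w t), rfl, fun i => ?_,
      finProdFinEquiv (⟨r, hr⟩, ⟨j, by omega⟩), ?_, ?_⟩
    · beta_reduce; rw [Equiv.symm_apply_apply]; rfl
    · rw [inf_ne]
      intro N
      obtain ⟨t, h1, h2⟩ := hF N
      refine ⟨t + 1, by omega, ?_⟩
      simpa [zG_iff] using h2
    · rw [inf_emp]
      refine ⟨T + 1, fun t ht => ?_⟩
      obtain ⟨t, rfl⟩ : ∃ t', t = t' + 1 := ⟨t - 1, by omega⟩
      have := (zB_iff S Q₀ w t r j).2 (hK t (by omega))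
      simpa using this
  · rintro ⟨ρ, h0, h1, i, hG, hB⟩
    have hr := hrun ρ h0 h1
    rw [inf_ne] at hG
    rw [inf_emp] at hB
    apply sound S Q₀ w (finProdFinEquiv.symm i).1 (finProdFinEquiv.symm i).2
    · obtain ⟨T, hT⟩ := hB
      refine ⟨T, fun t ht => ?_⟩
      rw [← zB_iff]
      have := hT (t + 1) (by omega)
      rw [hr] at this
      simpa using this
    · intro N
      obtain ⟨t, h2, h3⟩ := hG (N + 1)
      obtain ⟨t, rfl⟩ : ∃ t', t = t' + 1 := ⟨t - 1, by omega⟩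
      refine ⟨t, by omega, ?_⟩
      rw [← zG_iff]
      rw [hr] at h3
      simpa using h3
/-! ### parity conditions -/

section parity
variable {k : ℕ} (Δ : Q → α → Q → Prop) (G B : Fin k → Set Q)

lemma chain_le (h1 : ∀ i : Fin k, B i ⊂ G i)
    (h2 : ∀ i j : Fin k, (i : ℕ) + 1 = (j : ℕ) → G i ⊂ B j) (i j : ℕ) (hi : i < k) (hj : j < k)
    (h : i ≤ j) : B ⟨i, hi⟩ ⊆ B ⟨j, hj⟩ := by
  induction j, h using Nat.le_induction with
  | base => exact subset_rfl
  | succ j h ih =>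
    have hj' : j < k := by omega
    exact (ih hj').trans ((h1 _).subset.trans (h2 ⟨j, hj'⟩ ⟨j + 1, hj⟩ rfl).subset)

lemma chain_card (h1 : ∀ i : Fin k, B i ⊂ G i)
    (h2 : ∀ i j : Fin k, (i : ℕ) + 1 = (j : ℕ) → G i ⊂ B j) : k ≤ Fintype.card Q := by
  have h : ∀ i (hi : i < k), i + 1 ≤ (G ⟨i, hi⟩).ncard := by
    intro i
    induction i with
    | zero =>
      intro hi
      have := Set.ncard_lt_ncard (h1 ⟨0, hi⟩)
      omega
    | succ i ih =>
      intro hi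
      have a := ih (by omega)
      have b := Set.ncard_lt_ncard (h1 ⟨i + 1, hi⟩)
      have c := Set.ncard_lt_ncard (h2 ⟨i, by omega⟩ ⟨i + 1, hi⟩ rfl)
      omega
  rcases k with _ | k
  · omega
  · have a := h k (by omega)
    have b := Set.ncard_le_card (G ⟨k, by omega⟩)
    rw [Nat.card_eq_fintype_card] at b
    omega

def mkS (h1 : ∀ i : Fin k, B i ⊂ G i) : Setup Q α where
  k := k
  sf j q := j ≤ k ∧ ∀ i : Fin k, (i : ℕ) < j → q ∉ G i
  ht j q := ∀ h : j < k, q ∈ B ⟨j, h⟩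
  Δ := Δ
  sf0 q := ⟨Nat.zero_le _, fun i h => absurd h (by omega)⟩
  sfanti j q h := ⟨by omega, fun i hi => h.2 i (by omega)⟩
  sfk j q h := h.1
  htsf j q h h' := by
    have hj : j < k := h'.1
    exact h'.2 ⟨j, hj⟩ (Nat.lt_succ_self j) ((h1 _).subset (h hj))

lemma acc_iff (h1 : ∀ i : Fin k, B i ⊂ G i)
    (h2 : ∀ i j : Fin k, (i : ℕ) + 1 = (j : ℕ) → G i ⊂ B j) (ρ : ℕ → Q) :
    (∀ i : Fin k, (InfStates ρ ∩ G i).Nonempty → (InfStates ρ ∩ B i).Nonempty) ↔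
      Acc (mkS Δ G B h1) ρ := by
  constructor
  · intro h
    have hex : ∃ j, ∀ hj : j < k, (InfStates ρ ∩ G ⟨j, hj⟩).Nonempty :=
      ⟨k, fun hj => absurd hj (lt_irrefl _)⟩
    have hs := Nat.find_spec hex
    have hm := fun m => @Nat.find_min _ _ hex m
    have hle : Nat.find hex ≤ k := Nat.find_min' hex (fun hj => absurd hj (lt_irrefl _))
    generalize Nat.find hex = j at hs hm hle
    refine ⟨j, ?_, ?_⟩
    · have : ∀ i : Fin k, ∃ T, (i : ℕ) < j → ∀ t, T ≤ t → ρ t ∉ G i := by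
        intro i
        by_cases hi : (i : ℕ) < j
        · have := hm i hi
          have h3 : ¬ (InfStates ρ ∩ G i).Nonempty := fun h4 => this (fun _ => h4)
          rw [Set.not_nonempty_iff_eq_empty, inf_emp] at h3
          obtain ⟨T, hT⟩ := h3
          exact ⟨T, fun _ => hT⟩
        · exact ⟨0, fun h => absurd h hi⟩
      choose T hT using this
      obtain ⟨b, hb⟩ := (Set.finite_range T).bddAbove
      exact ⟨b, fun t ht => ⟨hle, fun i hi => hT i hi t ((hb ⟨i, rfl⟩).trans ht)⟩⟩
    · intro N
      by_cases hj : j < k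
      · obtain ⟨t, h3, h4⟩ := (inf_ne ρ _).1 (h ⟨j, hj⟩ (hs hj)) N
        exact ⟨t, h3, fun _ => h4⟩
      · exact ⟨N, le_rfl, fun h => absurd h hj⟩
  · rintro ⟨j, ⟨T, hT⟩, hj⟩ i hi
    have hji : j ≤ i := by
      by_contra hc
      obtain ⟨t, h3, h4⟩ := (inf_ne ρ _).1 hi T
      exact (hT t h3).2 i (by omega) h4
    have hjk : j < k := hji.trans_lt i.2
    rw [inf_ne]
    intro N
    obtain ⟨t, h3, h4⟩ := hj N
    exact ⟨t, h3, chain_le G B h1 h2 j i hjk i.2 hji (h4 hjk)⟩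

end parity

lemma num_bd (n k : ℕ) (h : k ≤ n) (hn : 1 ≤ n) :
    (DD n k).card ^ n * ((n * (k + 1)) ^ n * 2 ^ n) ≤ ((n + 1) ^ 11) ^ n := by
  rw [← mul_pow, ← mul_pow]
  apply Nat.pow_le_pow_left
  rw [DD_card]
  obtain ⟨X, rfl⟩ : ∃ X, n + 1 = X := ⟨_, rfl⟩
  have hX : 2 ≤ n + 1 := by omega
  generalize hXX : n + 1 = X at *
  have a1 : n ≤ X := by omega
  have a2 : k + 1 ≤ X := by omega
  have b0 : 2 * (n * (k + 1)) + 1 ≤ X ^ 4 := by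
    have : n * (k + 1) ≤ X * X := Nat.mul_le_mul a1 a2
    have : 1 ≤ X * X := by nlinarith
    have : 4 ≤ X * X := by nlinarith
    nlinarith
  have b1 : n * ((k + 1) * ((k + 1) * (2 * (n * (k + 1)) + 1))) ≤ X ^ 7 := by
    calc _ ≤ X * (X * (X * X ^ 4)) := by gcongr
      _ = X ^ 7 := by ring
  have b2 : n * ((k + 1) * ((k + 1) * (2 * (n * (k + 1)) + 1))) + 1 ≤ X ^ 8 := by
    have : 1 ≤ X ^ 7 := Nat.one_le_pow _ _ (by omega)
    calc _ ≤ 2 * X ^ 7 := by omega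
      _ ≤ X * X ^ 7 := by gcongr
      _ = X ^ 8 := by ring
  calc _ ≤ X ^ 8 * (X * X * X) := by gcongr
    _ = X ^ 11 := by ring

end PD

/-- Parity determinization, asymptotic form `2^{O(n log n)}`: there is a
constant `c > 0` such that every nondeterministic parity automaton (a Streett
automaton whose condition forms the chain
`B(1) ⊊ G(1) ⊊ B(2) ⊊ ⋯ ⊊ B(k) ⊊ G(k)`) with `n ≥ 1` states and index size
`k ≥ 1` has an equivalent deterministic Rabin automaton with at most
`2^{c·n·log₂(n+1)}` states and index size at most `n·(k+1)`. -/
theorem parity_determinization :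
    ∃ c : ℝ, 0 < c ∧ ∀ (α Q : Type) (_ : Fintype α) (_ : Nonempty α) (_ : Fintype Q)
      (n k : ℕ), Fintype.card Q = n → 1 ≤ n → 1 ≤ k →
      ∀ (Q₀ : Set Q) (Δ : Q → α → Q → Prop) (G B : Fin k → Set Q),
      (∀ i : Fin k, B i ⊂ G i) →
      (∀ i j : Fin k, (i : ℕ) + 1 = (j : ℕ) → G i ⊂ B j) →
      ∃ (m kB : ℕ) (init : Fin m) (δ : Fin m → α → Fin m)
        (G' B' : Fin kB → Set (Fin m)),
        (m : ℝ) ≤ (2 : ℝ) ^ (c * (n : ℝ) * Real.logb 2 ((n : ℝ) + 1)) ∧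
        kB ≤ n * (k + 1) ∧
        ∀ w : ℕ → α,
          (∃ ρ : ℕ → Q, ρ 0 ∈ Q₀ ∧ (∀ i : ℕ, Δ (ρ i) (w i) (ρ (i + 1))) ∧
            ∀ i : Fin k, (InfStates ρ ∩ G i).Nonempty → (InfStates ρ ∩ B i).Nonempty) ↔
          (∃ ρ : ℕ → Fin m, ρ 0 = init ∧ (∀ i : ℕ, ρ (i + 1) = δ (ρ i) (w i)) ∧
            ∃ i : Fin kB, (InfStates ρ ∩ G' i).Nonempty ∧ InfStates ρ ∩ B' i = ∅) := by
  refine ⟨11, by norm_num, ?_⟩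
  intro α Q _ _ _ n k hn h1n h1k Q₀ Δ G B hBG hGB
  subst hn
  have : Nonempty Q := Fintype.card_pos_iff.1 h1n
  have hk : k ≤ Fintype.card Q := PD.chain_card G B hBG hGB
  obtain ⟨m, init, δ, G', B', hm, hw⟩ := PD.rabin (PD.mkS Δ G B hBG) Q₀
  refine ⟨m, _, init, δ, G', B', ?_, le_rfl, ?_⟩
  · have h2 : m ≤ ((Fintype.card Q + 1) ^ 11) ^ Fintype.card Q :=
      hm.trans (PD.num_bd _ _ hk h1n)
    have h3 : (m : ℝ) ≤ (((Fintype.card Q : ℝ) + 1) ^ 11) ^ Fintype.card Q := by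
      exact_mod_cast h2
    refine h3.trans (le_of_eq ?_)
    have hpos : (0 : ℝ) < (Fintype.card Q : ℝ) + 1 := by positivity
    rw [mul_comm ((11 : ℝ) * _), Real.rpow_mul (by norm_num),
      Real.rpow_logb (by norm_num) (by norm_num) hpos, ← pow_mul, ← Real.rpow_natCast]
    push_cast
    rfl
  · intro w
    rw [← hw w]
    constructor
    · rintro ⟨ρ, h0, hd, hA⟩
      exact ⟨ρ, h0, hd, (PD.acc_iff Δ G B hBG hGB ρ).1 hA⟩
    · rintro ⟨ρ, h0, hd, hA⟩
      exact ⟨ρ, h0, hd, (PD.acc_iff Δ G B hBG hGB ρ).2 hA⟩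
end

section
/- There exists a constant c > 0 such that for every nondeterministic Rabin automaton A with n ≥ 1 states and index size k ≥ 1, there exists a deterministic Rabin automaton B over the same alphabet with L(B) = L(A), whose number of states is at most 2^{c·n·k·log₂(n+1)} and whose index size is at most 2·n·k. -/
set_option linter.unusedSectionVars false
set_option linter.unusedVariables false

namespace RabinDet

open Filter

/-- Lexicographic comparison of sets of naturals (membership preferred). -/
def GeLex (A C : Set ℕ) : Prop :=
  ∀ j, (∀ i, i < j → (i ∈ A ↔ i ∈ C)) → j ∈ C → j ∈ A

/-- states of the determinized automaton -/
@[ext] structure St (Q : Type) where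
  reach : Set Q
  path : Q → Set ℕ
  green : Set ℕ
  bad : Set ℕ

section step

variable {Q α : Type} (n : ℕ) (Δ : Q → α → Q → Prop) (G B : Set Q) (s : St Q) (a : α)

def Pred (q q' : Q) : Prop := q ∈ s.reach ∧ Δ q a q'

def IsBest (q q' : Q) : Prop :=
  Pred Δ s a q q' ∧ ∀ p, Pred Δ s a p q' → GeLex (s.path q) (s.path p)

open Classical in
noncomputable def bp (q' : Q) : Q :=
  if h : ∃ q, IsBest Δ s a q q' then h.choose else q'

def ok (q' : Q) : Prop := (∃ q, Pred Δ s a q q') ∧ q' ∉ B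

def ext (q' : Q) : Set ℕ :=
  {x | ok Δ B s a q' ∧ (x ∈ s.path (bp Δ s a q') ∨ (s.path (bp Δ s a q') = ∅ ∧ x = n) ∨
    (q' ∈ G ∧ ∃ y ∈ s.path (bp Δ s a q'), (∀ z ∈ s.path (bp Δ s a q'), z ≤ y) ∧ x = n + 1 + y))}

def grn (x : ℕ) : Prop :=
  (∃ q, x ∈ ext n Δ G B s a q) ∧ ∀ q, x ∈ ext n Δ G B s a q → ∃ y ∈ ext n Δ G B s a q, x < y

def tr (q : Q) : Set ℕ :=
  {x | x ∈ ext n Δ G B s a q ∧ ∀ z ∈ ext n Δ G B s a q, z < x → ¬ grn n Δ G B s a z}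

def alive (x : ℕ) : Prop := ∃ q, x ∈ tr n Δ G B s a q

open Classical in
noncomputable def rk (x : ℕ) : ℕ := Nat.count (alive n Δ G B s a) x

noncomputable def step : St Q where
  reach := {q' | ∃ q, Pred Δ s a q q'}
  path := fun q => rk n Δ G B s a '' tr n Δ G B s a q
  green := {i | i < n ∧ grn n Δ G B s a i}
  bad := {i | i < n ∧ ∃ j, j ≤ i ∧ ¬ alive n Δ G B s a j}

structure Inv : Prop where
  lt : ∀ q, ∀ x ∈ s.path q, x < n
  tree : ∀ q p x, x ∈ s.path q → x ∈ s.path p → ∀ y, y ≤ x → y ∈ s.path q → y ∈ s.path p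
  rch : ∀ q, ∀ x ∈ s.path q, q ∈ s.reach
  glt : ∀ x ∈ s.green, x < n
  blt : ∀ x ∈ s.bad, x < n

theorem geLex_of_le {A C : Set ℕ} (h : toLex (fun x => (x ∈ C : Prop)) ≤ toLex (fun x => (x ∈ A : Prop))) :
    GeLex A C := by
  intro j hj hC
  rcases h.eq_or_lt with h | h
  · have := congrFun (congrArg ofLex h) j
    simp at this
    exact this.1 hC
  · obtain ⟨i, h1, h2⟩ := h
    simp at h1 h2
    rcases lt_trichotomy i j with h | h | h
    · have := hj i h
      rw [this] at h2
      exact absurd h2 (lt_irrefl _)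
    · subst h
      exact h2.le hC
    · exact (h1 j h).1 hC

variable [Fintype Q]

theorem bp_best {q q' : Q} (h : Pred Δ s a q q') : IsBest Δ s a (bp Δ s a q') q' := by
  classical
  have : ∃ q, IsBest Δ s a q q' := by
    obtain ⟨p, hp, hm⟩ := Finset.exists_max_image (Finset.univ.filter (fun q => Pred Δ s a q q'))
      (fun q => toLex (fun x => (x ∈ s.path q : Prop))) ⟨q, by simpa using h⟩
    simp at hp hm
    exact ⟨p, hp, fun p' hp' => geLex_of_le (hm p' hp')⟩
  unfold bp
  rw [dif_pos this]
  exact this.choose_spec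

variable {n Δ G B s a}

theorem ext_old (hs : Inv n s) {q : Q} {x : ℕ} (hx : x < n) :
    x ∈ ext n Δ G B s a q ↔ ok Δ B s a q ∧ x ∈ s.path (bp Δ s a q) := by
  constructor
  · rintro ⟨h, h1 | h1 | ⟨_, y, _, _, h1⟩⟩
    · exact ⟨h, h1⟩
    · omega
    · omega
  · rintro ⟨h, h1⟩
    exact ⟨h, Or.inl h1⟩

theorem ext_tree (hs : Inv n s) (q p : Q) (x : ℕ) (hq : x ∈ ext n Δ G B s a q)
    (hp : x ∈ ext n Δ G B s a p) (y : ℕ) (hy : y ≤ x) (h : y ∈ ext n Δ G B s a q) :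
    y ∈ ext n Δ G B s a p := by
  obtain ⟨okp, hp⟩ := hp
  obtain ⟨okq, hq⟩ := hq
  rcases lt_or_ge x n with hxn | hxn
  · have hq : x ∈ s.path (bp Δ s a q) := by
      rcases hq with h | h | ⟨_, z, _, _, h⟩ <;> first | assumption | omega
    have hp : x ∈ s.path (bp Δ s a p) := by
      rcases hp with h | h | ⟨_, z, _, _, h⟩ <;> first | assumption | omega
    rw [ext_old hs (by omega)] at h ⊢
    exact ⟨okp, hs.tree _ _ x hq hp y hy h.2⟩
  · rcases hq with h1 | ⟨h0, h1⟩ | ⟨g, z, hz, hz', h1⟩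
    · have := hs.lt _ _ h1; omega
    · have : y = x := by
        rcases h with ⟨_, h | h | ⟨_, z, hz, _⟩⟩
        · rw [h0] at h; exact absurd h (by simp)
        · omega
        · rw [h0] at hz; exact absurd hz (by simp)
      rw [this]; exact ⟨okp, hp⟩
    · rcases hp with h2 | ⟨h0, h2⟩ | ⟨g', z', hw, hw', h2⟩
      · have := hs.lt _ _ h2; omega
      · omega
      · have : z = z' := by omega
        subst this
        rcases h with ⟨_, h | ⟨h, _⟩ | ⟨_, z2, hz2, hz2', h⟩⟩
        · exact ⟨okp, Or.inl (hs.tree _ _ z hz hw y (hz' y h) h)⟩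
        · rw [h] at hz; exact absurd hz (by simp)
        · have h3 := hz2' _ hz
          have h4 := hz' _ hz2
          have : z2 = z := by omega
          subst this
          exact ⟨okp, Or.inr (Or.inr ⟨g', z2, hw, hw', h⟩)⟩

theorem tr_tree (hs : Inv n s) (q p : Q) (x : ℕ) (hq : x ∈ tr n Δ G B s a q)
    (hp : x ∈ tr n Δ G B s a p) (y : ℕ) (hy : y ≤ x) (h : y ∈ tr n Δ G B s a q) :
    y ∈ tr n Δ G B s a p :=
  ⟨ext_tree hs q p x hq.1 hp.1 y hy h.1, fun z hz hzy => hp.2 z hz (by omega)⟩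

/-- every alive node hosts a state -/
theorem host (hs : Inv n s) {x : ℕ} (hx : alive n Δ G B s a x) :
    ∃ q, x ∈ tr n Δ G B s a q ∧ ∀ y ∈ tr n Δ G B s a q, y ≤ x := by
  obtain ⟨q, hq⟩ := hx
  by_cases hg : grn n Δ G B s a x
  · refine ⟨q, hq, fun y hy => ?_⟩
    by_contra hlt
    exact hy.2 x hq.1 (by omega) hg
  · have : ∃ p, x ∈ ext n Δ G B s a p ∧ ∀ y ∈ ext n Δ G B s a p, y ≤ x := by
      by_contra hcon
      apply hg
      refine ⟨⟨q, hq.1⟩, fun p hp => ?_⟩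
      by_contra hc
      exact hcon ⟨p, hp, fun y hy => by
        by_contra hlt
        exact hc ⟨y, hy, by omega⟩⟩
    obtain ⟨p, hp, hm⟩ := this
    refine ⟨p, ⟨hp, fun z hz hzx => ?_⟩, fun y hy => hm y hy.1⟩
    exact hq.2 z (ext_tree hs p q x hp hq.1 z hzx.le hz) hzx

theorem rk_le_card (hs : Inv n s) (x : ℕ) : rk n Δ G B s a x ≤ Fintype.card Q := by
  classical
  unfold rk
  rw [Nat.count_eq_card_filter_range]
  rcases isEmpty_or_nonempty Q with he | he
  · rw [Finset.card_eq_zero.2]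
    · exact Nat.zero_le _
    · refine Finset.filter_eq_empty_iff.2 ?_
      rintro y _ ⟨q, _⟩
      exact he.elim q
  choose! f hf using fun (x : ℕ) (hx : alive n Δ G B s a x) => host hs hx
  rw [← Finset.card_univ]
  refine Finset.card_le_card_of_injOn f (fun _ _ => Finset.mem_coe.2 (Finset.mem_univ _)) ?_
  intro u hu v hv huv
  simp at hu hv
  have h1 := hf u hu.2
  have h2 := hf v hv.2
  rw [huv] at h1
  exact le_antisymm (h2.2 _ h1.1) (h1.2 _ h2.1)

theorem rk_succ {x : ℕ} (hx : alive n Δ G B s a x) :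
    rk n Δ G B s a (x + 1) = rk n Δ G B s a x + 1 := by
  classical
  unfold rk
  rw [Nat.count_succ, if_pos hx]

theorem rk_mono : Monotone (rk n Δ G B s a) := by
  classical
  exact Nat.count_monotone _

theorem rk_strict {x y : ℕ} (hx : alive n Δ G B s a x) (h : x < y) :
    rk n Δ G B s a x < rk n Δ G B s a y := by
  have := rk_mono (n := n) (Δ := Δ) (G := G) (B := B) (s := s) (a := a) (Nat.succ_le_of_lt h)
  rw [Nat.succ_eq_add_one, rk_succ hx] at this
  omega

theorem rk_inj {x y : ℕ} (hx : alive n Δ G B s a x) (hy : alive n Δ G B s a y)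
    (h : rk n Δ G B s a x = rk n Δ G B s a y) : x = y := by
  rcases lt_trichotomy x y with h' | h' | h'
  · have := rk_strict hx h'; omega
  · exact h'
  · have := rk_strict hy h'; omega

theorem rk_le (x : ℕ) : rk n Δ G B s a x ≤ x := by
  classical
  exact Nat.count_le _

theorem rk_eq {m : ℕ} (h : ∀ j, j < m → alive n Δ G B s a j) : rk n Δ G B s a m = m := by
  induction m with
  | zero => have := rk_le (n := n) (Δ := Δ) (G := G) (B := B) (s := s) (a := a) 0; omega
  | succ m ih => rw [rk_succ (h m (by omega)), ih (fun j hj => h j (by omega))]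

theorem rk_lt {m x : ℕ} (hm : ¬ alive n Δ G B s a m) (h : m < x) : rk n Δ G B s a x < x := by
  classical
  induction x with
  | zero => omega
  | succ x ih =>
    unfold rk at *
    rw [Nat.count_succ]
    rcases Nat.lt_succ_iff_lt_or_eq.1 h with h' | h'
    · have := ih h'
      split <;> omega
    · subst h'
      rw [if_neg hm]
      have : Nat.count (alive n Δ G B s a) m ≤ m := Nat.count_le _
      omega

theorem dead_exists (hn : Fintype.card Q = n) (hs : Inv n s) : ∃ j ≤ n, ¬ alive n Δ G B s a j := by
  by_contra hcon
  push Not at hcon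
  have h1 := rk_eq (n := n) (Δ := Δ) (G := G) (B := B) (s := s) (a := a) (m := n + 1)
    (fun j hj => hcon j (by omega))
  have := rk_le_card (Δ := Δ) (G := G) (B := B) (a := a) hs (n + 1)
  omega

theorem step_inv (hn : Fintype.card Q = n) (hs : Inv n s) : Inv n (step n Δ G B s a) where
  lt := by
    rintro q _ ⟨x, hx, rfl⟩
    have h1 := rk_succ (n := n) (Δ := Δ) (G := G) (B := B) (s := s) (a := a) ⟨q, hx⟩
    have := rk_le_card (Δ := Δ) (G := G) (B := B) (a := a) hs (x + 1)
    omega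
  tree := by
    rintro q p _ ⟨x, hx, rfl⟩ ⟨x', hx', h⟩ _ hle ⟨y, hy, rfl⟩
    have : x' = x := rk_inj ⟨p, hx'⟩ ⟨q, hx⟩ h
    subst this
    refine ⟨y, tr_tree hs q p x' hx hx' y ?_ hy, rfl⟩
    by_contra hlt
    have := rk_strict (n := n) (Δ := Δ) (G := G) (B := B) (s := s) (a := a) ⟨q, hx⟩ (by omega : x' < y)
    omega
  rch := by
    rintro q _ ⟨x, hx, rfl⟩
    exact hx.1.1.1
  glt := fun x hx => hx.1
  blt := fun x hx => hx.1

/-- a stable rank keeps its name -/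
theorem stable {i : ℕ} (hi : i < n) (hb : i ∉ (step n Δ G B s a).bad) :
    (∀ j ≤ i, alive n Δ G B s a j) ∧ rk n Δ G B s a i = i ∧
    ∀ q, i ∈ (step n Δ G B s a).path q ↔ i ∈ tr n Δ G B s a q := by
  have h1 : ∀ j ≤ i, alive n Δ G B s a j := by
    intro j hj
    by_contra h
    exact hb ⟨hi, j, hj, h⟩
  have h2 : rk n Δ G B s a i = i := rk_eq (fun j hj => h1 j hj.le)
  refine ⟨h1, h2, fun q => ⟨?_, fun h => ⟨i, h, h2⟩⟩⟩
  rintro ⟨x, hx, h⟩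
  have : x = i := rk_inj ⟨q, hx⟩ (h1 i le_rfl) (by rw [h, h2])
  exact this ▸ hx

theorem stable_back (hs : Inv n s) {i : ℕ} (hi : i < n) (hb : i ∉ (step n Δ G B s a).bad) {q : Q}
    (hq : i ∈ (step n Δ G B s a).path q) : i ∈ s.path (bp Δ s a q) ∧ q ∉ B := by
  have := (((stable hi hb).2.2 q).1 hq).1
  rw [ext_old hs hi] at this
  exact ⟨this.2, this.1.2⟩

theorem stable_nonempty {i : ℕ} (hi : i < n) (hb : i ∉ (step n Δ G B s a).bad) :
    ∃ q, i ∈ (step n Δ G B s a).path q := by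
  obtain ⟨q, hq⟩ := (stable hi hb).1 i le_rfl
  exact ⟨q, ((stable hi hb).2.2 q).2 hq⟩

theorem green_deepest {i : ℕ} (hi : i < n) (hb : i ∉ (step n Δ G B s a).bad) {q : Q}
    (hq : i ∈ (step n Δ G B s a).path q) (hg : i ∈ (step n Δ G B s a).green) :
    ∀ y ∈ (step n Δ G B s a).path q, y ≤ i := by
  rintro _ ⟨x, hx, rfl⟩
  have h := (stable hi hb)
  have h3 : i ∈ tr n Δ G B s a q := (h.2.2 q).1 hq
  have : x ≤ i := by
    by_contra hlt
    exact hx.2 i h3.1 (by omega) hg.2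
  calc _ ≤ _ := rk_mono this
    _ = i := h.2.1

theorem deeper_back (hs : Inv n s) {i : ℕ} (hi : i < n) (hb : i ∉ (step n Δ G B s a).bad) {q : Q}
    (hq : i ∈ (step n Δ G B s a).path q)
    (hg : i ∈ (step n Δ G B s a).green ∨ ∃ y ∈ (step n Δ G B s a).path q, i < y) (hG : q ∉ G) :
    ∃ y ∈ s.path (bp Δ s a q), i < y := by
  have h := (stable hi hb)
  have h3 : i ∈ tr n Δ G B s a q := (h.2.2 q).1 hq
  have h4 := stable_back hs hi hb hq
  have : ∃ y ∈ ext n Δ G B s a q, i < y := by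
    rcases hg with hg | ⟨_, ⟨x, hx, rfl⟩, hlt⟩
    · exact hg.2.2 q h3.1
    · exact ⟨x, hx.1, lt_of_lt_of_le hlt (rk_le x)⟩
  obtain ⟨y, ⟨_, hy | hy | hy⟩, hiy⟩ := this
  · exact ⟨y, hy, hiy⟩
  · rw [hy.1] at h4; exact absurd h4.1 (by simp)
  · exact absurd hy.1 hG

/-- progress lemmas for completeness -/
theorem low_iff (hs : Inv n s) {m : ℕ} (hm : m ≤ n) (ha : ∀ j < m, alive n Δ G B s a j)
    (hg : ∀ j < m, ¬ grn n Δ G B s a j) {q : Q} (hq : ok Δ B s a q) {j : ℕ} (hj : j < m) :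
    j ∈ (step n Δ G B s a).path q ↔ j ∈ s.path (bp Δ s a q) := by
  have h2 : rk n Δ G B s a j = j := rk_eq (fun i hi => ha i (by omega))
  constructor
  · rintro ⟨x, hx, h⟩
    have : x = j := rk_inj ⟨q, hx⟩ (ha j hj) (by rw [h, h2])
    subst this
    exact ((ext_old hs (by omega)).1 hx.1).2
  · intro h
    refine ⟨j, ⟨(ext_old hs (by omega)).2 ⟨hq, h⟩, fun z _ hz => hg z (by omega)⟩, h2⟩

theorem high_aux {m : ℕ} (ha : ∀ j < m, alive n Δ G B s a j)
    (hg : ∀ j < m, ¬ grn n Δ G B s a j) {q : Q} {x : ℕ} (hx : x ∈ ext n Δ G B s a q)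
    (hmx : m ≤ x) :
    ∃ x' ∈ (step n Δ G B s a).path q, m ≤ x' ∧ x' ≤ x ∧ (¬ alive n Δ G B s a m → x' < x) := by
  classical
  have hex : ∃ x, x ∈ ext n Δ G B s a q ∧ m ≤ x := ⟨x, hx, hmx⟩
  have h0 := Nat.find_spec hex
  have h1 : Nat.find hex ≤ x := Nat.find_min' hex ⟨hx, hmx⟩
  have h2 := fun y => Nat.find_min hex (m := y)
  generalize Nat.find hex = x0 at *
  have htr : x0 ∈ tr n Δ G B s a q := by
    refine ⟨h0.1, fun z hz hzx => hg z ?_⟩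
    by_contra hlt
    exact h2 z hzx ⟨hz, by omega⟩
  refine ⟨rk n Δ G B s a x0, ⟨x0, htr, rfl⟩, ?_, (rk_le _).trans h1, fun hd => ?_⟩
  · calc m = rk n Δ G B s a m := (rk_eq ha).symm
      _ ≤ _ := rk_mono h0.2
  · have : m ≠ x0 := by
      rintro rfl
      exact hd ⟨q, htr⟩
    exact (rk_lt hd (by omega)).trans_le h1

theorem high_old {m : ℕ} (ha : ∀ j < m, alive n Δ G B s a j)
    (hg : ∀ j < m, ¬ grn n Δ G B s a j) {q : Q} (hq : ok Δ B s a q) {x : ℕ}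
    (hx : x ∈ s.path (bp Δ s a q)) (hmx : m ≤ x) :
    ∃ x' ∈ (step n Δ G B s a).path q, m ≤ x' ∧ x' ≤ x ∧ (¬ alive n Δ G B s a m → x' < x) :=
  high_aux ha hg (q := q) ⟨hq, Or.inl hx⟩ hmx

theorem high_new (hs : Inv n s) {m : ℕ} (hm : m ≤ n) (ha : ∀ j < m, alive n Δ G B s a j)
    (hg : ∀ j < m, ¬ grn n Δ G B s a j) {q : Q} (hq : ok Δ B s a q)
    (h : q ∈ G) :
    ∃ x' ∈ (step n Δ G B s a).path q, m ≤ x' := by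
  have : ∃ x ∈ ext n Δ G B s a q, m ≤ x := by
    rcases Set.eq_empty_or_nonempty (s.path (bp Δ s a q)) with h0 | h0
    · exact ⟨n, ⟨hq, Or.inr (Or.inl ⟨h0, rfl⟩)⟩, hm⟩
    · have hf : (s.path (bp Δ s a q)).Finite := (Set.finite_lt_nat n).subset (hs.lt _)
      obtain ⟨y, hy, hy'⟩ := hf.exists_maximalFor id _ h0
      refine ⟨n + 1 + y, ⟨hq, Or.inr (Or.inr ⟨h, y, hy, fun z hz => ?_, rfl⟩)⟩, by omega⟩
      by_contra hlt
      have := hy' hz (by simp; omega)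
      simp at this
      omega
  obtain ⟨x, hx, hmx⟩ := this
  obtain ⟨x', h1, h2, _⟩ := high_aux ha hg hx hmx
  exact ⟨x', h1, h2⟩

end step

section run

variable {Q α : Type} [Fintype Q] (n : ℕ) (Δ : Q → α → Q → Prop) (G B : Set Q) (Q₀ : Set Q)
  (w : ℕ → α)

def initSt : St Q where
  reach := Q₀
  path := fun _ => ∅
  green := ∅
  bad := ∅

noncomputable def sq : ℕ → St Q
  | 0 => initSt Q₀
  | t + 1 => step n Δ G B (sq t) (w t)

theorem init_inv : Inv n (initSt Q₀) where
  lt := fun _ _ h => h.elim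
  tree := fun _ _ _ h => h.elim
  rch := fun _ _ h => h.elim
  glt := fun _ h => h.elim
  blt := fun _ h => h.elim

variable {n Δ G B Q₀ w}

theorem sq_inv (hn : Fintype.card Q = n) (t : ℕ) : Inv n (sq n Δ G B Q₀ w t) := by
  induction t with
  | zero => exact init_inv n Q₀
  | succ t ih => exact step_inv hn ih

/-- König's lemma -/
theorem konig (R : ℕ → Q → Prop) (E : ℕ → Q → Q → Prop) (hne : ∀ t, ∃ q, R t q)
    (hE : ∀ t q', R (t + 1) q' → ∃ q, R t q ∧ E t q q') :
    ∃ ρ : ℕ → Q, (∀ t, R t (ρ t)) ∧ ∀ t, E t (ρ t) (ρ (t + 1)) := by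
  classical
  let _ : TopologicalSpace Q := ⊥
  have : DiscreteTopology Q := ⟨rfl⟩
  let K : ℕ → Set (ℕ → Q) := fun m => {ρ | (∀ t ≤ m, R t (ρ t)) ∧ ∀ t < m, E t (ρ t) (ρ (t + 1))}
  have hK : (⋂ m, K m).Nonempty := by
    refine IsCompact.nonempty_iInter_of_sequence_nonempty_isCompact_isClosed K ?_ ?_ ?_ ?_
    · intro m ρ h
      exact ⟨fun t ht => h.1 t (by omega), fun t ht => h.2 t (by omega)⟩
    · intro m
      have : ∀ m q, R m q → ∃ ρ ∈ K m, ρ m = q := by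
        intro m
        induction m with
        | zero =>
          intro q hq
          refine ⟨fun _ => q, ⟨fun t ht => ?_, fun t ht => by omega⟩, rfl⟩
          have : t = 0 := by omega
          subst this; exact hq
        | succ m ih =>
          intro q' hq'
          obtain ⟨q, hq, he⟩ := hE m q' hq'
          obtain ⟨ρ, h, h1⟩ := ih q hq
          refine ⟨Function.update ρ (m + 1) q', ⟨fun t ht => ?_, fun t ht => ?_⟩, by simp⟩
          · rcases eq_or_ne t (m + 1) with h2 | h2
            · subst h2; simpa using hq'
            · rw [Function.update_of_ne h2]; exact h.1 t (by omega)
          · rw [Function.update_of_ne (by omega : t ≠ m + 1)]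
            rcases eq_or_ne t m with h2 | h2
            · subst h2; rw [h1]; simpa using he
            · rw [Function.update_of_ne (by omega : t + 1 ≠ m + 1)]; exact h.2 t (by omega)
      obtain ⟨q, hq⟩ := hne m
      obtain ⟨ρ, h, _⟩ := this m q hq
      exact ⟨ρ, h⟩
    · have : IsClosed (K 0) := by
        have : K 0 = (fun ρ : ℕ → Q => ρ 0) ⁻¹' {q | R 0 q} := by
          ext ρ
          simp [K]
        rw [this]
        exact (isClosed_discrete _).preimage (continuous_apply 0)
      exact this.isCompact
    · intro m
      have : K m = (⋂ t, ⋂ (_ : t ≤ m), (fun ρ : ℕ → Q => ρ t) ⁻¹' {q | R t q}) ∩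
          ⋂ t, ⋂ (_ : t < m), (fun ρ : ℕ → Q => (ρ t, ρ (t + 1))) ⁻¹' {q | E t q.1 q.2} := by
        ext ρ
        simp [K]
      rw [this]
      refine IsClosed.inter ?_ ?_
      · exact isClosed_iInter fun t => isClosed_iInter fun _ =>
          (isClosed_discrete _).preimage (continuous_apply t)
      · exact isClosed_iInter fun t => isClosed_iInter fun _ =>
          (isClosed_discrete _).preimage ((continuous_apply t).prodMk (continuous_apply (t + 1)))
  obtain ⟨ρ, hρ⟩ := hK
  rw [Set.mem_iInter] at hρ
  exact ⟨ρ, fun t => (hρ t).1 t le_rfl, fun t => (hρ (t + 1)).2 t (by omega)⟩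

theorem sound (hn : Fintype.card Q = n) {i : ℕ} (hi : i < n)
    (hg : ∃ᶠ t in atTop, i ∈ (sq n Δ G B Q₀ w t).green)
    (hb : ∀ᶠ t in atTop, i ∉ (sq n Δ G B Q₀ w t).bad) :
    ∃ ρ : ℕ → Q, ρ 0 ∈ Q₀ ∧ (∀ t, Δ (ρ t) (w t) (ρ (t + 1))) ∧ (∃ᶠ t in atTop, ρ t ∈ G) ∧
      ∀ᶠ t in atTop, ρ t ∉ B := by
  obtain ⟨T, hT⟩ := eventually_atTop.1 hb
  set s := sq n Δ G B Q₀ w with hs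
  have hss : ∀ t, s (t + 1) = step n Δ G B (s t) (w t) := fun t => rfl
  have hinv : ∀ t, Inv n (s t) := sq_inv hn
  have hb' : ∀ t ≥ T, i ∉ (step n Δ G B (s t) (w t)).bad := fun t ht => hT (t + 1) (by omega)
  have hne : ∀ t ≥ T, ∃ q, i ∈ (s (t + 1)).path q := fun t ht => stable_nonempty hi (hb' t ht)
  have hbp : ∀ t q, q ∈ (s (t + 1)).reach → IsBest Δ (s t) (w t) (bp Δ (s t) (w t) q) q := by
    rintro t q ⟨p, hp⟩
    exact bp_best _ _ _ hp
  obtain ⟨ρ, h1, h2⟩ := konig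
    (fun t q => q ∈ (s t).reach ∧ (T < t → i ∈ (s t).path q))
    (fun t q q' => Δ q (w t) q' ∧ (T < t → q = bp Δ (s t) (w t) q')) (by
      intro t
      have hr : ∀ t, (∃ q, q ∈ (s (t + 1)).reach) → ∃ q, q ∈ (s t).reach := by
        rintro t ⟨q, p, hp⟩
        exact ⟨p, hp.1⟩
      rcases lt_or_ge T t with h | h
      · obtain ⟨t, rfl⟩ : ∃ t', t = t' + 1 := ⟨t - 1, by omega⟩
        obtain ⟨q, hq⟩ := hne t (by omega)
        exact ⟨q, (hinv _).rch q _ hq, fun _ => hq⟩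
      · have : ∀ d t, t + d = T + 1 → ∃ q, q ∈ (s t).reach := by
          intro d
          induction d with
          | zero =>
            intro t ht
            have : t = T + 1 := by omega
            subst this
            obtain ⟨q, hq⟩ := hne T le_rfl
            exact ⟨q, (hinv _).rch q _ hq⟩
          | succ d ih => exact fun t ht => hr t (ih (t + 1) (by omega))
        obtain ⟨q, hq⟩ := this (T + 1 - t) t (by omega)
        exact ⟨q, hq, fun h' => by omega⟩) (by
      rintro t q' ⟨hq, hp⟩
      have hbest := hbp t q' hq
      refine ⟨bp Δ (s t) (w t) q', ⟨hbest.1.1, fun ht => ?_⟩, hbest.1.2, fun _ => rfl⟩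
      exact (stable_back (hinv t) hi (hb' t (by omega)) (hp (by omega))).1)
  refine ⟨ρ, (h1 0).1, fun t => (h2 t).1, ?_, ?_⟩
  · rw [frequently_atTop] at hg ⊢
    intro N
    obtain ⟨t1, ht1, hg1⟩ := hg (N + T + 2)
    obtain ⟨t2, ht2, hg2⟩ := hg (t1 + 1)
    by_contra hcon
    push Not at hcon
    have key : ∀ d, ∀ y ∈ (s (t1 + d)).path (ρ (t1 + d)), y ≤ i := by
      intro d
      induction d with
      | zero =>
        obtain ⟨t, rfl⟩ : ∃ t', t1 = t' + 1 := ⟨t1 - 1, by omega⟩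
        exact green_deepest hi (hb' t (by omega)) ((h1 (t + 1)).2 (by omega)) hg1
      | succ d ih =>
        intro y hy
        by_contra hlt
        obtain ⟨y', hy', hlt'⟩ := deeper_back (hinv (t1 + d)) hi (hb' (t1 + d) (by omega))
          ((h1 (t1 + d + 1)).2 (by omega)) (Or.inr ⟨y, hy, by omega⟩) (hcon (t1 + d + 1) (by omega))
        rw [← (h2 (t1 + d)).2 (by omega)] at hy'
        have := ih y' hy'
        omega
    obtain ⟨d, rfl⟩ : ∃ d, t2 = t1 + d + 1 := ⟨t2 - t1 - 1, by omega⟩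
    obtain ⟨y', hy', hlt'⟩ := deeper_back (hinv (t1 + d)) hi (hb' (t1 + d) (by omega))
      ((h1 (t1 + d + 1)).2 (by omega)) (Or.inl hg2) (hcon (t1 + d + 1) (by omega))
    rw [← (h2 (t1 + d)).2 (by omega)] at hy'
    have := key d y' hy'
    omega
  · rw [eventually_atTop]
    refine ⟨T + 1, fun t ht => ?_⟩
    obtain ⟨t, rfl⟩ : ∃ t', t = t' + 1 := ⟨t - 1, by omega⟩
    exact (stable_back (hinv t) hi (hb' t (by omega)) ((h1 (t + 1)).2 (by omega))).2

theorem complete (hn : Fintype.card Q = n) (ρ : ℕ → Q) (h0 : ρ 0 ∈ Q₀)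
    (hΔ : ∀ t, Δ (ρ t) (w t) (ρ (t + 1))) (hG : ∃ᶠ t in atTop, ρ t ∈ G)
    (hB : ∀ᶠ t in atTop, ρ t ∉ B) :
    ∃ i, i < n ∧ (∃ᶠ t in atTop, i ∈ (sq n Δ G B Q₀ w t).green) ∧
      ∀ᶠ t in atTop, i ∉ (sq n Δ G B Q₀ w t).bad := by
  classical
  set s := sq n Δ G B Q₀ w with hs
  have hinv : ∀ t, Inv n (s t) := sq_inv hn
  by_contra hcon
  have hreach : ∀ t, ρ t ∈ (s t).reach := by
    intro t
    induction t with
    | zero => exact h0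
    | succ t ih => exact ⟨ρ t, ih, hΔ t⟩
  have hpred : ∀ t, Pred Δ (s t) (w t) (ρ t) (ρ (t + 1)) := fun t => ⟨hreach t, hΔ t⟩
  have hbest : ∀ t, GeLex ((s t).path (bp Δ (s t) (w t) (ρ (t + 1)))) ((s t).path (ρ t)) :=
    fun t => (bp_best _ _ _ (hpred t)).2 _ (hpred t)
  have hex : ∃ j, j ≤ n ∧ ¬ ∀ᶠ t in atTop, alive n Δ G B (s t) (w t) j := by
    by_contra hc
    push Not at hc
    have : ∀ᶠ t in atTop, ∀ j ∈ {j | j ≤ n}, alive n Δ G B (s t) (w t) j :=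
      (eventually_all_finite (Set.finite_le_nat n)).2 hc
    obtain ⟨t, ht⟩ := this.exists
    obtain ⟨j, hj, hd⟩ := dead_exists (Δ := Δ) (G := G) (B := B) (a := w t) hn (hinv t)
    exact hd (ht j hj)
  obtain ⟨hm, hmd⟩ := Nat.find_spec hex
  have hmin := fun y => Nat.find_min hex (m := y)
  generalize Nat.find hex = m at *
  have hal : ∀ j < m, ∀ᶠ t in atTop, alive n Δ G B (s t) (w t) j := by
    intro j hj
    by_contra h
    exact hmin j hj ⟨by omega, h⟩
  have hal' : ∀ᶠ t in atTop, ∀ j ∈ {j | j < m}, alive n Δ G B (s t) (w t) j :=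
      (eventually_all_finite (Set.finite_lt_nat m)).2 hal
  have hgr : ∀ᶠ t in atTop, ∀ j ∈ {j | j < m}, ¬ grn n Δ G B (s t) (w t) j := by
    refine (eventually_all_finite (Set.finite_lt_nat m)).2 fun j hj => ?_
    have hj : j < m := hj
    by_contra hfr
    refine hcon ⟨j, by omega, ?_, ?_⟩
    · have hfr : ∃ᶠ t in atTop, grn n Δ G B (s t) (w t) j := by
        intro h; exact hfr h
      rw [frequently_atTop] at hfr ⊢
      intro N
      obtain ⟨t, ht, h⟩ := hfr N
      exact ⟨t + 1, by omega, by omega, h⟩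
    · obtain ⟨N, hN⟩ := eventually_atTop.1 hal'
      refine eventually_atTop.2 ⟨N + 1, fun t ht => ?_⟩
      obtain ⟨t, rfl⟩ : ∃ t', t = t' + 1 := ⟨t - 1, by omega⟩
      rintro ⟨_, i, hi, hd⟩
      exact hd (hN t (by omega) i (show i < m by omega))
  obtain ⟨N, hN⟩ := eventually_atTop.1 (hal'.and (hgr.and hB))
  have ha : ∀ t ≥ N, ∀ j < m, alive n Δ G B (s t) (w t) j := fun t ht => (hN t ht).1
  have hg : ∀ t ≥ N, ∀ j < m, ¬ grn n Δ G B (s t) (w t) j := fun t ht => (hN t ht).2.1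
  have hok : ∀ t ≥ N, ok Δ B (s t) (w t) (ρ (t + 1)) :=
    fun t ht => ⟨⟨_, hpred t⟩, (hN (t + 1) (by omega)).2.2⟩
  have hlow : ∀ t ≥ N, ∀ j < m, j ∈ (s (t + 1)).path (ρ (t + 1)) ↔
      j ∈ (s t).path (bp Δ (s t) (w t) (ρ (t + 1))) := fun t ht j hj =>
    low_iff (hinv t) hm (ha t ht) (hg t ht) (hok t ht) hj
  -- the low part stabilizes
  have hstab : ∀ j ≤ m, ∃ M ≥ N, ∀ t ≥ M, ∀ i < j,
      (i ∈ (s (t + 1)).path (ρ (t + 1)) ↔ i ∈ (s t).path (ρ t)) := by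
    intro j
    induction j with
    | zero => exact fun _ => ⟨N, le_rfl, fun t _ i hi => by omega⟩
    | succ j ih =>
      intro hj
      obtain ⟨M, hM, hst⟩ := ih (by omega)
      have hup : ∀ t ≥ M, j ∈ (s t).path (ρ t) → j ∈ (s (t + 1)).path (ρ (t + 1)) := by
        intro t ht hjt
        rw [hlow t (by omega) j (by omega)]
        refine hbest t j (fun i hi => ?_) hjt
        rw [← hlow t (by omega) i (by omega)]
        exact hst t ht i hi
      by_cases hc : ∃ t0 ≥ M, j ∈ (s t0).path (ρ t0)
      · obtain ⟨t0, ht0, hj0⟩ := hc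
        have hall : ∀ t ≥ t0, j ∈ (s t).path (ρ t) := by
          intro t ht
          induction t, ht using Nat.le_induction with
          | base => exact hj0
          | succ t ht ih => exact hup t (by omega) ih
        refine ⟨t0, by omega, fun t ht i hi => ?_⟩
        rcases Nat.lt_succ_iff_lt_or_eq.1 hi with h | h
        · exact hst t (by omega) i h
        · subst h
          exact ⟨fun _ => hall t ht, fun _ => hall (t + 1) (by omega)⟩
      · push Not at hc
        refine ⟨M, hM, fun t ht i hi => ?_⟩
        rcases Nat.lt_succ_iff_lt_or_eq.1 hi with h | h
        · exact hst t (by omega) i h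
        · subst h
          exact ⟨fun h => absurd h (hc (t + 1) (by omega)), fun h => absurd h (hc t ht)⟩
  obtain ⟨M, hM, hst⟩ := hstab m le_rfl
  have hstep : ∀ t ≥ M, ∀ x ∈ (s t).path (ρ t), m ≤ x → ∃ x' ∈ (s (t + 1)).path (ρ (t + 1)),
      m ≤ x' ∧ x' ≤ x ∧ (¬ alive n Δ G B (s t) (w t) m → x' < x) := by
    intro t ht x hx hmx
    have : ∃ y ∈ (s t).path (bp Δ (s t) (w t) (ρ (t + 1))), m ≤ y ∧ y ≤ x := by
      by_contra hc
      push Not at hc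
      have hlex := hbest t
      have h3 : ∀ i, i < m → (i ∈ (s t).path (bp Δ (s t) (w t) (ρ (t + 1))) ↔ i ∈ (s t).path (ρ t)) := by
        intro i hi
        rw [← hlow t (by omega) i hi]
        exact hst t ht i hi
      have hex2 : ∃ z, z ∈ (s t).path (ρ t) ∧ m ≤ z := ⟨x, hx, hmx⟩
      have e0 := Nat.find_spec hex2
      have e1 : Nat.find hex2 ≤ x := Nat.find_min' hex2 ⟨hx, hmx⟩
      have e2 := fun y => Nat.find_min hex2 (m := y)
      generalize Nat.find hex2 = z at *
      have : z ∈ (s t).path (bp Δ (s t) (w t) (ρ (t + 1))) := by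
        refine hlex z (fun i hi => ?_) e0.1
        rcases lt_or_ge i m with h | h
        · exact h3 i h
        · constructor
          · intro h'
            have := hc i h' h
            omega
          · intro h'
            exact absurd ⟨h', h⟩ (e2 i hi)
      have := hc z this e0.2
      omega
    obtain ⟨y, hy, hmy, hyx⟩ := this
    obtain ⟨x', k1, k2, k3, k4⟩ := high_old (ha t (by omega)) (hg t (by omega)) (hok t (by omega)) hy hmy
    exact ⟨x', k1, k2, by omega, fun h => (k4 h).trans_le hyx⟩
  have hdead : ∀ N', ∃ t ≥ N', ¬ alive n Δ G B (s t) (w t) m := by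
    have : ∃ᶠ t in atTop, ¬ alive n Δ G B (s t) (w t) m := by
      intro h; apply hmd; simpa using h
    exact frequently_atTop.1 this
  have hfall : ∀ x, ∀ t ≥ M, x ∈ (s t).path (ρ t) → m ≤ x → False := by
    intro x
    induction x using Nat.strong_induction_on with
    | _ x ih =>
      intro t ht hx hmx
      obtain ⟨t2, ht2, hd⟩ := hdead t
      have : ∀ t' ≥ t, x ∈ (s t').path (ρ t') := by
        intro t' ht'
        induction t', ht' using Nat.le_induction with
        | base => exact hx
        | succ t' ht' ih' =>
          obtain ⟨x', k1, k2, k3, _⟩ := hstep t' (by omega) x ih' hmx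
          rcases k3.lt_or_eq with h | h
          · exact (ih x' h (t' + 1) (by omega) k1 k2).elim
          · exact h ▸ k1
      obtain ⟨x', k1, k2, _, k4⟩ := hstep t2 (by omega) x (this t2 ht2) hmx
      exact ih x' (k4 hd) (t2 + 1) (by omega) k1 k2
  obtain ⟨t, ht, hGt⟩ := frequently_atTop.1 hG (M + 1)
  obtain ⟨t, rfl⟩ : ∃ t', t = t' + 1 := ⟨t - 1, by omega⟩
  obtain ⟨x, hx, hmx⟩ := high_new (hinv t) hm (ha t (by omega)) (hg t (by omega)) (hok t (by omega)) hGt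
  exact hfall x (t + 1) (by omega) hx hmx

end run

section count

variable {Q : Type} [Fintype Q] (n : ℕ)

open Classical in
noncomputable def prd (A : Set ℕ) (x : ℕ) : ℕ := Nat.findGreatest (fun k => ∃ y ∈ A, k = y + 1) x

theorem prd_lt (A : Set ℕ) (x : ℕ) : prd A x < x + 1 := by
  classical
  exact Nat.lt_succ_of_le (Nat.findGreatest_le x)

theorem prd_zero {A : Set ℕ} {x : ℕ} (h : prd A x = 0) (y : ℕ) (hy : y < x) : y ∉ A := by
  classical
  intro hA
  have := (Nat.findGreatest_eq_zero_iff.1 h) (n := y + 1) (by omega) (by omega)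
  exact this ⟨y, hA, rfl⟩

theorem prd_succ {A : Set ℕ} {x y : ℕ} (h : prd A x = y + 1) :
    y < x ∧ y ∈ A ∧ ∀ z, y < z → z < x → z ∉ A := by
  classical
  obtain ⟨h1, h2, h3⟩ := Nat.findGreatest_eq_iff.1 h
  obtain ⟨y', hy', he⟩ := h2 (by omega)
  have : y' = y := by omega
  subst this
  refine ⟨by omega, hy', fun z hz hzx hA => ?_⟩
  exact h3 (n := z + 1) (by omega) (by omega) ⟨z, hA, rfl⟩

theorem prd_congr {A C : Set ℕ} {x : ℕ} (h : ∀ y < x, y ∈ A ↔ y ∈ C) : prd A x = prd C x := by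
  classical
  unfold prd
  rw [Nat.findGreatest_eq_iff]
  obtain ⟨h1, h2, h3⟩ := (Nat.findGreatest_eq_iff (P := fun k => ∃ y ∈ C, k = y + 1) (k := x)).1 rfl
  refine ⟨h1, fun hne => ?_, fun k hk hkx => ?_⟩
  · obtain ⟨y, hy, he⟩ := h2 hne
    exact ⟨y, (h y (by omega)).2 hy, he⟩
  · rintro ⟨y, hy, he⟩
    exact h3 hk hkx ⟨y, (h y (by omega)).1 hy, he⟩

open Classical in
noncomputable def par (s : St Q) (x : ℕ) : ℕ :=
  if h : ∃ q, x ∈ s.path q then prd (s.path h.choose) x else 0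

theorem par_lt (s : St Q) (x : ℕ) : par s x < x + 1 := by
  unfold par
  split
  · exact prd_lt _ _
  · omega

theorem par_eq {s : St Q} (hs : Inv n s) {q : Q} {x : ℕ} (h : x ∈ s.path q) :
    par s x = prd (s.path q) x := by
  have hex : ∃ q, x ∈ s.path q := ⟨q, h⟩
  unfold par
  rw [dif_pos hex]
  apply prd_congr
  intro y hy
  exact ⟨hs.tree _ _ x hex.choose_spec h y hy.le, hs.tree _ _ x h hex.choose_spec y hy.le⟩

abbrev FS (Q : Type) (n : ℕ) := {s : St Q // Inv n s}

abbrev Code (Q : Type) (n : ℕ) :=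
  (Q → Fin (n + 1)) × (Fin n → Fin (n + 1)) × Set Q × Set (Fin n) × Set (Fin n)

noncomputable def code (s : FS Q n) : Code Q n :=
  (fun q => ⟨prd (s.1.path q) n, prd_lt _ _⟩,
   fun x => ⟨par s.1 x, (par_lt _ _).trans (by omega)⟩,
   s.1.reach, {x | (x : ℕ) ∈ s.1.green}, {x | (x : ℕ) ∈ s.1.bad})

theorem path_det {s s' : St Q} (hs : Inv n s) (hs' : Inv n s')
    (hp : ∀ x < n, par s x = par s' x) (q : Q) (x : ℕ) :
    x ≤ n → prd (s.path q) x = prd (s'.path q) x → ∀ y < x, y ∈ s.path q ↔ y ∈ s'.path q := by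
  induction x using Nat.strong_induction_on with
  | _ x ih =>
    intro hx he y hy
    rcases hz : prd (s.path q) x with _ | z
    · rw [hz] at he
      exact ⟨fun h => absurd h (prd_zero hz y hy), fun h => absurd h (prd_zero he.symm y hy)⟩
    · rw [hz] at he
      obtain ⟨h1, h2, h3⟩ := prd_succ hz
      obtain ⟨_, h2', h3'⟩ := prd_succ he.symm
      rcases lt_trichotomy y z with h | h | h
      · refine ih z h1 (by omega) ?_ y h
        rw [← par_eq n hs h2, ← par_eq n hs' h2', hp z (by omega)]
      · subst h
        exact ⟨fun _ => h2', fun _ => h2⟩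
      · exact ⟨fun hh => absurd hh (h3 y h hy), fun hh => absurd hh (h3' y h hy)⟩

theorem code_inj : Function.Injective (code (Q := Q) n) := by
  rintro ⟨s, hs⟩ ⟨s', hs'⟩ h
  simp only [code, Prod.mk.injEq] at h
  obtain ⟨h1, h2, h3, h4, h5⟩ := h
  apply Subtype.ext
  have hp : ∀ x < n, par s x = par s' x := fun x hx => by
    have := congrFun h2 ⟨x, hx⟩
    simpa using this
  apply St.ext
  · exact h3
  · funext q
    ext x
    have hq : prd (s.path q) n = prd (s'.path q) n := by simpa using congrFun h1 q
    constructor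
    · intro h
      exact (path_det n hs hs' hp q n le_rfl hq x (hs.lt _ _ h)).1 h
    · intro h
      exact (path_det n hs hs' hp q n le_rfl hq x (hs'.lt _ _ h)).2 h
  · ext x
    constructor
    · intro h
      have : (⟨x, hs.glt _ h⟩ : Fin n) ∈ {x : Fin n | (x : ℕ) ∈ s.green} := h
      rw [h4] at this; exact this
    · intro h
      have : (⟨x, hs'.glt _ h⟩ : Fin n) ∈ {x : Fin n | (x : ℕ) ∈ s'.green} := h
      rw [← h4] at this; exact this
  · ext x
    constructor
    · intro h
      have : (⟨x, hs.blt _ h⟩ : Fin n) ∈ {x : Fin n | (x : ℕ) ∈ s.bad} := h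
      rw [h5] at this; exact this
    · intro h
      have : (⟨x, hs'.blt _ h⟩ : Fin n) ∈ {x : Fin n | (x : ℕ) ∈ s'.bad} := h
      rw [← h5] at this; exact this

theorem fs_finite : Finite (FS Q n) := Finite.of_injective _ (code_inj n)

theorem fs_card (hn : Fintype.card Q = n) (h1 : 1 ≤ n) : Nat.card (FS Q n) ≤ (n + 1) ^ (5 * n) := by
  classical
  have h := Nat.card_le_card_of_injective _ (code_inj (Q := Q) n)
  refine h.trans ?_
  have h2 : 2 ^ n ≤ (n + 1) ^ n := Nat.pow_le_pow_left (by omega) n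
  have hc : Nat.card (Code Q n) = (n + 1) ^ n * ((n + 1) ^ n * (2 ^ n * (2 ^ n * 2 ^ n))) := by
    rw [Nat.card_eq_fintype_card]
    simp [Fintype.card_set, hn]
  rw [hc, show 5 * n = n + (n + (n + (n + n))) by ring, pow_add, pow_add, pow_add, pow_add]
  gcongr

end count

section final

theorem inf_nonempty {S : Type} [Finite S] (ρ : ℕ → S) (A : Set S) :
    (InfStates ρ ∩ A).Nonempty ↔ ∃ᶠ t in atTop, ρ t ∈ A := by
  constructor
  · rintro ⟨q, hq, hA⟩
    rw [frequently_atTop]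
    intro N
    obtain ⟨m, hm, h⟩ := hq N
    exact ⟨m, hm, h ▸ hA⟩
  · intro h
    by_contra hc
    have h1 : ∀ q ∈ A, ∀ᶠ t in atTop, ρ t ≠ q := by
      intro q hq
      by_contra hf
      refine hc ⟨q, ?_, hq⟩
      have hf : ∃ᶠ t in atTop, ρ t = q := hf
      rw [frequently_atTop] at hf
      exact hf
    have h2 : ∀ᶠ t in atTop, ∀ q ∈ A, ρ t ≠ q := (eventually_all_finite (Set.toFinite A)).2 h1
    obtain ⟨t, h3, h4⟩ := (h.and_eventually h2).exists
    exact h4 _ h3 rfl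

theorem inf_empty {S : Type} [Finite S] (ρ : ℕ → S) (A : Set S) :
    InfStates ρ ∩ A = ∅ ↔ ∀ᶠ t in atTop, ρ t ∉ A := by
  rw [← Set.not_nonempty_iff_eq_empty, inf_nonempty, not_frequently]

end final

end RabinDet

open RabinDet Filter

/-- Rabin determinization, asymptotic form `2^{O(nk log n)}`: there is a
constant `c > 0` such that every nondeterministic Rabin automaton with `n ≥ 1`
states and index size `k ≥ 1` has an equivalent deterministic Rabin automaton
with at most `2^{c·n·k·log₂(n+1)}` states and index size at most `2·n·k`. -/
theorem rabin_determinization :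
    ∃ c : ℝ, 0 < c ∧ ∀ (α Q : Type) (_ : Fintype α) (_ : Nonempty α) (_ : Fintype Q)
      (n k : ℕ), Fintype.card Q = n → 1 ≤ n → 1 ≤ k →
      ∀ (Q₀ : Set Q) (Δ : Q → α → Q → Prop) (G B : Fin k → Set Q),
      ∃ (m kB : ℕ) (init : Fin m) (δ : Fin m → α → Fin m)
        (G' B' : Fin kB → Set (Fin m)),
        (m : ℝ) ≤ (2 : ℝ) ^ (c * (n : ℝ) * (k : ℝ) * Real.logb 2 ((n : ℝ) + 1)) ∧
        kB ≤ 2 * n * k ∧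
        ∀ w : ℕ → α,
          (∃ ρ : ℕ → Q, ρ 0 ∈ Q₀ ∧ (∀ i : ℕ, Δ (ρ i) (w i) (ρ (i + 1))) ∧
            ∃ i : Fin k, (InfStates ρ ∩ G i).Nonempty ∧ InfStates ρ ∩ B i = ∅) ↔
          (∃ ρ : ℕ → Fin m, ρ 0 = init ∧ (∀ i : ℕ, ρ (i + 1) = δ (ρ i) (w i)) ∧
            ∃ i : Fin kB, (InfStates ρ ∩ G' i).Nonempty ∧ InfStates ρ ∩ B' i = ∅) := by
  classical
  refine ⟨5, by norm_num, ?_⟩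
  intro α Q _ _ _ n k hn h1 hk Q₀ Δ G B
  have hfin : Finite (FS Q n) := fs_finite n
  let X := Fin k → FS Q n
  have hX : Finite X := inferInstance
  let e : X ≃ Fin (Nat.card X) := Finite.equivFin X
  let x0 : X := fun _ => ⟨initSt Q₀, init_inv n Q₀⟩
  let st : X → α → X := fun x a i => ⟨step n Δ (G i) (B i) (x i).1 a, step_inv hn (x i).2⟩
  let f : Fin k × Fin n ≃ Fin (k * n) := finProdFinEquiv
  refine ⟨Nat.card X, k * n, e x0, fun y a => e (st (e.symm y) a),
    fun i => {y | ((f.symm i).2 : ℕ) ∈ ((e.symm y) (f.symm i).1).1.green},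
    fun i => {y | ((f.symm i).2 : ℕ) ∈ ((e.symm y) (f.symm i).1).1.bad}, ?_, ?_, ?_⟩
  · have hc : Nat.card X ≤ (n + 1) ^ (5 * n * k) := by
      have : Nat.card X = Nat.card (FS Q n) ^ k := by
        simp [X, Nat.card_fun]
      rw [this, pow_mul]
      exact Nat.pow_le_pow_left (fs_card n hn h1) k
    have hpos : (0 : ℝ) < (n : ℝ) + 1 := by positivity
    calc (Nat.card X : ℝ) ≤ ((n : ℝ) + 1) ^ (5 * n * k) := by exact_mod_cast hc
      _ = (2 : ℝ) ^ (5 * (n : ℝ) * (k : ℝ) * Real.logb 2 ((n : ℝ) + 1)) := by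
        rw [mul_comm (5 * (n : ℝ) * (k : ℝ)), Real.rpow_mul (by norm_num),
          Real.rpow_logb (by norm_num) (by norm_num) hpos, ← Real.rpow_natCast]
        push_cast
        rfl
  · nlinarith [Nat.zero_le (n * k)]
  · intro w
    let sr : ℕ → X := fun t i => ⟨sq n Δ (G i) (B i) Q₀ w t, sq_inv hn t⟩
    have hrun : ∀ ρ : ℕ → Fin (Nat.card X), (ρ 0 = e x0 ∧
        ∀ i : ℕ, ρ (i + 1) = e (st (e.symm (ρ i)) (w i))) ↔ ρ = fun t => e (sr t) := by
      intro ρ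
      constructor
      · rintro ⟨ha, hb⟩
        funext t
        induction t with
        | zero => exact ha
        | succ t ih => rw [hb, ih, e.symm_apply_apply]; rfl
      · rintro rfl
        refine ⟨rfl, fun i => ?_⟩
        simp only [e.symm_apply_apply]
        rfl
    constructor
    · rintro ⟨ρ, h0, hΔ, i, hG, hB⟩
      rw [inf_nonempty] at hG
      rw [inf_empty] at hB
      obtain ⟨j, hj, hg, hb⟩ := complete hn ρ h0 hΔ hG hB
      obtain ⟨r0, r1⟩ := (hrun _).2 rfl
      refine ⟨fun t => e (sr t), r0, r1, f (i, ⟨j, hj⟩), ?_, ?_⟩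
      · rw [inf_nonempty]
        simpa [sr] using hg
      · rw [inf_empty]
        simpa [sr] using hb
    · rintro ⟨ρ, r0, r1, i, hG, hB⟩
      have hρ := (hrun ρ).1 ⟨r0, r1⟩
      subst hρ
      rw [inf_nonempty] at hG
      rw [inf_empty] at hB
      obtain ⟨ρ, h0, hΔ, hg, hb⟩ := sound (Δ := Δ) (G := G (f.symm i).1) (B := B (f.symm i).1)
        (Q₀ := Q₀) (w := w) hn (f.symm i).2.2
        (by simpa [sr] using hG) (by simpa [sr] using hB)
      exact ⟨ρ, h0, hΔ, (f.symm i).1, (inf_nonempty _ _).2 hg, (inf_empty _ _).2 hb⟩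
end

section
/- Let Q be a finite set with |Q| = n ≥ 1 and let μ ≥ 0 be a natural number. Let T be a finite rooted tree with node set V, and let S : V → 2^Q and h : V → ℕ be labelings satisfying: (i) S(v) ≠ ∅ for every v ∈ V; (ii) for every non-leaf node v, S(v) = ⋃ { S(v') ∣ v' a child of v } and the sets S(v') for distinct children v' of v are pairwise disjoint; (iii) for every non-root node v with h(v) = 0, S(v) ⊊ S(parent(v)); (iv) h(root) = 0; (v) on every path from the root to a leaf, at most μ nodes v satisfy h(v) ≠ 0; (vi) every non-leaf node has at least one child v' with h(v') ≠ 0. Then |V| ≤ n·(μ+1). -/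
/-- Size bound for (reduced) Safra trees for Streett determinization.
A finite rooted tree is encoded by a node type `V`, a root, and a parent
function that fixes the root and reaches the root from every node by
iteration; the children of `v` are the non-root nodes whose parent is `v`,
and a leaf is a node with no children. Given a state labeling `S` and an
index labeling `h` satisfying the structural constraints (i)–(vi), the tree
has at most `n·(μ+1)` nodes. -/
theorem safra_tree_size_bound
    {Q V : Type*} [Fintype Q] [Fintype V] {n μ : ℕ}
    (hn : Fintype.card Q = n) (hn1 : 1 ≤ n)
    (root : V) (parent : V → V)
    (hroot : parent root = root)
    (hreach : ∀ v : V, ∃ m : ℕ, parent^[m] v = root)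
    (S : V → Set Q) (h : V → ℕ)
    -- (i) every state label is nonempty
    (hne : ∀ v : V, (S v).Nonempty)
    -- (ii) at every non-leaf node, the state label is the union of the
    -- children's state labels, and children's state labels are pairwise disjoint
    (hunion : ∀ v : V, {v' : V | v' ≠ root ∧ parent v' = v}.Nonempty →
      S v = ⋃ v' ∈ {v' : V | v' ≠ root ∧ parent v' = v}, S v')
    (hdisj : ∀ v v₁ v₂ : V, v₁ ≠ root → parent v₁ = v → v₂ ≠ root →
      parent v₂ = v → v₁ ≠ v₂ → Disjoint (S v₁) (S v₂))
    -- (iii) a non-root node with index label 0 has a strictly smaller state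
    -- label than its parent
    (hzero : ∀ v : V, v ≠ root → h v = 0 → S v ⊂ S (parent v))
    -- (iv) the root has index label 0
    (hr0 : h root = 0)
    -- (v) on every path from the root to a leaf, at most μ nodes have a
    -- nonzero index label
    (hpath : ∀ ℓ : V, {v' : V | v' ≠ root ∧ parent v' = ℓ} = ∅ →
      ({u : V | (∃ m : ℕ, parent^[m] ℓ = u) ∧ h u ≠ 0}).ncard ≤ μ)
    -- (vi) every non-leaf node has a child with nonzero index label
    (hchildnz : ∀ v : V, {v' : V | v' ≠ root ∧ parent v' = v}.Nonempty →
      ∃ v' : V, v' ≠ root ∧ parent v' = v ∧ h v' ≠ 0) :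
    Fintype.card V ≤ n * (μ + 1) := by
  classical
  have hrootit : ∀ k : ℕ, parent^[k] root = root := fun k => Function.iterate_fixed hroot k
  have hacyc : ∀ (v : V) (m : ℕ), parent^[m] (parent v) = v → v = root := by
    intro v m hm
    obtain ⟨k, hk⟩ := hreach v
    have h1 : parent^[m + 1] v = v := by rw [Function.iterate_succ_apply]; exact hm
    have h2 : (parent^[m + 1])^[k] v = v := Function.iterate_fixed h1 k
    rw [← Function.iterate_mul] at h2
    have h3 : (m + 1) * k = m * k + k := by ring
    rw [h3, Function.iterate_add_apply, hk, hrootit] at h2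
    exact h2.symm
  let A : V → Set V := fun v => {u : V | (∃ m : ℕ, parent^[m] v = u) ∧ h u ≠ 0}
  have hAsub : ∀ v, A (parent v) ⊆ A v := by
    rintro v u ⟨⟨m, hm⟩, hu⟩
    exact ⟨⟨m + 1, by rw [Function.iterate_succ_apply]; exact hm⟩, hu⟩
  have hc1 : ∀ v, (A (parent v)).ncard ≤ (A v).ncard := fun v =>
    Set.ncard_le_ncard (hAsub v) (Set.toFinite _)
  have hc2 : ∀ v, v ≠ root → h v ≠ 0 → (A (parent v)).ncard + 1 ≤ (A v).ncard := by
    intro v hv hh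
    refine Set.ncard_lt_ncard ⟨hAsub v, fun hs => ?_⟩ (Set.toFinite _)
    have hvA : v ∈ A v := ⟨⟨0, rfl⟩, hh⟩
    obtain ⟨⟨m, hm⟩, _⟩ := hs hvA
    exact hv (hacyc v m hm)
  let s : V → ℤ := fun v => ((S v).toFinset.card : ℤ)
  have hs1 : ∀ v, 1 ≤ s v := by
    intro v
    have : 0 < (S v).toFinset.card := Finset.card_pos.mpr (by simpa using hne v)
    show (1 : ℤ) ≤ ((S v).toFinset.card : ℤ)
    exact_mod_cast this
  let C : V → Finset V := fun v => Finset.univ.filter (fun w => w ≠ root ∧ parent w = v)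
  have hCm : ∀ v w, w ∈ C v ↔ w ≠ root ∧ parent w = v := by intro v w; simp [C]
  have hsum : ∀ v, (C v).Nonempty → ∑ w ∈ C v, s w ≤ s v := by
    rintro v ⟨w0, hw0⟩
    have hd : ((C v : Finset V) : Set V).PairwiseDisjoint (fun w => (S w).toFinset) := by
      intro a ha b hb hab
      have ha := (hCm v a).1 ha
      have hb := (hCm v b).1 hb
      exact Set.disjoint_toFinset.2 (hdisj v a b ha.1 ha.2 hb.1 hb.2 hab)
    have hb := Finset.card_biUnion hd
    have hle : ((C v).biUnion (fun w => (S w).toFinset)).card ≤ (S v).toFinset.card := by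
      apply Finset.card_le_card
      intro q hq
      obtain ⟨w, hw, hq⟩ := Finset.mem_biUnion.1 hq
      rw [Set.mem_toFinset] at hq ⊢
      rw [hunion v ⟨w0, (hCm v w0).1 hw0⟩]
      exact Set.mem_biUnion ((hCm v w).1 hw) hq
    rw [hb] at hle
    show ∑ w ∈ C v, ((S w).toFinset.card : ℤ) ≤ ((S v).toFinset.card : ℤ)
    exact_mod_cast hle
  let c : V → ℤ := fun v => ((A v).ncard : ℤ)
  let P : V → ℤ := fun v => s v * (μ + 1 - c v)
  have hleafc : ∀ v, C v = ∅ → c v ≤ μ := by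
    intro v hv
    have : (A v).ncard ≤ μ := by
      apply hpath v
      ext w
      have := hCm v w
      rw [hv] at this
      simpa using this
    show ((A v).ncard : ℤ) ≤ μ
    exact_mod_cast this
  have hcle : ∀ v, c v ≤ μ := by
    -- a node maximising c is a leaf
    obtain ⟨m, -, hm⟩ := Finset.exists_max_image Finset.univ c ⟨root, Finset.mem_univ _⟩
    have hmC : C m = ∅ := by
      by_contra hne'
      obtain ⟨w0, hw0⟩ := Finset.nonempty_iff_ne_empty.2 hne'
      obtain ⟨j, hj1, hj2, hj3⟩ := hchildnz m ⟨w0, (hCm m w0).1 hw0⟩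
      have h1 := hc2 j hj1 hj3
      rw [hj2] at h1
      have h2 : ((A j).ncard : ℤ) ≤ ((A m).ncard : ℤ) := hm j (Finset.mem_univ _)
      omega
    intro v
    exact (hm v (Finset.mem_univ _)).trans (hleafc m hmC)
  have hdrop : ∀ v, 1 + ∑ w ∈ C v, P w ≤ P v := by
    intro v
    rcases (C v).eq_empty_or_nonempty with he | hn
    · have h1 := hleafc v he
      have h2 := hs1 v
      rw [he, Finset.sum_empty]
      show 1 + 0 ≤ s v * (μ + 1 - c v)
      nlinarith
    · obtain ⟨w0, hw0⟩ := id hn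
      obtain ⟨j, hj1, hj2, hj3⟩ := hchildnz v ⟨w0, (hCm v w0).1 hw0⟩
      have hjC : j ∈ C v := (hCm v j).2 ⟨hj1, hj2⟩
      have hb : ∑ w ∈ C v, P w ≤ ∑ w ∈ C v, (s w * (μ + 1 - c v) - if w = j then 1 else 0) := by
        apply Finset.sum_le_sum
        intro w hw
        obtain ⟨hw1, hw2⟩ := (hCm v w).1 hw
        have h2 := hs1 w
        show s w * (μ + 1 - c w) ≤ _
        split_ifs with hwj
        · have h3 : c v + 1 ≤ c w := by
            have := hc2 w hw1 (hwj ▸ hj3)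
            rw [hw2] at this
            show ((A v).ncard : ℤ) + 1 ≤ ((A w).ncard : ℤ)
            exact_mod_cast this
          nlinarith
        · have h3 : c v ≤ c w := by
            have := hc1 w
            rw [hw2] at this
            show ((A v).ncard : ℤ) ≤ ((A w).ncard : ℤ)
            exact_mod_cast this
          nlinarith
      rw [Finset.sum_sub_distrib, ← Finset.sum_mul, Finset.sum_ite_eq' (C v) j, if_pos hjC] at hb
      have h4 := hsum v hn
      have h5 := hcle v
      show _ ≤ s v * (μ + 1 - c v)
      nlinarith
  have htot : ∑ v, (1 + ∑ w ∈ C v, P w) ≤ ∑ v, P v := Finset.sum_le_sum fun v _ => hdrop v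
  have hfib : ∑ v, ∑ w ∈ C v, P w = ∑ w ∈ Finset.univ.filter (fun w => w ≠ root), P w := by
    rw [← Finset.sum_fiberwise (Finset.univ.filter (fun w => w ≠ root)) parent P]
    apply Finset.sum_congr rfl
    intro v _
    rw [Finset.filter_filter]
  have hsplit : ∑ v, P v = P root + ∑ w ∈ Finset.univ.filter (fun w => w ≠ root), P w := by
    rw [Finset.filter_ne', Finset.add_sum_erase _ _ (Finset.mem_univ root)]
  rw [Finset.sum_add_distrib, hfib, hsplit] at htot
  simp only [Finset.sum_const, Finset.card_univ, nsmul_eq_mul, mul_one] at htot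
  have hsr : s root ≤ n := by
    have : (S root).toFinset.card ≤ n := hn ▸ Finset.card_le_univ _
    show ((S root).toFinset.card : ℤ) ≤ n
    exact_mod_cast this
  have hc0 : 0 ≤ c root := Int.natCast_nonneg _
  have hPr : P root ≤ n * (μ + 1) := by
    show s root * (μ + 1 - c root) ≤ n * (μ + 1)
    have := hs1 root
    have : (0:ℤ) ≤ μ := Int.natCast_nonneg _
    nlinarith
  have : (Fintype.card V : ℤ) ≤ n * (μ + 1) := by linarith
  exact_mod_cast this
end
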